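/- For every dimension d ≥ 1, every smoothness α > 1 and constants M ≥ 2, R > 1, there exist a constant C > 0 and an integer n₀ (depending only on d, α, M, R) such that for every n ≥ n₀ there exists a measurable estimator T̂ : (ℝ^d)^n × (ℝ^d)^n × ℝ^d → ℝ^d with the property that for every admissible pair (P, T₀), E[∫_{[0,1]^d} ‖T̂(X_{1:n}, Y_{1:n}, x) − T₀(x)‖₂² dP(x)] ≤ C · max(n^{−2α/(2α−2+d)} (log n)², n^{−1}), where the expectation is over independent samples X_{1:n} ∼ P^{⊗n} and Y_{1:n} ∼ ((T₀)_# P)^{⊗n}. -/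

import Mathlib

open MeasureTheory Set RealInnerProductSpace
open scoped ENNReal

noncomputable section

/-- The closed unit cube `[0,1]^d` in `ℝ^d`. -/
def unitCube (d : ℕ) : Set (EuclideanSpace ℝ (Fin d)) :=
  {x | ∀ i, x i ∈ Set.Icc (0 : ℝ) 1}

/-- The enlarged cube `Ω̃ = [−1,2]^d` in `ℝ^d`. -/
def bigBox (d : ℕ) : Set (EuclideanSpace ℝ (Fin d)) :=
  {x | ∀ i, x i ∈ Set.Icc (-1 : ℝ) 2}

/-- The (topological) support of a measure: the set of points all of whose open
neighbourhoods have positive measure. -/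
def mSupport {X : Type*} [TopologicalSpace X] [MeasurableSpace X] (μ : Measure X) : Set X :=
  {x | ∀ U : Set X, IsOpen U → x ∈ U → 0 < μ U}

/-- The partial derivative `∂f/∂xᵢ` of `f : ℝ^d → ℝ`. -/
def pderiv1 (d : ℕ) (i : Fin d) (f : EuclideanSpace ℝ (Fin d) → ℝ) :
    EuclideanSpace ℝ (Fin d) → ℝ :=
  fun x => fderiv ℝ f x (EuclideanSpace.single i 1)

/-- The iterated partial derivative `(∂/∂xᵢ)^n f`. -/
def pderivIter (d : ℕ) (i : Fin d) : ℕ → (EuclideanSpace ℝ (Fin d) → ℝ) →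
    (EuclideanSpace ℝ (Fin d) → ℝ)
  | 0, f => f
  | (n + 1), f => pderiv1 d i (pderivIter d i n f)

/-- The multi-index partial derivative `∂^♭ f = ∂^{♭₁}_{x₁} ⋯ ∂^{♭_d}_{x_d} f`. -/
def multiDeriv (d : ℕ) (b : Fin d → ℕ) (f : EuclideanSpace ℝ (Fin d) → ℝ) :
    EuclideanSpace ℝ (Fin d) → ℝ :=
  (List.finRange d).foldr (fun i g => pderivIter d i (b i) g) f

/-- The finite set of multi-indices `♭ : Fin d → ℕ` of total degree `|♭| ≤ k`. -/
def multiIdxLe (d k : ℕ) : Finset (Fin d → ℕ) :=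
  (Fintype.piFinset fun _ : Fin d => Finset.range (k + 1)).filter fun b => (∑ i, b i) ≤ k

/-- The finite set of multi-indices `♭ : Fin d → ℕ` of total degree `|♭| = k`. -/
def multiIdxEq (d k : ℕ) : Finset (Fin d → ℕ) :=
  (Fintype.piFinset fun _ : Fin d => Finset.range (k + 1)).filter fun b => (∑ i, b i) = k

/-- The Hölder norm bound `‖T‖_{C^α(Ω)} ≤ R` for a map `T : ℝ^d → ℝ^d`: there are bounds
`B ♭ i` on `sup_{x ∈ Ω} |∂^♭ T_i(x)|` for `|♭| ≤ ⌊α⌋` and bounds `H ♭ i` on the Hölder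
quotients `sup_{x ≠ y ∈ Ω} |∂^♭ T_i(x) − ∂^♭ T_i(y)|/‖x − y‖^{α−⌊α⌋}` for `|♭| = ⌊α⌋`,
whose total sum over coordinates `i` and multi-indices is at most `R`. -/
def HolderNormLE (d : ℕ) (α : ℝ) (Ω : Set (EuclideanSpace ℝ (Fin d)))
    (T : EuclideanSpace ℝ (Fin d) → EuclideanSpace ℝ (Fin d)) (R : ℝ) : Prop :=
  ∃ B H : (Fin d → ℕ) → Fin d → ℝ,
    (∀ b ∈ multiIdxLe d ⌊α⌋₊, ∀ i : Fin d, ∀ x ∈ Ω,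
      |multiDeriv d b (fun z => T z i) x| ≤ B b i) ∧
    (∀ b ∈ multiIdxEq d ⌊α⌋₊, ∀ i : Fin d, ∀ x ∈ Ω, ∀ y ∈ Ω, x ≠ y →
      |multiDeriv d b (fun z => T z i) x - multiDeriv d b (fun z => T z i) y|
        ≤ H b i * ‖x - y‖ ^ (α - (⌊α⌋₊ : ℝ))) ∧
    (∑ i : Fin d,
      ((∑ b ∈ multiIdxLe d ⌊α⌋₊, B b i) + ∑ b ∈ multiIdxEq d ⌊α⌋₊, H b i)) ≤ R

/-- Membership in the class `𝓜(M)` of source distributions: `P` is a probability measure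
with (topological) support equal to `[0,1]^d`, absolutely continuous with respect to
Lebesgue measure with a density `ρ_P` satisfying `M⁻¹ ≤ ρ_P ≤ M` a.e. on `[0,1]^d`
(and vanishing a.e. outside). -/
structure MemM (d : ℕ) (M : ℝ) (P : Measure (EuclideanSpace ℝ (Fin d))) : Prop where
  prob : IsProbabilityMeasure P
  density : ∃ ρ : EuclideanSpace ℝ (Fin d) → ℝ, Measurable ρ ∧
    P = volume.withDensity (fun x => ENNReal.ofReal (ρ x)) ∧
    (∀ᵐ x ∂(volume : Measure (EuclideanSpace ℝ (Fin d))),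
      (x ∈ unitCube d → M⁻¹ ≤ ρ x ∧ ρ x ≤ M) ∧ (x ∉ unitCube d → ρ x = 0))
  supp : mSupport P = unitCube d

/-- Membership in the class `𝓣_α(M, R)` of transport maps on `Ω̃ = [−1,2]^d`: `T = ∇f` for a
differentiable convex `f`, `‖T‖ ≤ M` on `Ω̃`, `M⁻¹‖v‖² ≤ ⟨DT(x)v, v⟩ ≤ M‖v‖²` on `Ω̃`, and
`T` is `⌊α⌋`-times differentiable with `‖T‖_{C^α(Ω̃)} ≤ R`. -/
structure MemT (d : ℕ) (α M R : ℝ)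
    (T : EuclideanSpace ℝ (Fin d) → EuclideanSpace ℝ (Fin d)) : Prop where
  isGradient : ∃ f : EuclideanSpace ℝ (Fin d) → ℝ,
    ConvexOn ℝ (bigBox d) f ∧ ∀ x ∈ bigBox d, HasGradientAt f (T x) x
  bounded : ∀ x ∈ bigBox d, ‖T x‖ ≤ M
  derivBounds : ∀ x ∈ bigBox d,
    ∃ A : EuclideanSpace ℝ (Fin d) →L[ℝ] EuclideanSpace ℝ (Fin d), HasFDerivAt T A x ∧
      ∀ v : EuclideanSpace ℝ (Fin d),
        M⁻¹ * ‖v‖ ^ 2 ≤ ⟪A v, v⟫ ∧ ⟪A v, v⟫ ≤ M * ‖v‖ ^ 2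
  smooth : ∀ x ∈ bigBox d, ContDiffAt ℝ (⌊α⌋₊ : ℕ∞) T x
  holder : HolderNormLE d α (bigBox d) T R

/-- A pair `(P, T₀)` is admissible when `P ∈ 𝓜(M)`, `T₀ ∈ 𝓣_α(M, R)` (with `T₀` Borel
measurable) and the support of the pushforward `(T₀)_# P` equals `[0,1]^d`. -/
structure Admissible (d : ℕ) (α M R : ℝ) (P : Measure (EuclideanSpace ℝ (Fin d)))
    (T₀ : EuclideanSpace ℝ (Fin d) → EuclideanSpace ℝ (Fin d)) : Prop where
  memM : MemM d M P
  memT : MemT d α M R T₀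
  meas : Measurable T₀
  pushSupp : mSupport (P.map T₀) = unitCube d

/-- The risk `E[∫ ‖T̂(X_{1:n}, Y_{1:n}, x) − T₀(x)‖² dP(x)]` of an estimator `T̂`, where the
expectation is over `X_{1:n} ∼ P^{⊗n}` and, independently, `Y_{1:n} ∼ ((T₀)_# P)^{⊗n}`. -/
def transportRisk (d n : ℕ) (P : Measure (EuclideanSpace ℝ (Fin d)))
    (T₀ : EuclideanSpace ℝ (Fin d) → EuclideanSpace ℝ (Fin d))
    (Th : (Fin n → EuclideanSpace ℝ (Fin d)) → (Fin n → EuclideanSpace ℝ (Fin d)) →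
      EuclideanSpace ℝ (Fin d) → EuclideanSpace ℝ (Fin d)) : ℝ≥0∞ :=
  ∫⁻ xs, (∫⁻ ys, (∫⁻ x, (‖Th xs ys x - T₀ x‖₊ : ℝ≥0∞) ^ 2 ∂P)
      ∂(Measure.pi fun _ : Fin n => P.map T₀))
    ∂(Measure.pi fun _ : Fin n => P)

/-- Euclidean space shorthand. -/
abbrev Eu (d : ℕ) := EuclideanSpace ℝ (Fin d)

/-! ### Multi-index derivatives -/

lemma pderiv1_contDiffAt {d : ℕ} (i : Fin d) {f : Eu d → ℝ} {x : Eu d} {m : ℕ}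
    (h : ContDiffAt ℝ ((m + 1 : ℕ) : ℕ∞) f x) : ContDiffAt ℝ (m : ℕ∞) (pderiv1 d i f) x := by
  have h1 : ContDiffAt ℝ (m : ℕ∞) (fderiv ℝ f) x := by
    apply h.fderiv_right
    norm_cast
  exact h1.clm_apply contDiffAt_const

lemma pderivIter_contDiffAt {d : ℕ} (i : Fin d) {f : Eu d → ℝ} {x : Eu d} (s : ℕ) :
    ∀ {m : ℕ}, ContDiffAt ℝ ((m + s : ℕ) : ℕ∞) f x →
      ContDiffAt ℝ (m : ℕ∞) (pderivIter d i s f) x := by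
  induction s with
  | zero => intro m h; simpa [pderivIter] using h
  | succ s ih =>
    intro m h
    apply pderiv1_contDiffAt
    apply ih
    rwa [show m + 1 + s = m + (s + 1) by omega]

lemma foldr_contDiffAt {d : ℕ} (b : Fin d → ℕ) {f : Eu d → ℝ} {x : Eu d} (l : List (Fin d)) :
    ∀ {m : ℕ}, ContDiffAt ℝ ((m + (l.map b).sum : ℕ) : ℕ∞) f x →
      ContDiffAt ℝ (m : ℕ∞) (l.foldr (fun i g => pderivIter d i (b i) g) f) x := by
  induction l with
  | nil => intro m h; simpa using h
  | cons i l ih =>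
    intro m h
    simp only [List.foldr_cons]
    apply pderivIter_contDiffAt
    apply ih
    rw [List.map_cons, List.sum_cons] at h
    rwa [show m + b i + (l.map b).sum = m + (b i + (l.map b).sum) by omega]

lemma multiDeriv_contDiffAt {d : ℕ} (b : Fin d → ℕ) {f : Eu d → ℝ} {x : Eu d} {m : ℕ}
    (h : ContDiffAt ℝ ((m + ∑ i, b i : ℕ) : ℕ∞) f x) :
    ContDiffAt ℝ (m : ℕ∞) (multiDeriv d b f) x := by
  apply foldr_contDiffAt
  convert h using 4
  rw [← List.ofFn_eq_map, List.sum_ofFn]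

lemma foldr_zero {d : ℕ} (b : Fin d → ℕ) (f : Eu d → ℝ) (l : List (Fin d))
    (h : ∀ j ∈ l, b j = 0) : l.foldr (fun i g => pderivIter d i (b i) g) f = f := by
  induction l with
  | nil => rfl
  | cons i l ih =>
    simp only [List.foldr_cons]
    rw [ih (fun j hj => h j (List.mem_cons_of_mem _ hj)), h i List.mem_cons_self]
    rfl

lemma foldr_congr_idx {d : ℕ} (b b' : Fin d → ℕ) (f : Eu d → ℝ) (l : List (Fin d))
    (h : ∀ j ∈ l, b j = b' j) : l.foldr (fun i g => pderivIter d i (b i) g) f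
      = l.foldr (fun i g => pderivIter d i (b' i) g) f := by
  induction l with
  | nil => rfl
  | cons i l ih =>
    simp only [List.foldr_cons]
    rw [ih (fun j hj => h j (List.mem_cons_of_mem _ hj)), h i List.mem_cons_self]

lemma multiDeriv_zero {d : ℕ} (f : Eu d → ℝ) : multiDeriv d 0 f = f :=
  foldr_zero _ _ _ (fun _ _ => rfl)

lemma multiDeriv_add_single {d : ℕ} (b : Fin d → ℕ) (i : Fin d) (f : Eu d → ℝ)
    (hb : ∀ j, j < i → b j = 0) :
    multiDeriv d (b + Pi.single i 1) f = pderiv1 d i (multiDeriv d b f) := by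
  obtain ⟨l1, l2, hl⟩ := List.append_of_mem (List.mem_finRange i)
  have hp : (l1 ++ i :: l2).Pairwise (· < ·) := hl ▸ List.pairwise_lt_finRange d
  rw [List.pairwise_append] at hp
  obtain ⟨_, h2, h3⟩ := hp
  rw [List.pairwise_cons] at h2
  have hlt1 : ∀ j ∈ l1, j < i := fun j hj => h3 j hj i List.mem_cons_self
  have hlt2 : ∀ j ∈ l2, i < j := h2.1
  unfold multiDeriv
  rw [hl, List.foldr_append, List.foldr_append]
  rw [foldr_zero _ _ l1, foldr_zero b _ l1]
  · simp only [List.foldr_cons]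
    rw [foldr_congr_idx (b + Pi.single i 1) b f l2]
    · simp [pderivIter]
    · intro j hj
      simp [Pi.single_eq_of_ne (hlt2 j hj).ne']
  · intro j hj; exact hb j (hlt1 j hj)
  · intro j hj
    simp [Pi.single_eq_of_ne (hlt1 j hj).ne, hb j (hlt1 j hj)]

/-- Derivative of `multiDeriv` along a coordinate line. -/
lemma multiDeriv_hasDerivAt {d : ℕ} (b : Fin d → ℕ) (i : Fin d) {f : Eu d → ℝ} {k : ℕ}
    (hk : (∑ j, b j) < k) (hb : ∀ j, j < i → b j = 0) (y : Eu d) (t : ℝ)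
    (h : ContDiffAt ℝ (k : ℕ∞) f (y + t • EuclideanSpace.single i (1 : ℝ))) :
    HasDerivAt (fun s : ℝ => multiDeriv d b f (y + s • EuclideanSpace.single i (1 : ℝ)))
      (multiDeriv d (b + Pi.single i 1) f (y + t • EuclideanSpace.single i (1 : ℝ))) t := by
  rw [multiDeriv_add_single b i f hb]
  have h1 : ContDiffAt ℝ ((1 : ℕ) : ℕ∞) (multiDeriv d b f)
      (y + t • EuclideanSpace.single i (1 : ℝ)) := by
    apply multiDeriv_contDiffAt
    apply h.of_le
    norm_cast
    omega
  have h2 : DifferentiableAt ℝ (multiDeriv d b f) (y + t • EuclideanSpace.single i (1 : ℝ)) :=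
    h1.differentiableAt (by norm_num)
  have h3 : HasDerivAt (fun s : ℝ => y + s • (EuclideanSpace.single i (1 : ℝ) : Eu d))
      (EuclideanSpace.single i (1 : ℝ)) t := by
    simpa using ((hasDerivAt_id t).smul_const (EuclideanSpace.single i (1 : ℝ) : Eu d)).const_add y
  exact h2.hasFDerivAt.comp_hasDerivAt t h3

/-! ### One-dimensional Taylor-type estimate -/

/-- If the derivatives at the left end point are small and the top derivative oscillates little,
then the function is small. -/
lemma taylor_one_dim {r α C H s : ℝ} {k : ℕ} (hr : 0 < r) (hs0 : 0 ≤ s) (hs : s ≤ r)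
    (hC : 0 ≤ C) (hH : 0 ≤ H) (φ : ℕ → ℝ → ℝ) (m₀ : ℕ) (n : ℕ) (hn : m₀ + n = k)
    (hder : ∀ m < n, ∀ t ∈ Icc 0 s, HasDerivAt (φ m) (φ (m + 1) t) t)
    (h0 : ∀ m ≤ n, |φ m 0| ≤ C * r ^ (α - (m₀ + m : ℕ)))
    (htop : ∀ t ∈ Icc 0 s, |φ n t - φ n 0| ≤ H * r ^ (α - (k : ℕ))) :
    |φ 0 s| ≤ (C * (k + 1) + H) * r ^ (α - (m₀ : ℕ)) := by
  have key : ∀ j ≤ n, ∀ t ∈ Icc 0 s, |φ (n - j) t| ≤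
      (C * (j + 1) + H) * r ^ (α - (m₀ + (n - j) : ℕ)) := by
    intro j
    induction j with
    | zero =>
      intro _ t ht
      have h1 := htop t ht
      have h2 := h0 n le_rfl
      rw [hn] at h2
      simp only [Nat.sub_zero, hn, Nat.cast_zero, zero_add, mul_one]
      calc |φ n t| = |(φ n t - φ n 0) + φ n 0| := by ring_nf
        _ ≤ |φ n t - φ n 0| + |φ n 0| := abs_add_le _ _
        _ ≤ _ := by linarith
    | succ j ih =>
      intro hj t ht
      have ih' := ih (by omega)
      have e1 : n - (j + 1) + 1 = n - j := by omega
      have hd := hder (n - (j + 1)) (by omega)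
      rw [e1] at hd
      set B := (C * (j + 1) + H) * r ^ (α - (m₀ + (n - j) : ℕ)) with hB
      have hmv := (convex_Icc 0 s).norm_image_sub_le_of_norm_hasDerivWithin_le (C := B)
        (fun u hu => (hd u hu).hasDerivWithinAt) (fun u hu => ih' u hu)
        (left_mem_Icc.2 hs0) ht
      simp only [Real.norm_eq_abs, sub_zero] at hmv
      have h2 := h0 (n - (j + 1)) (by omega)
      have hpow : r ^ (α - (m₀ + (n - j) : ℕ)) * r = r ^ (α - (m₀ + (n - (j + 1)) : ℕ)) := by
        rw [← Real.rpow_add_one hr.ne']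
        congr 1
        have : m₀ + (n - j) = m₀ + (n - (j + 1)) + 1 := by omega
        rw [this]; push_cast; ring
      have hB0 : 0 ≤ B := by positivity
      have ht' : |t| ≤ r := by rw [abs_of_nonneg ht.1]; exact ht.2.trans hs
      have h3 : B * |t| ≤ B * r := mul_le_mul_of_nonneg_left ht' hB0
      have h4 : B * r = (C * (j + 1) + H) * r ^ (α - (m₀ + (n - (j + 1)) : ℕ)) := by
        rw [hB, mul_assoc, hpow]
      calc |φ (n - (j + 1)) t|
          = |(φ (n - (j + 1)) t - φ (n - (j + 1)) 0) + φ (n - (j + 1)) 0| := by ring_nf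
        _ ≤ |φ (n - (j + 1)) t - φ (n - (j + 1)) 0| + |φ (n - (j + 1)) 0| := abs_add_le _ _
        _ ≤ _ := by push_cast at *; linarith
  have hfin := key n le_rfl s ⟨hs0, le_rfl⟩
  simp only [Nat.sub_self, add_zero] at hfin
  refine hfin.trans ?_
  apply mul_le_mul_of_nonneg_right _ (by positivity)
  have : (n : ℝ) ≤ k := by exact_mod_cast (by omega : n ≤ k)
  nlinarith

/-- Points interpolating between `c` and `x`: the first `i` coordinates are those of `x`. -/
def mixPt {d : ℕ} (c x : Eu d) (i : ℕ) : Eu d :=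
  WithLp.toLp 2 (fun j : Fin d => if (j : ℕ) < i then x j else c j)

lemma single_apply_ne {d : ℕ} {i j : Fin d} (h : j ≠ i) :
    (EuclideanSpace.single i (1 : ℝ) : Eu d) j = 0 := by
  simp [h]

lemma mixPt_succ {d : ℕ} (c x : Eu d) (i : Fin d) :
    mixPt c x (i + 1) = mixPt c x i + (x i - c i) • EuclideanSpace.single i (1 : ℝ) := by
  ext j
  by_cases h : j = i
  · subst h; simp [mixPt]
  · have h' : (j : ℕ) ≠ i := fun e => h (Fin.ext e)
    simp only [mixPt, PiLp.add_apply, PiLp.smul_apply]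
    rw [single_apply_ne h, smul_zero, add_zero]
    have : ((j : ℕ) < i + 1) ↔ (j : ℕ) < i := by omega
    simp [this]

/-- Multi-dimensional Taylor-type estimate in abstract form: `w b` plays the role of `∂^b u`. -/
lemma taylor_multi {d k : ℕ} {r α H : ℝ} (hr : 0 < r) (hH : 0 ≤ H) (w : (Fin d → ℕ) → Eu d → ℝ)
    (c x : Eu d) (hx : ∀ i, c i ≤ x i ∧ x i ≤ c i + r)
    (hder : ∀ (b : Fin d → ℕ) (i : Fin d), (∑ j, b j) < k → (∀ j, j < i → b j = 0) →
      ∀ y : Eu d, ∀ t : ℝ, (∀ j, c j ≤ (y + t • EuclideanSpace.single i (1 : ℝ) : Eu d) j ∧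
        (y + t • EuclideanSpace.single i (1 : ℝ) : Eu d) j ≤ x j) →
      HasDerivAt (fun s : ℝ => w b (y + s • EuclideanSpace.single i (1 : ℝ)))
      (w (b + Pi.single i 1) (y + t • EuclideanSpace.single i (1 : ℝ))) t)
    (h0 : ∀ b : Fin d → ℕ, (∑ j, b j) ≤ k → |w b c| ≤ r ^ (α - (∑ j, b j : ℕ)))
    (htop : ∀ b : Fin d → ℕ, (∑ j, b j) = k → ∀ y z : Eu d,
      (∀ j, c j ≤ y j ∧ y j ≤ x j) → (∀ j, c j ≤ z j ∧ z j ≤ x j) → ‖y - z‖ ≤ r →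
      |w b y - w b z| ≤ H * r ^ (α - (k : ℕ))) :
    |w 0 x| ≤ ((fun C : ℝ => C * (k + 1) + H)^[d] 1) * r ^ α := by
  set F : ℝ → ℝ := fun C => C * (k + 1) + H with hF
  have hFpos : ∀ i, 0 ≤ F^[i] 1 := by
    intro i
    induction i with
    | zero => simp
    | succ i ih => rw [Function.iterate_succ_apply']; simp only [hF]; positivity
  have key : ∀ i : ℕ, i ≤ d → ∀ b : Fin d → ℕ, (∀ j : Fin d, (j : ℕ) < i → b j = 0) →
      (∑ j, b j) ≤ k → |w b (mixPt c x i)| ≤ F^[i] 1 * r ^ (α - (∑ j, b j : ℕ)) := by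
    intro i
    induction i with
    | zero =>
      intro _ b _ hb
      have : mixPt c x 0 = c := by ext j; simp [mixPt]
      rw [this]; simpa using h0 b hb
    | succ i ih =>
      intro hi b hb0 hb
      set ii : Fin d := ⟨i, hi⟩ with hii
      have hmix := mixPt_succ c x ii
      have hsum : ∀ m : ℕ, (∑ j, (b + Pi.single ii m : Fin d → ℕ) j) = (∑ j, b j) + m := by
        intro m
        simp [Finset.sum_add_distrib]
      have hzero : ∀ m : ℕ, ∀ j : Fin d, j < ii → (b + Pi.single ii m : Fin d → ℕ) j = 0 := by
        intro m j hj
        have : (j : ℕ) < i := hj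
        simp [Pi.single_eq_of_ne hj.ne, hb0 j (by omega)]
      have hin : ∀ t ∈ Icc 0 (x ii - c ii), ∀ j,
          c j ≤ (mixPt c x i + t • EuclideanSpace.single ii (1 : ℝ) : Eu d) j ∧
          (mixPt c x i + t • EuclideanSpace.single ii (1 : ℝ) : Eu d) j ≤ x j := by
        intro t ht j
        by_cases h : j = ii
        · subst h
          have : ¬ ((ii : ℕ) < i) := by simp [hii]
          simp only [mixPt, PiLp.add_apply, PiLp.smul_apply, this, if_false]
          simp
          constructor <;> linarith [ht.1, ht.2]
        · simp only [mixPt, PiLp.add_apply, PiLp.smul_apply]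
          rw [single_apply_ne h, smul_zero, add_zero]
          split_ifs
          · exact ⟨(hx j).1, le_rfl⟩
          · exact ⟨le_rfl, (hx j).1⟩
      have h00 : mixPt c x i + (0 : ℝ) • EuclideanSpace.single ii (1 : ℝ) = mixPt c x i := by simp
      have hT := taylor_one_dim (r := r) (α := α) (C := F^[i] 1) (H := H) (s := x ii - c ii)
        (k := k) hr (by linarith [(hx ii).1]) (by linarith [(hx ii).2]) (hFpos i) hH
        (fun m t => w (b + Pi.single ii m) (mixPt c x i + t • EuclideanSpace.single ii (1 : ℝ)))
        (∑ j, b j) (k - ∑ j, b j) (by omega) ?_ ?_ ?_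
      · simp only [Pi.single_zero, add_zero] at hT
        rw [hmix, Function.iterate_succ_apply']
        exact hT
      · intro m hm t ht
        have := hder (b + Pi.single ii m) ii (by rw [hsum]; omega) (hzero m) (mixPt c x i) t (hin t ht)
        simpa [add_assoc, ← Pi.single_add] using this
      · intro m hm
        have := ih (by omega) (b + Pi.single ii m)
          (fun j hj => hzero m j hj) (by rw [hsum]; omega)
        rw [hsum] at this
        simpa only [h00] using this
      · intro t ht
        apply htop
        · rw [hsum]; omega
        · exact hin t ht
        · exact hin 0 ⟨le_rfl, by linarith [(hx ii).1]⟩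
        · have : (mixPt c x i + t • EuclideanSpace.single ii (1 : ℝ)) -
            (mixPt c x i + (0:ℝ) • EuclideanSpace.single ii (1 : ℝ))
              = t • EuclideanSpace.single ii (1 : ℝ) := by
            rw [h00]; abel
          rw [this, norm_smul]
          simp
          rw [abs_of_nonneg ht.1]
          linarith [ht.2, (hx ii).2]
  have := key d le_rfl 0 (fun _ _ => rfl) (by simp)
  have hm : mixPt c x d = x := by ext j; simp [mixPt]
  rw [hm] at this
  simpa using this

/-! ### Quantisation and the net -/

/-- Every set with a bounded finite-dimensional feature map has an internal net of controlled
cardinality. -/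
lemma quantize {X : Type*} (S : Set X) (hS : S.Nonempty) {ι : Type} [Fintype ι]
    [DecidableEq ι] (Φ : X → ι → ℝ) {R η : ℝ} (hη : 0 < η) (hR : 0 < R)
    (hΦ : ∀ x ∈ S, ∀ i, |Φ x i| ≤ R) :
    ∃ (κ : Type) (_ : Fintype κ) (_ : Nonempty κ) (net : κ → X), (∀ j, net j ∈ S) ∧
      (∀ x ∈ S, ∃ j, ∀ i, |Φ x i - Φ (net j) i| ≤ η) ∧
      Real.log (Fintype.card κ) ≤ Fintype.card ι * Real.log (2 * (R / η) + 5) := by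
  classical
  set K : ℕ := ⌈R / η⌉₊ + 1 with hK
  have hKle : (K : ℝ) ≤ R / η + 2 := by
    have := Nat.ceil_lt_add_one (a := R / η) (by positivity)
    rw [hK]; push_cast; linarith
  let code : X → ι → (Finset.Icc (-(K : ℤ)) K) := fun x i =>
    if h : ⌊Φ x i / η⌋ ∈ Finset.Icc (-(K : ℤ)) K then ⟨⌊Φ x i / η⌋, h⟩ else
      ⟨0, by simp⟩
  have hcode : ∀ x ∈ S, ∀ i, ((code x i : ℤ)) = ⌊Φ x i / η⌋ := by
    intro x hx i
    have hb := abs_le.1 (hΦ x hx i)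
    have hR' : R / η ≤ ((K : ℤ) : ℝ) - 1 := by
      rw [hK]; push_cast; linarith [Nat.le_ceil (R / η)]
    have h : ⌊Φ x i / η⌋ ∈ Finset.Icc (-(K : ℤ)) K := by
      rw [Finset.mem_Icc]
      constructor
      · apply Int.le_floor.2
        have : -(R / η) ≤ Φ x i / η := by rw [← neg_div]; gcongr; exact hb.1
        push_cast at *; linarith
      · have h1 : Φ x i / η ≤ R / η := by gcongr; exact hb.2
        have h2 := Int.floor_le (Φ x i / η)
        have : (⌊Φ x i / η⌋ : ℝ) ≤ ((K : ℤ) : ℝ) := by linarith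
        exact_mod_cast this
    simp only [code, dif_pos h]
  obtain ⟨x₀, hx₀⟩ := hS
  let net : (ι → (Finset.Icc (-(K : ℤ)) K)) → X := fun c =>
    if h : ∃ x ∈ S, code x = c then h.choose else x₀
  refine ⟨ι → (Finset.Icc (-(K : ℤ)) K), inferInstance, ⟨code x₀⟩, net, ?_, ?_, ?_⟩
  · intro c
    by_cases h : ∃ x ∈ S, code x = c
    · simp only [net, dif_pos h]; exact h.choose_spec.1
    · simp only [net, dif_neg h]; exact hx₀
  · intro x hx
    refine ⟨code x, fun i => ?_⟩
    have h : ∃ x' ∈ S, code x' = code x := ⟨x, hx, rfl⟩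
    have hn : net (code x) = h.choose := by simp only [net, dif_pos h]
    obtain ⟨h1, h2⟩ := h.choose_spec
    rw [hn]
    set x' := h.choose
    have e : ⌊Φ x i / η⌋ = ⌊Φ x' i / η⌋ := by
      rw [← hcode x hx i, ← hcode x' h1 i, h2]
    have := Int.abs_sub_lt_one_of_floor_eq_floor e
    rw [← sub_div, abs_div, abs_of_pos hη, div_lt_one hη] at this
    exact this.le
  · rw [Fintype.card_pi, Finset.prod_const, Finset.card_univ]
    push_cast
    rw [Real.log_pow]
    apply mul_le_mul_of_nonneg_left _ (by positivity)
    have hc : (Fintype.card (Finset.Icc (-(K : ℤ)) K) : ℝ) = 2 * K + 1 := by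
      rw [Fintype.card_coe, Int.card_Icc]
      have : ((K : ℤ) + 1 - -(K : ℤ)).toNat = 2 * K + 1 := by omega
      rw [this]; push_cast; ring
    rw [hc]
    apply Real.log_le_log (by positivity)
    linarith

lemma norm_le_sum_abs {d : ℕ} (v : Eu d) : ‖v‖ ≤ ∑ i, |v i| := by
  rw [EuclideanSpace.norm_eq]
  apply Real.sqrt_le_iff.2
  refine ⟨by positivity, ?_⟩
  exact Finset.sum_sq_le_sq_sum_of_nonneg (fun i _ => abs_nonneg (v i))

/-- The class of candidate transport maps. -/
def Cls (d : ℕ) (α M R : ℝ) : Set (Eu d → Eu d) :=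
  {T | MemT d α M R T ∧ T '' unitCube d = unitCube d}

lemma unitCube_sub_bigBox {d : ℕ} {x : Eu d} (hx : x ∈ unitCube d) : x ∈ bigBox d := by
  intro i
  exact ⟨by linarith [(hx i).1], by linarith [(hx i).2]⟩

lemma holder_data {d : ℕ} {α R : ℝ} {T : Eu d → Eu d} (h : HolderNormLE d α (bigBox d) T R) :
    (∀ b ∈ multiIdxLe d ⌊α⌋₊, ∀ i : Fin d, ∀ x ∈ bigBox d,
      |multiDeriv d b (fun z => T z i) x| ≤ R) ∧
    (∀ b ∈ multiIdxEq d ⌊α⌋₊, ∀ i : Fin d, ∀ x ∈ bigBox d, ∀ y ∈ bigBox d,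
      |multiDeriv d b (fun z => T z i) x - multiDeriv d b (fun z => T z i) y|
        ≤ R * ‖x - y‖ ^ (α - (⌊α⌋₊ : ℝ))) := by
  obtain ⟨B, H, hB, hH, hs⟩ := h
  have z0 : (0 : Eu d) ∈ bigBox d := by intro i; simp
  have hB0 : ∀ b ∈ multiIdxLe d ⌊α⌋₊, ∀ i, 0 ≤ B b i := fun b hb i =>
    (abs_nonneg _).trans (hB b hb i 0 z0)
  have hH0 : ∀ b ∈ multiIdxEq d ⌊α⌋₊, ∀ i, 0 ≤ H b i := by
    intro b hb i
    have z1 : (EuclideanSpace.single i (1 : ℝ) : Eu d) ∈ bigBox d := by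
      intro j
      by_cases h : j = i
      · subst h; simp
      · rw [single_apply_ne h]; norm_num
    have hne : (EuclideanSpace.single i (1 : ℝ) : Eu d) ≠ 0 := by simp
    have := hH b hb i _ z1 _ z0 hne
    simp at this
    exact (abs_nonneg _).trans this
  have hterm : ∀ i, 0 ≤ (∑ b ∈ multiIdxLe d ⌊α⌋₊, B b i) + ∑ b ∈ multiIdxEq d ⌊α⌋₊, H b i :=
    fun i => add_nonneg (Finset.sum_nonneg fun b hb => hB0 b hb i)
      (Finset.sum_nonneg fun b hb => hH0 b hb i)
  have hi : ∀ i, (∑ b ∈ multiIdxLe d ⌊α⌋₊, B b i) + ∑ b ∈ multiIdxEq d ⌊α⌋₊, H b i ≤ R :=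
    fun i => (Finset.single_le_sum (fun j _ => hterm j) (Finset.mem_univ i)).trans hs
  constructor
  · intro b hb i x hx
    refine (hB b hb i x hx).trans ?_
    have h1 := Finset.single_le_sum (f := fun b => B b i) (fun c hc => hB0 c hc i) hb
    have h2 : 0 ≤ ∑ b ∈ multiIdxEq d ⌊α⌋₊, H b i := Finset.sum_nonneg fun b hb => hH0 b hb i
    have := hi i
    linarith
  · intro b hb i x hx y hy
    have hHR : H b i ≤ R := by
      have h1 := Finset.single_le_sum (f := fun b => H b i) (fun c hc => hH0 c hc i) hb
      have h2 : 0 ≤ ∑ b ∈ multiIdxLe d ⌊α⌋₊, B b i := Finset.sum_nonneg fun b hb => hB0 b hb i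
      have := hi i
      linarith
    by_cases hxy : x = y
    · subst hxy
      simp only [sub_self, abs_zero]
      have : 0 ≤ R := (hH0 b hb i).trans hHR
      positivity
    · refine (hH b hb i x hx y hy hxy).trans ?_
      gcongr

lemma mem_multiIdxLe {d k : ℕ} {b : Fin d → ℕ} (h : (∑ j, b j) ≤ k) : b ∈ multiIdxLe d k := by
  unfold multiIdxLe
  rw [Finset.mem_filter]
  refine ⟨?_, h⟩
  rw [Fintype.mem_piFinset]
  intro i
  rw [Finset.mem_range]
  have := Finset.single_le_sum (f := b) (fun j _ => Nat.zero_le _) (Finset.mem_univ i)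
  omega

lemma mem_multiIdxEq {d k : ℕ} {b : Fin d → ℕ} (h : (∑ j, b j) = k) : b ∈ multiIdxEq d k := by
  unfold multiIdxEq
  have := mem_multiIdxLe h.le
  unfold multiIdxLe at this
  rw [Finset.mem_filter] at this ⊢
  exact ⟨this.1, h⟩

/-- The lower-left corner of the dyadic cell with index `k` at level `J`. -/
def corner {d : ℕ} (J : ℕ) (k : Fin d → Fin (2 ^ J)) : Eu d :=
  WithLp.toLp 2 (fun i => ((k i : ℕ) : ℝ) / 2 ^ J)

lemma exists_corner {d : ℕ} (J : ℕ) {x : Eu d} (hx : x ∈ unitCube d) :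
    ∃ k : Fin d → Fin (2 ^ J), ∀ i, corner J k i ≤ x i ∧ x i ≤ corner J k i + (1 / 2) ^ J := by
  have hp : (0 : ℝ) < 2 ^ J := by positivity
  have hk : ∀ i, ∃ m : Fin (2 ^ J), ((m : ℕ) : ℝ) / 2 ^ J ≤ x i ∧
      x i ≤ ((m : ℕ) : ℝ) / 2 ^ J + (1 / 2) ^ J := by
    intro i
    have h2 : ((1 : ℝ) / 2) ^ J = 1 / 2 ^ J := by rw [div_pow, one_pow]
    rw [h2]
    by_cases h : x i < 1
    · have h0 : 0 ≤ x i * 2 ^ J := mul_nonneg (hx i).1 hp.le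
      have hlt : ⌊x i * 2 ^ J⌋₊ < 2 ^ J := by
        rw [Nat.floor_lt h0]; push_cast; nlinarith
      refine ⟨⟨_, hlt⟩, ?_, ?_⟩
      · rw [div_le_iff₀ hp]; exact Nat.floor_le h0
      · rw [← add_div, le_div_iff₀ hp]; exact (Nat.lt_floor_add_one _).le
    · have h1 : x i = 1 := le_antisymm (hx i).2 (not_lt.1 h)
      have h3 : 0 < 2 ^ J := by positivity
      refine ⟨⟨2 ^ J - 1, by omega⟩, ?_, ?_⟩
      · rw [h1, div_le_iff₀ hp]
        rw [Nat.cast_sub h3]; push_cast; linarith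
      · rw [h1, ← add_div, le_div_iff₀ hp]
        rw [Nat.cast_sub h3]; push_cast; linarith
  choose k hk using hk
  exact ⟨k, fun i => hk i⟩

lemma contDiffAt_coord {d : ℕ} {T : Eu d → Eu d} {x : Eu d} {n : WithTop ℕ∞} (i : Fin d)
    (h : ContDiffAt ℝ n T x) : ContDiffAt ℝ n (fun z => T z i) x := by
  exact contDiffAt_euclidean.1 h i

lemma corner_mem {d : ℕ} (J : ℕ) (k : Fin d → Fin (2 ^ J)) : corner J k ∈ unitCube d := by
  have hp : (0 : ℝ) < 2 ^ J := by positivity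
  intro i
  have hlt := (k i).2
  have : ((k i : ℕ) : ℝ) ≤ 2 ^ J := by exact_mod_cast hlt.le
  refine ⟨?_, ?_⟩
  · simp only [corner]; positivity
  · simp only [corner]; rw [div_le_one hp]; exact this

/-- Maps with the same quantised Taylor data are uniformly close. -/
lemma close_of_code {d : ℕ} {α M R : ℝ} (hR : 0 ≤ R) (hα : 1 < α) {T T' : Eu d → Eu d}
    (hT : MemT d α M R T) (hT' : MemT d α M R T') (J : ℕ)
    (h : ∀ (k : Fin d → Fin (2 ^ J)) (b : multiIdxLe d ⌊α⌋₊) (i : Fin d),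
      |multiDeriv d b (fun z => T z i) (corner J k) - multiDeriv d b (fun z => T' z i) (corner J k)|
        ≤ (((1 : ℝ) / 2) ^ J) ^ α) {x : Eu d} (hx : x ∈ unitCube d) :
    ‖T x - T' x‖ ≤ d * ((fun C : ℝ => C * (⌊α⌋₊ + 1) + 2 * R)^[d] 1) * (((1 : ℝ) / 2) ^ J) ^ α := by
  obtain ⟨k, hk⟩ := exists_corner J hx
  set r : ℝ := ((1 : ℝ) / 2) ^ J with hr
  have hr0 : 0 < r := by positivity
  have hr1 : r ≤ 1 := pow_le_one₀ (by norm_num) (by norm_num)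
  have hbox : ∀ y : Eu d, (∀ j, corner J k j ≤ y j ∧ y j ≤ x j) → y ∈ bigBox d := by
    intro y hy
    apply unitCube_sub_bigBox
    intro j
    exact ⟨((corner_mem J k j).1).trans (hy j).1, (hy j).2.trans (hx j).2⟩
  obtain ⟨hA1, hA2⟩ := holder_data hT.holder
  obtain ⟨hB1, hB2⟩ := holder_data hT'.holder
  have hcoord : ∀ i, |T x i - T' x i| ≤
      ((fun C : ℝ => C * (⌊α⌋₊ + 1) + 2 * R)^[d] 1) * r ^ α := by
    intro i
    have := taylor_multi (k := ⌊α⌋₊) (r := r) (α := α) (H := 2 * R) hr0 (by positivity)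
      (fun b z => multiDeriv d b (fun z => T z i) z - multiDeriv d b (fun z => T' z i) z)
      (corner J k) x hk ?_ ?_ ?_
    · simpa [multiDeriv_zero] using this
    · intro b j hb hb0 y t hy
      apply HasDerivAt.sub
      · exact multiDeriv_hasDerivAt b j hb hb0 y t (contDiffAt_coord i (hT.smooth _ (hbox _ hy)))
      · exact multiDeriv_hasDerivAt b j hb hb0 y t (contDiffAt_coord i (hT'.smooth _ (hbox _ hy)))
    · intro b hb
      refine (h k ⟨b, mem_multiIdxLe hb⟩ i).trans ?_
      apply Real.rpow_le_rpow_of_exponent_ge hr0 hr1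
      have : (0 : ℝ) ≤ ((∑ j, b j : ℕ) : ℝ) := by positivity
      linarith
    · intro b hb y z hy hz hyz
      have e1 := hA2 b (mem_multiIdxEq hb) i y (hbox y hy) z (hbox z hz)
      have e2 := hB2 b (mem_multiIdxEq hb) i y (hbox y hy) z (hbox z hz)
      have hβ : 0 ≤ α - (⌊α⌋₊ : ℝ) := by linarith [Nat.floor_le (by linarith : 0 ≤ α)]
      have e3 : ‖y - z‖ ^ (α - (⌊α⌋₊ : ℝ)) ≤ r ^ (α - (⌊α⌋₊ : ℝ)) :=
        Real.rpow_le_rpow (norm_nonneg _) hyz hβ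
      have e4 := mul_le_mul_of_nonneg_left e3 hR
      rw [abs_le] at *
      constructor <;> linarith [e1.1, e1.2, e2.1, e2.2]
  calc ‖T x - T' x‖ ≤ ∑ i, |(T x - T' x) i| := norm_le_sum_abs _
    _ ≤ ∑ _i : Fin d, ((fun C : ℝ => C * (⌊α⌋₊ + 1) + 2 * R)^[d] 1) * r ^ α :=
        Finset.sum_le_sum fun i _ => hcoord i
    _ = _ := by simp; ring

/-- The net. -/
lemma exists_net (d : ℕ) {α M R : ℝ} (hα : 1 < α) (hR : 1 < R)
    (hne : (Cls d α M R).Nonempty) :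
    ∃ C : ℝ, 0 < C ∧ ∀ J : ℕ, ∃ (κ : Type) (_ : Fintype κ) (_ : Nonempty κ)
      (net : κ → Eu d → Eu d),
      (∀ j, net j ∈ Cls d α M R) ∧
      (∀ T ∈ Cls d α M R, ∃ j, ∀ x ∈ unitCube d, ‖T x - net j x‖ ≤ C * (((1 : ℝ) / 2) ^ J) ^ α) ∧
      Real.log (Fintype.card κ) ≤ C * 2 ^ (J * d) * (J + 1) := by
  classical
  set C1 : ℝ := d * ((fun C : ℝ => C * (⌊α⌋₊ + 1) + 2 * R)^[d] 1) with hC1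
  set m : ℕ := Fintype.card (multiIdxLe d ⌊α⌋₊)
  set C2 : ℝ := m * d * (Real.log (2 * R + 5) + α) with hC2
  have hlogpos : 0 ≤ Real.log (2 * R + 5) := Real.log_nonneg (by linarith)
  have hC2' : 0 ≤ C2 := by positivity
  refine ⟨|C1| + C2 + 1, by positivity, fun J => ?_⟩
  have hr0 : (0 : ℝ) < (((1 : ℝ) / 2) ^ J) ^ α := by positivity
  obtain ⟨κ, h1, h2, net, h3, h4, h5⟩ := quantize (Cls d α M R) hne
    (ι := (Fin d → Fin (2 ^ J)) × (multiIdxLe d ⌊α⌋₊) × Fin d)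
    (fun T p => multiDeriv d p.2.1 (fun z => T z p.2.2) (corner J p.1))
    hr0 (by linarith : 0 < R)
    (fun T hT p => (holder_data hT.1.holder).1 p.2.1 p.2.1.2 p.2.2 _
      (unitCube_sub_bigBox (corner_mem J p.1)))
  refine ⟨κ, h1, h2, net, h3, ?_, ?_⟩
  · intro T hT
    obtain ⟨j, hj⟩ := h4 T hT
    refine ⟨j, fun x hx => ?_⟩
    refine (close_of_code (by linarith) hα hT.1 (h3 j).1 J (fun k b i => hj (k, b, i)) hx).trans ?_
    rw [← hC1]
    apply mul_le_mul_of_nonneg_right _ hr0.le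
    linarith [le_abs_self C1]
  · refine h5.trans ?_
    have hcard : (Fintype.card ((Fin d → Fin (2 ^ J)) × (multiIdxLe d ⌊α⌋₊) × Fin d) : ℝ)
        = 2 ^ (J * d) * (m * d) := by
      rw [Fintype.card_prod, Fintype.card_prod, Fintype.card_pi]
      simp only [Fintype.card_fin, Finset.prod_const, Finset.card_univ]
      push_cast
      rw [← pow_mul]
    rw [hcard]
    have hlog : Real.log (2 * (R / (((1 : ℝ) / 2) ^ J) ^ α) + 5) ≤
        (Real.log (2 * R + 5) + α) * (J + 1) := by
      have e : R / (((1 : ℝ) / 2) ^ J) ^ α = R * ((2 : ℝ) ^ J) ^ α := by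
        rw [div_pow, one_pow, Real.div_rpow (by norm_num) (by positivity), Real.one_rpow]
        field_simp
      rw [e]
      have h1 : (1 : ℝ) ≤ ((2 : ℝ) ^ J) ^ α :=
        Real.one_le_rpow (one_le_pow₀ (by norm_num)) (by linarith)
      have h2 : 2 * (R * ((2 : ℝ) ^ J) ^ α) + 5 ≤ (2 * R + 5) * ((2 : ℝ) ^ J) ^ α := by nlinarith
      refine (Real.log_le_log (by positivity) h2).trans ?_
      rw [Real.log_mul (by positivity) (by positivity), Real.log_rpow (by positivity), Real.log_pow]
      have h3 : Real.log 2 ≤ 1 := by linarith [Real.log_two_lt_d9]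
      have h4 : α * (J * Real.log 2) ≤ α * (J * 1) := by gcongr
      have hJ : (0 : ℝ) ≤ J := by positivity
      nlinarith
    calc 2 ^ (J * d) * (m * d) * Real.log (2 * (R / (((1 : ℝ) / 2) ^ J) ^ α) + 5)
        ≤ 2 ^ (J * d) * (m * d) * ((Real.log (2 * R + 5) + α) * (J + 1)) := by gcongr
      _ = C2 * 2 ^ (J * d) * (J + 1) := by rw [hC2]; ring
      _ ≤ _ := by
        have : C2 ≤ |C1| + C2 + 1 := by linarith [abs_nonneg C1]
        gcongr

/-! ### Properties of maps in the class -/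

lemma convex_unitCube (d : ℕ) : Convex ℝ (unitCube d) := by
  intro x hx y hy a b ha hb hab i
  have h := convex_Icc (0 : ℝ) 1 (hx i) (hy i) ha hb hab
  simpa using h

lemma memT_norm_deriv_le {d : ℕ} {α M R : ℝ} (hα : 1 < α) {T : Eu d → Eu d}
    (hT : MemT d α M R T) {x : Eu d} (hx : x ∈ bigBox d) {A : Eu d →L[ℝ] Eu d}
    (hA : HasFDerivAt T A x) (hR : 0 ≤ R) : ‖A‖ ≤ d * (d * R) := by
  have hk : 1 ≤ ⌊α⌋₊ := Nat.le_floor (by exact_mod_cast hα.le)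
  have hent : ∀ i j, |A (EuclideanSpace.single j 1) i| ≤ R := by
    intro i j
    have h1 := (holder_data hT.holder).1 (0 + Pi.single j 1) (mem_multiIdxLe (by simpa using hk)) i x hx
    rw [multiDeriv_add_single 0 j _ (fun _ _ => rfl), multiDeriv_zero] at h1
    unfold pderiv1 at h1
    have h2 : HasFDerivAt (fun z => T z i) ((EuclideanSpace.proj i).comp A) x :=
      (EuclideanSpace.proj (𝕜 := ℝ) i : Eu d →L[ℝ] ℝ).hasFDerivAt.comp x hA
    rw [h2.fderiv] at h1
    simpa using h1
  apply ContinuousLinearMap.opNorm_le_bound _ (by positivity)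
  intro v
  have hv : v = ∑ j, v j • (EuclideanSpace.single j (1 : ℝ) : Eu d) := by
    ext i
    simp [Pi.single_apply]
  have hAe : ∀ j, ‖A (EuclideanSpace.single j 1)‖ ≤ d * R := by
    intro j
    calc ‖A (EuclideanSpace.single j 1)‖ ≤ ∑ i, |A (EuclideanSpace.single j 1) i| :=
          norm_le_sum_abs _
      _ ≤ ∑ _i : Fin d, R := Finset.sum_le_sum fun i _ => hent i j
      _ = d * R := by simp
  calc ‖A v‖ = ‖∑ j, v j • A (EuclideanSpace.single j (1 : ℝ))‖ := by
        conv_lhs => rw [hv]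
        rw [map_sum]
        simp only [map_smul]
    _ ≤ ∑ j, ‖v j • A (EuclideanSpace.single j (1 : ℝ))‖ := norm_sum_le _ _
    _ ≤ ∑ _j : Fin d, ‖v‖ * (d * R) := by
        apply Finset.sum_le_sum
        intro j _
        rw [norm_smul]
        exact mul_le_mul (PiLp.norm_apply_le v j) (hAe j) (norm_nonneg _) (norm_nonneg _)
    _ = d * (d * R) * ‖v‖ := by simp; ring

lemma memT_lip {d : ℕ} {α M R : ℝ} (hα : 1 < α) (hR : 0 ≤ R) {T : Eu d → Eu d}
    (hT : MemT d α M R T) {x y : Eu d} (hx : x ∈ unitCube d) (hy : y ∈ unitCube d) :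
    ‖T x - T y‖ ≤ d * (d * R) * ‖x - y‖ := by
  choose A hA using hT.derivBounds
  classical
  have := (convex_unitCube d).norm_image_sub_le_of_norm_hasFDerivWithin_le (𝕜 := ℝ) (f := T)
    (f' := fun z => if h : z ∈ bigBox d then A z h else 0) (C := d * (d * R)) ?_ ?_ hy hx
  · exact this
  · intro z hz
    simp only [dif_pos (unitCube_sub_bigBox hz)]
    exact (hA z _).1.hasFDerivWithinAt
  · intro z hz
    simp only [dif_pos (unitCube_sub_bigBox hz)]
    exact memT_norm_deriv_le hα hT (unitCube_sub_bigBox hz) (hA z _).1 hR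

lemma seg_mem {d : ℕ} {x y : Eu d} (hx : x ∈ unitCube d) (hy : y ∈ unitCube d) {t : ℝ}
    (ht : t ∈ Icc (0 : ℝ) 1) : y + t • (x - y) ∈ unitCube d := by
  have := (convex_unitCube d) hy hx (by linarith [ht.2] : 0 ≤ 1 - t) ht.1 (by ring)
  convert this using 1
  rw [smul_sub, sub_smul, one_smul]; abel

lemma seg_hasDerivAt {d : ℕ} (x y : Eu d) (t : ℝ) :
    HasDerivAt (fun s : ℝ => y + s • (x - y)) (x - y) t := by
  simpa using ((hasDerivAt_id t).smul_const (x - y)).const_add y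

lemma memT_mono {d : ℕ} {α M R : ℝ} {T : Eu d → Eu d}
    (hT : MemT d α M R T) {x y : Eu d} (hx : x ∈ unitCube d) (hy : y ∈ unitCube d) :
    M⁻¹ * ‖x - y‖ ^ 2 ≤ ⟪T x - T y, x - y⟫ := by
  have hder : ∀ t ∈ Icc (0 : ℝ) 1, ∃ D, HasDerivAt (fun s : ℝ => ⟪T (y + s • (x - y)), x - y⟫) D t ∧
      M⁻¹ * ‖x - y‖ ^ 2 ≤ D := by
    intro t ht
    obtain ⟨A, hA, hb⟩ := hT.derivBounds _ (unitCube_sub_bigBox (seg_mem hx hy ht))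
    refine ⟨⟪A (x - y), x - y⟫, ?_, (hb _).1⟩
    have h1 := hA.comp_hasDerivAt t (seg_hasDerivAt x y t)
    simpa using h1.inner ℝ (hasDerivAt_const t (x - y))
  choose D hD using hder
  classical
  obtain ⟨c, hc, hcc⟩ := exists_hasDerivAt_eq_slope
    (fun s : ℝ => ⟪T (y + s • (x - y)), x - y⟫) (fun t => if h : t ∈ Icc (0 : ℝ) 1 then D t h else 0)
    (zero_lt_one) (fun t ht => ((hD t ht).1.continuousAt).continuousWithinAt) (fun t ht => by
      have ht' : t ∈ Icc (0 : ℝ) 1 := Ioo_subset_Icc_self ht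
      simp only [dif_pos ht']; exact (hD t ht').1)
  have hc' : c ∈ Icc (0 : ℝ) 1 := Ioo_subset_Icc_self hc
  simp only [dif_pos hc'] at hcc
  have := (hD c hc').2
  rw [hcc] at this
  simpa [inner_sub_left] using this

/-- Bregman mean value identity. -/
lemma bregman_mvt {d : ℕ} {T : Eu d → Eu d} {f : Eu d → ℝ}
    (hf : ∀ x ∈ bigBox d, HasGradientAt f (T x) x) {x z : Eu d} (hx : x ∈ unitCube d)
    (hz : z ∈ unitCube d) :
    ∃ t ∈ Ioo (0 : ℝ) 1, f x - f z - ⟪T z, x - z⟫ = ⟪T (z + t • (x - z)) - T z, x - z⟫ := by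
  have hder : ∀ t ∈ Icc (0 : ℝ) 1, HasDerivAt (fun s : ℝ => f (z + s • (x - z)))
      ⟪T (z + t • (x - z)), x - z⟫ t := by
    intro t ht
    have h1 := (hf _ (unitCube_sub_bigBox (seg_mem hx hz ht))).hasFDerivAt.comp_hasDerivAt t
      (seg_hasDerivAt x z t)
    simp only [InnerProductSpace.toDual_apply_apply] at h1
    exact h1
  obtain ⟨c, hc, hcc⟩ := exists_hasDerivAt_eq_slope
    (fun s : ℝ => f (z + s • (x - z))) (fun t => ⟪T (z + t • (x - z)), x - z⟫)
    (zero_lt_one) (fun t ht => ((hder t ht).continuousAt).continuousWithinAt)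
    (fun t ht => hder t (Ioo_subset_Icc_self ht))
  refine ⟨c, hc, ?_⟩
  rw [inner_sub_left, hcc]
  simp

lemma bregman_bounds {d : ℕ} {α M R : ℝ} (hα : 1 < α) (hR : 0 ≤ R) (hM : 0 < M) {T : Eu d → Eu d}
    (hT : MemT d α M R T) {f : Eu d → ℝ}
    (hf : ∀ x ∈ bigBox d, HasGradientAt f (T x) x) {x z : Eu d} (hx : x ∈ unitCube d)
    (hz : z ∈ unitCube d) :
    M⁻¹ / 4 * ‖x - z‖ ^ 2 ≤ f x - f z - ⟪T z, x - z⟫ ∧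
      f x - f z - ⟪T z, x - z⟫ ≤ d * (d * R) * ‖x - z‖ ^ 2 := by
  have hnn : ∀ {x z : Eu d}, x ∈ unitCube d → z ∈ unitCube d → 0 ≤ f x - f z - ⟪T z, x - z⟫ := by
    intro x z hx hz
    obtain ⟨t, ht, e⟩ := bregman_mvt hf hx hz
    rw [e]
    have h1 := memT_mono hT (seg_mem hx hz (Ioo_subset_Icc_self ht)) hz
    simp only [add_sub_cancel_left, inner_smul_right] at h1
    have h2 : 0 ≤ t * ⟪T (z + t • (x - z)) - T z, x - z⟫ := le_trans (by positivity) h1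
    exact nonneg_of_mul_nonneg_right h2 ht.1
  constructor
  · set m : Eu d := z + (1 / 2 : ℝ) • (x - z) with hm
    have hmm : m ∈ unitCube d := seg_mem hx hz (by norm_num)
    have h1 := hnn hx hmm
    have h2 := hnn hmm hz
    have h3 := memT_mono hT hmm hz
    have e1 : m - z = (1 / 2 : ℝ) • (x - z) := by rw [hm]; abel
    have e2 : x - m = (1 / 2 : ℝ) • (x - z) := by
      rw [hm]; module
    rw [e1] at h2 h3
    rw [e2] at h1
    rw [norm_smul, inner_sub_left, inner_smul_right, inner_smul_right] at h3
    rw [inner_smul_right] at h1 h2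
    norm_num at h1 h2 h3
    nlinarith
  · obtain ⟨t, ht, e⟩ := bregman_mvt hf hx hz
    rw [e]
    refine (real_inner_le_norm _ _).trans ?_
    have h1 := memT_lip hα hR hT (seg_mem hx hz (Ioo_subset_Icc_self ht)) hz
    have h2 : ‖z + t • (x - z) - z‖ ≤ ‖x - z‖ := by
      rw [add_sub_cancel_left, norm_smul, Real.norm_eq_abs, abs_of_pos ht.1]
      exact mul_le_of_le_one_left (norm_nonneg _) ht.2.le
    have h3 : ‖T (z + t • (x - z)) - T z‖ ≤ d * (d * R) * ‖x - z‖ :=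
      h1.trans (by gcongr)
    calc _ ≤ d * (d * R) * ‖x - z‖ * ‖x - z‖ := by gcongr
      _ = _ := by ring

/-- A function `g` with gradient `G` having a quadratic Taylor remainder on the cube. -/
structure C11 (d : ℕ) (K : ℝ) (g : Eu d → ℝ) (G : Eu d → Eu d) : Prop where
  rem : ∀ x ∈ unitCube d, ∀ y ∈ unitCube d, |g x - g y - ⟪G y, x - y⟫| ≤ K * ‖x - y‖ ^ 2
  lip : ∀ x ∈ unitCube d, ∀ y ∈ unitCube d, ‖G x - G y‖ ≤ K * ‖x - y‖

/-- Data of a transport potential, its conjugate, and the inverse map. -/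
structure Pot (d : ℕ) (K c : ℝ) (T S : Eu d → Eu d) (f fs : Eu d → ℝ) : Prop where
  c1 : C11 d K f T
  c2 : C11 d K fs S
  mapT : ∀ x ∈ unitCube d, T x ∈ unitCube d
  mapS : ∀ x ∈ unitCube d, S x ∈ unitCube d
  ST : ∀ x ∈ unitCube d, S (T x) = x
  TS : ∀ x ∈ unitCube d, T (S x) = x
  lower : ∀ x ∈ unitCube d, ∀ z ∈ unitCube d, c * ‖x - z‖ ^ 2 ≤ f x + fs (T z) - ⟪x, T z⟫
  upper : ∀ x ∈ unitCube d, ∀ z ∈ unitCube d, f x + fs (T z) - ⟪x, T z⟫ ≤ K * ‖x - z‖ ^ 2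

lemma exists_pot (d : ℕ) {α M R : ℝ} (hα : 1 < α) (hR : 0 ≤ R) (hM : 0 < M) :
    ∃ K c : ℝ, 0 < K ∧ 0 < c ∧ ∀ T ∈ Cls d α M R, ∃ S f fs, Pot d K c T S f fs := by
  set L : ℝ := d * (d * R) with hL
  have hL0 : 0 ≤ L := by positivity
  refine ⟨L + M + L * M ^ 2, M⁻¹ / 4, by positivity, by positivity, ?_⟩
  intro T hT
  obtain ⟨f, -, hf⟩ := hT.1.isGradient
  have hmapT : ∀ x ∈ unitCube d, T x ∈ unitCube d := fun x hx => by
    rw [← hT.2]; exact mem_image_of_mem _ hx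
  have hanti : ∀ x ∈ unitCube d, ∀ y ∈ unitCube d, ‖x - y‖ ≤ M * ‖T x - T y‖ := by
    intro x hx y hy
    have h1 := memT_mono hT.1 hx hy
    have h2 := real_inner_le_norm (T x - T y) (x - y)
    rcases (norm_nonneg (x - y)).eq_or_lt with h | h
    · rw [← h]; positivity
    · have h3 : M⁻¹ * ‖x - y‖ * ‖x - y‖ ≤ ‖T x - T y‖ * ‖x - y‖ := by
        calc _ = M⁻¹ * ‖x - y‖ ^ 2 := by ring
          _ ≤ _ := h1.trans h2
      have h4 := le_of_mul_le_mul_right h3 h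
      rwa [inv_mul_le_iff₀ hM] at h4
  have hex : ∀ y, ∃ x, y ∈ unitCube d → x ∈ unitCube d ∧ T x = y := by
    intro y
    by_cases h : y ∈ unitCube d
    · rw [← hT.2] at h
      obtain ⟨x, hx, e⟩ := h
      exact ⟨x, fun _ => ⟨hx, e⟩⟩
    · exact ⟨0, fun h' => absurd h' h⟩
  choose S hS using hex
  have hmapS : ∀ x ∈ unitCube d, S x ∈ unitCube d := fun x hx => (hS x hx).1
  have hTS : ∀ x ∈ unitCube d, T (S x) = x := fun x hx => (hS x hx).2
  have hST : ∀ x ∈ unitCube d, S (T x) = x := by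
    intro x hx
    have h1 := hanti _ (hmapS _ (hmapT x hx)) x hx
    rw [hTS _ (hmapT x hx), sub_self, norm_zero, mul_zero] at h1
    exact sub_eq_zero.1 (norm_le_zero_iff.1 h1)
  have hSlip : ∀ x ∈ unitCube d, ∀ y ∈ unitCube d, ‖S x - S y‖ ≤ M * ‖x - y‖ := by
    intro x hx y hy
    have := hanti _ (hmapS x hx) _ (hmapS y hy)
    rwa [hTS x hx, hTS y hy] at this
  have hgap : ∀ x ∈ unitCube d, ∀ z ∈ unitCube d,
      f x + (⟪S (T z), T z⟫ - f (S (T z))) - ⟪x, T z⟫ = f x - f z - ⟪T z, x - z⟫ := by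
    intro x hx z hz
    rw [hST z hz, inner_sub_right, real_inner_comm (T z) z, real_inner_comm (T z) x]
    ring
  refine ⟨S, f, fun y => ⟪S y, y⟫ - f (S y), ?_, ?_, hmapT, hmapS, hST, hTS, ?_, ?_⟩
  · constructor
    · intro x hx y hy
      obtain ⟨h1, h2⟩ := bregman_bounds hα hR hM hT.1 hf hx hy
      rw [abs_of_nonneg (le_trans (by positivity) h1)]
      refine h2.trans ?_
      gcongr
      rw [← hL]
      nlinarith [mul_nonneg hL0 (sq_nonneg M)]
    · intro x hx y hy
      refine (memT_lip hα hR hT.1 hx hy).trans ?_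
      gcongr
      rw [← hL]
      nlinarith [mul_nonneg hL0 (sq_nonneg M)]
  · constructor
    · intro x hx y hy
      obtain ⟨h1, h2⟩ := bregman_bounds hα hR hM hT.1 hf (hmapS y hy) (hmapS x hx)
      rw [hTS x hx] at h1 h2
      have e : ⟪S x, x⟫ - f (S x) - (⟪S y, y⟫ - f (S y)) - ⟪S y, x - y⟫
          = f (S y) - f (S x) - ⟪x, S y - S x⟫ := by
        rw [inner_sub_right, inner_sub_right, real_inner_comm (S y) x, real_inner_comm (S x) x]
        ring
      rw [e, abs_of_nonneg (le_trans (by positivity) h1)]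
      refine h2.trans ?_
      have h3 := hSlip y hy x hx
      rw [norm_sub_rev y x] at h3
      rw [← hL]
      calc L * ‖S y - S x‖ ^ 2 ≤ L * (M * ‖x - y‖) ^ 2 := by gcongr
        _ = L * M ^ 2 * ‖x - y‖ ^ 2 := by ring
        _ ≤ _ := by gcongr; linarith
    · intro x hx y hy
      refine (hSlip x hx y hy).trans ?_
      gcongr
      nlinarith [mul_nonneg hL0 (sq_nonneg M)]
  · intro x hx z hz
    rw [hgap x hx z hz]
    exact (bregman_bounds hα hR hM hT.1 hf hx hz).1
  · intro x hx z hz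
    rw [hgap x hx z hz]
    refine (bregman_bounds hα hR hM hT.1 hf hx hz).2.trans ?_
    gcongr
    rw [← hL]
    nlinarith [mul_nonneg hL0 (sq_nonneg M)]

/-! ### A Poincaré inequality on convex subsets of the cube -/

lemma sq_integral_le {Ω : Type*} [MeasurableSpace Ω] (μ : Measure Ω) [IsFiniteMeasure μ]
    (f : Ω → ℝ) (hf : Integrable f μ) (hf2 : Integrable (fun x => f x ^ 2) μ) :
    (∫ x, f x ∂μ) ^ 2 ≤ μ.real univ * ∫ x, f x ^ 2 ∂μ := by
  set m := μ.real univ with hm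
  set I := ∫ x, f x ∂μ with hI
  rcases (measureReal_nonneg : 0 ≤ μ.real univ).eq_or_lt with h0 | h0
  · have : μ = 0 := by
      rw [← Measure.measure_univ_eq_zero]
      exact (measureReal_eq_zero_iff).1 h0.symm
    simp [hI, this]
  · have h1 : 0 ≤ ∫ x, (m * f x - I) ^ 2 ∂μ := integral_nonneg fun x => sq_nonneg _
    have h2 : ∫ x, (m * f x - I) ^ 2 ∂μ = m ^ 2 * ∫ x, f x ^ 2 ∂μ - 2 * m * I * I + m * I ^ 2 := by
      have : ∀ x, (m * f x - I) ^ 2 = m ^ 2 * f x ^ 2 - 2 * m * I * f x + I ^ 2 := fun x => by ring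
      simp_rw [this]
      rw [integral_add, integral_sub, integral_const_mul, integral_const_mul]
      · simp [hm, hI]
      · exact hf2.const_mul _
      · exact hf.const_mul _
      · exact (hf2.const_mul _).sub (hf.const_mul _)
      · exact integrable_const _
    rw [h2] at h1
    have h3 : 0 ≤ m * (m * ∫ x, f x ^ 2 ∂μ - I ^ 2) := by nlinarith
    have := nonneg_of_mul_nonneg_right h3 h0
    linarith

lemma c11_seg_deriv {d : ℕ} {K : ℝ} {g : Eu d → ℝ} {G : Eu d → Eu d} (h : C11 d K g G)
    {x y : Eu d} (hx : x ∈ unitCube d) (hy : y ∈ unitCube d) {t : ℝ} (ht : t ∈ Ioo (0 : ℝ) 1) :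
    HasDerivAt (fun s : ℝ => g (y + s • (x - y))) ⟪G (y + t • (x - y)), x - y⟫ t := by
  rw [hasDerivAt_iff_isLittleO]
  have h2 : (fun s : ℝ => ‖s - t‖ ^ 2) =o[nhds t] (fun s => s - t) := by
    have := Asymptotics.isLittleO_pow_sub_sub t (m := 2) (by norm_num)
    simpa using this
  refine Asymptotics.IsBigO.trans_isLittleO ?_ h2
  apply Asymptotics.IsBigO.of_bound (K * ‖x - y‖ ^ 2)
  filter_upwards [Ioo_mem_nhds ht.1 ht.2] with s hs
  have := h.rem _ (seg_mem hx hy ⟨hs.1.le, hs.2.le⟩) _ (seg_mem hx hy ⟨ht.1.le, ht.2.le⟩)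
  have e : y + s • (x - y) - (y + t • (x - y)) = (s - t) • (x - y) := by
    rw [sub_smul]; abel
  rw [e, inner_smul_right, norm_smul, mul_pow] at this
  rw [Real.norm_eq_abs, smul_eq_mul]
  refine this.trans (le_of_eq ?_)
  rw [Real.norm_of_nonneg (by positivity : (0:ℝ) ≤ ‖s - t‖ ^ 2)]
  ring

lemma c11_seg_sq {d : ℕ} {K : ℝ} {g : Eu d → ℝ} {G : Eu d → Eu d} (h : C11 d K g G)
    (hg : Continuous g) (hG : Continuous G)
    {x y : Eu d} (hx : x ∈ unitCube d) (hy : y ∈ unitCube d) :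
    ENNReal.ofReal ((g x - g y) ^ 2) ≤
      ∫⁻ t in Ioc (0 : ℝ) 1, ENNReal.ofReal (‖x - y‖ ^ 2) *
        ENNReal.ofReal (‖G (y + t • (x - y))‖ ^ 2) := by
  have hc : Continuous fun t : ℝ => ⟪G (y + t • (x - y)), x - y⟫ := by fun_prop
  have hftc : ∫ t in (0 : ℝ)..1, ⟪G (y + t • (x - y)), x - y⟫ = g x - g y := by
    rw [intervalIntegral.integral_eq_sub_of_hasDerivAt_of_le (f := fun s : ℝ => g (y + s • (x - y)))
      zero_le_one (by fun_prop) (fun t ht => c11_seg_deriv h hx hy ht) (hc.intervalIntegrable _ _)]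
    simp
  rw [intervalIntegral.integral_of_le zero_le_one] at hftc
  have hInt0 : ∀ F : ℝ → ℝ, Continuous F → Integrable F (volume.restrict (Ioc (0:ℝ) 1)) :=
    fun F hF => (hF.integrableOn_Icc (a := 0) (b := 1)).mono_set Ioc_subset_Icc_self
  have hs := sq_integral_le (volume.restrict (Ioc (0 : ℝ) 1)) _ (hInt0 _ hc) (hInt0 _ (hc.pow 2))
  rw [hftc] at hs
  have e1 : (volume.restrict (Ioc (0 : ℝ) 1)).real univ = 1 := by simp
  rw [e1, one_mul] at hs
  have hs2 : (g x - g y) ^ 2 ≤ ∫ t in Ioc (0 : ℝ) 1, ‖x - y‖ ^ 2 * ‖G (y + t • (x - y))‖ ^ 2 := by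
    refine hs.trans (integral_mono (hInt0 _ (hc.pow 2)) (hInt0 _ (by fun_prop)) fun t => ?_)
    have := abs_real_inner_le_norm (G (y + t • (x - y))) (x - y)
    calc ⟪G (y + t • (x - y)), x - y⟫ ^ 2 = |⟪G (y + t • (x - y)), x - y⟫| ^ 2 := (sq_abs _).symm
      _ ≤ (‖G (y + t • (x - y))‖ * ‖x - y‖) ^ 2 := by gcongr
      _ = _ := by ring
  calc ENNReal.ofReal ((g x - g y) ^ 2) ≤ ENNReal.ofReal (∫ t in Ioc (0 : ℝ) 1, ‖x - y‖ ^ 2 * ‖G (y + t • (x - y))‖ ^ 2) :=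
        ENNReal.ofReal_le_ofReal hs2
    _ = ∫⁻ t in Ioc (0 : ℝ) 1, ENNReal.ofReal (‖x - y‖ ^ 2 * ‖G (y + t • (x - y))‖ ^ 2) := by
        rw [ofReal_integral_eq_lintegral_ofReal (hInt0 _ (by fun_prop))]
        exact Filter.Eventually.of_forall fun t => by positivity
    _ = _ := by
        congr 1; ext t; rw [ENNReal.ofReal_mul (by positivity)]

lemma scale_bound {d : ℕ} {Q : Set (Eu d)} (hQc : Convex ℝ Q) (hQm : MeasurableSet Q)
    (φ : Eu d → ℝ≥0∞) (hφ : Measurable φ) {s : ℝ} (hs : 1 / 2 ≤ s) (hs1 : s ≤ 1) {z : Eu d}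
    (hz : z ∈ Q) :
    ∫⁻ y in Q, φ (s • y + (1 - s) • z) ≤ 2 ^ d * ∫⁻ y in Q, φ y := by
  have h0 : s ≠ 0 := by linarith
  have hψ : Measurable (Q.indicator φ) := hφ.indicator hQm
  calc ∫⁻ y in Q, φ (s • y + (1 - s) • z)
      ≤ ∫⁻ y in Q, Q.indicator φ (s • y + (1 - s) • z) := by
        apply setLIntegral_mono' hQm
        intro y hy
        rw [indicator_of_mem]
        exact hQc hy hz (by linarith) (by linarith) (by ring)
    _ ≤ ∫⁻ y, Q.indicator φ (s • y + (1 - s) • z) := setLIntegral_le_lintegral _ _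
    _ = ∫⁻ w, Q.indicator φ (w + (1 - s) • z) ∂(Measure.map (s • ·) volume) := by
        have hmm : Measurable fun w : Eu d => Q.indicator φ (w + (1 - s) • z) :=
          hψ.comp (measurable_add_const _)
        rw [lintegral_map hmm (measurable_const_smul s)]
    _ = ENNReal.ofReal |(s ^ d)⁻¹| * ∫⁻ w, Q.indicator φ w := by
        rw [Measure.map_addHaar_smul _ h0, lintegral_smul_measure, lintegral_add_right_eq_self (Q.indicator φ)]
        simp
    _ ≤ 2 ^ d * ∫⁻ y in Q, φ y := by
        rw [lintegral_indicator hQm]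
        gcongr
        rw [abs_of_pos (by positivity), ← inv_pow, ENNReal.ofReal_pow (by positivity)]
        gcongr
        rw [show (2 : ℝ≥0∞) = ENNReal.ofReal 2 by simp]
        apply ENNReal.ofReal_le_ofReal
        rw [inv_le_comm₀ (by linarith) (by norm_num)]
        linarith

lemma poincare {d : ℕ} {K : ℝ} {g : Eu d → ℝ} {G : Eu d → Eu d} (h : C11 d K g G)
    (hg : Continuous g) (hG : Continuous G) {Q : Set (Eu d)} (hQ : Q ⊆ unitCube d)
    (hQc : Convex ℝ Q) (hQm : MeasurableSet Q) {D : ℝ}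
    (hD : ∀ x ∈ Q, ∀ y ∈ Q, ‖x - y‖ ^ 2 ≤ D) :
    ∫⁻ x in Q, ∫⁻ y in Q, ENNReal.ofReal ((g x - g y) ^ 2) ≤
      ENNReal.ofReal D * (2 ^ d * volume Q * ∫⁻ x in Q, ENNReal.ofReal (‖G x‖ ^ 2)) := by
  set φ : Eu d → ℝ≥0∞ := fun x => ENNReal.ofReal (‖G x‖ ^ 2) with hφ
  have hφc : Continuous φ := ENNReal.continuous_ofReal.comp (by fun_prop)
  have hφm : Measurable φ := hφc.measurable
  have hseg : ∀ x ∈ unitCube d, ∀ y ∈ unitCube d, ENNReal.ofReal ((g x - g y) ^ 2) ≤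
      ∫⁻ t in Ioc (0 : ℝ) 1, ENNReal.ofReal (‖x - y‖ ^ 2) * φ (y + t • (x - y)) :=
    fun x hx y hy => c11_seg_sq h hg hG hx hy
  clear_value φ
  have hcont : Continuous (fun p : (Eu d × Eu d) × ℝ => φ (p.1.2 + p.2 • (p.1.1 - p.1.2))) := by
    fun_prop
  have key : ∀ t ∈ Ioc (0 : ℝ) 1, ∫⁻ x in Q, ∫⁻ y in Q, φ (y + t • (x - y)) ≤
      2 ^ d * volume Q * ∫⁻ x in Q, φ x := by
    intro t ht
    rcases le_total t (1 / 2) with h2 | h2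
    · calc ∫⁻ x in Q, ∫⁻ y in Q, φ (y + t • (x - y)) ≤ ∫⁻ x in Q, 2 ^ d * ∫⁻ x in Q, φ x := by
            apply setLIntegral_mono' hQm
            intro x hx
            have := scale_bound hQc hQm φ hφm (s := 1 - t) (by linarith) (by linarith [ht.1]) hx
            refine le_trans (le_of_eq ?_) this
            congr 1; ext y; congr 1
            rw [smul_sub, sub_sub_cancel, sub_smul, one_smul]; abel
        _ = _ := by rw [setLIntegral_const]; ring
    · rw [lintegral_lintegral_swap]
      · calc ∫⁻ y in Q, ∫⁻ x in Q, φ (y + t • (x - y)) ≤ ∫⁻ y in Q, 2 ^ d * ∫⁻ x in Q, φ x := by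
              apply setLIntegral_mono' hQm
              intro y hy
              have := scale_bound hQc hQm φ hφm (s := t) h2 ht.2 hy
              refine le_trans (le_of_eq ?_) this
              congr 1; ext x; congr 1
              rw [smul_sub, sub_smul, one_smul]; abel
          _ = _ := by rw [setLIntegral_const]; ring
      · have : Continuous (Function.uncurry fun x y : Eu d => φ (y + t • (x - y))) := by
          unfold Function.uncurry; fun_prop
        exact this.measurable.aemeasurable
  have hm3 : Measurable (fun p : (Eu d × Eu d) × ℝ => φ (p.1.2 + p.2 • (p.1.1 - p.1.2))) :=
    hcont.measurable
  have hm2 : Measurable (fun p : (Eu d × ℝ) × Eu d => φ (p.2 + p.1.2 • (p.1.1 - p.2))) := by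
    have : Continuous (fun p : (Eu d × ℝ) × Eu d => φ (p.2 + p.1.2 • (p.1.1 - p.2))) := by
      fun_prop
    exact this.measurable
  calc ∫⁻ x in Q, ∫⁻ y in Q, ENNReal.ofReal ((g x - g y) ^ 2)
      ≤ ∫⁻ x in Q, ∫⁻ y in Q, ENNReal.ofReal D * ∫⁻ t in Ioc (0 : ℝ) 1, φ (y + t • (x - y)) := by
        apply setLIntegral_mono' hQm
        intro x hx
        apply setLIntegral_mono' hQm
        intro y hy
        refine (hseg x (hQ hx) y (hQ hy)).trans ?_
        rw [lintegral_const_mul]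
        · gcongr
          exact hD x hx y hy
        · have : Continuous fun t : ℝ => φ (y + t • (x - y)) := by fun_prop
          exact this.measurable
    _ = ENNReal.ofReal D * ∫⁻ x in Q, ∫⁻ y in Q, ∫⁻ t in Ioc (0 : ℝ) 1, φ (y + t • (x - y)) := by
        have e : ∀ x, ∫⁻ y in Q, ENNReal.ofReal D * ∫⁻ t in Ioc (0 : ℝ) 1, φ (y + t • (x - y)) =
            ENNReal.ofReal D * ∫⁻ y in Q, ∫⁻ t in Ioc (0 : ℝ) 1, φ (y + t • (x - y)) := fun x =>
          lintegral_const_mul' _ _ ENNReal.ofReal_ne_top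
        simp_rw [e]
        rw [lintegral_const_mul' _ _ ENNReal.ofReal_ne_top]
    _ = ENNReal.ofReal D * ∫⁻ x in Q, ∫⁻ t in Ioc (0 : ℝ) 1, ∫⁻ y in Q, φ (y + t • (x - y)) := by
        congr 2; ext x
        rw [lintegral_lintegral_swap]
        have : Continuous (Function.uncurry fun (y : Eu d) (t : ℝ) => φ (y + t • (x - y))) := by
          unfold Function.uncurry; fun_prop
        exact this.measurable.aemeasurable
    _ = ENNReal.ofReal D * ∫⁻ t in Ioc (0 : ℝ) 1, ∫⁻ x in Q, ∫⁻ y in Q, φ (y + t • (x - y)) := by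
        congr 1
        rw [lintegral_lintegral_swap]
        exact (hm2.lintegral_prod_right' (ν := volume.restrict Q)).aemeasurable
    _ ≤ ENNReal.ofReal D * ∫⁻ t in Ioc (0 : ℝ) 1, 2 ^ d * volume Q * ∫⁻ x in Q, φ x := by
        gcongr 1
        exact setLIntegral_mono' measurableSet_Ioc key
    _ = _ := by simp

/-! ### Dyadic cells -/

/-- The dyadic cell of level `j` and index `k`. -/
def cell (d j : ℕ) (k : Fin d → ℕ) : Set (Eu d) :=
  {x | ∀ i, (k i : ℝ) ≤ 2 ^ j * x i ∧ 2 ^ j * x i < k i + 1}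

/-- The half open unit cube. -/
def box1 (d : ℕ) : Set (Eu d) := {x | ∀ i, 0 ≤ x i ∧ x i < 1}

/-- The dyadic index of level `j` of a point. -/
def didx {d : ℕ} (j : ℕ) (x : Eu d) : Fin d → ℕ := fun i => ⌊2 ^ j * x i⌋₊

/-- Cast of bounded indices. -/
def kc {d m : ℕ} (k : Fin d → Fin m) : Fin d → ℕ := fun i => (k i : ℕ)

lemma measurable_coord {d : ℕ} (i : Fin d) : Measurable fun x : Eu d => x i := by fun_prop

lemma measurableSet_cell (d j : ℕ) (k : Fin d → ℕ) : MeasurableSet (cell d j k) := by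
  have : cell d j k = ⋂ i, ({x : Eu d | (k i : ℝ) ≤ 2 ^ j * x i} ∩ {x | 2 ^ j * x i < k i + 1}) := by
    ext x; simp [cell]
  rw [this]
  refine MeasurableSet.iInter fun i => ?_
  exact (measurableSet_le measurable_const (by fun_prop)).inter
    (measurableSet_lt (by fun_prop) measurable_const)

lemma convex_cell (d j : ℕ) (k : Fin d → ℕ) : Convex ℝ (cell d j k) := by
  intro x hx y hy a b ha hb hab i
  have h1 := convex_Ico (k i : ℝ) (k i + 1) (hx i) (hy i) ha hb hab
  simp only [smul_eq_mul, mem_Ico] at h1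
  have e : (2:ℝ) ^ j * (a • x + b • y) i = a * (2 ^ j * x i) + b * (2 ^ j * y i) := by
    simp; ring
  rw [e]; exact h1

lemma mem_cell_iff {d j : ℕ} {k : Fin d → ℕ} {x : Eu d} (hx : ∀ i, 0 ≤ x i) :
    x ∈ cell d j k ↔ didx j x = k := by
  rw [funext_iff]
  refine forall_congr' fun i => ?_
  unfold didx
  rw [Nat.floor_eq_iff (by have := hx i; positivity)]

lemma cell_nonneg {d j : ℕ} {k : Fin d → ℕ} {x : Eu d} (hx : x ∈ cell d j k) (i : Fin d) :
    0 ≤ x i := by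
  have h := (hx i).1
  have h2 : (0:ℝ) ≤ k i := Nat.cast_nonneg _
  by_contra hc
  push Not at hc
  have : (2:ℝ) ^ j * x i < 0 := mul_neg_of_pos_of_neg (by positivity) hc
  linarith

lemma cell_subset_box1 {d j : ℕ} {k : Fin d → ℕ} (hk : ∀ i, k i < 2 ^ j) :
    cell d j k ⊆ box1 d := by
  intro x hx i
  refine ⟨cell_nonneg hx i, ?_⟩
  have h := (hx i).2
  have h2 : (k i : ℝ) + 1 ≤ 2 ^ j := by exact_mod_cast hk i
  have h3 : (2:ℝ) ^ j * x i < 2 ^ j * 1 := by linarith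
  exact lt_of_mul_lt_mul_left h3 (by positivity)

lemma box1_subset (d : ℕ) : box1 d ⊆ unitCube d := fun _ hx i => ⟨(hx i).1, (hx i).2.le⟩

lemma didx_lt {d j : ℕ} {x : Eu d} (hx : x ∈ box1 d) (i : Fin d) : didx j x i < 2 ^ j := by
  unfold didx
  rw [Nat.floor_lt (by have := (hx i).1; positivity)]
  push_cast
  have := (hx i).2
  have h2 : (0:ℝ) < 2 ^ j := by positivity
  nlinarith

/-- The bounded dyadic index. -/
def fidx {d : ℕ} (j : ℕ) (x : Eu d) (hx : x ∈ box1 d) : Fin d → Fin (2 ^ j) :=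
  fun i => ⟨didx j x i, didx_lt hx i⟩

lemma mem_cell_fin {d j : ℕ} {k : Fin d → Fin (2 ^ j)} {x : Eu d} (hx : x ∈ box1 d) :
    x ∈ cell d j (kc k) ↔ k = fidx j x hx := by
  rw [mem_cell_iff fun i => (hx i).1, funext_iff, funext_iff]
  refine forall_congr' fun i => ?_
  unfold kc fidx
  rw [Fin.ext_iff]
  exact eq_comm

lemma didx_succ {d j : ℕ} (x : Eu d) : (fun i => didx (j + 1) x i / 2) = didx j x := by
  funext i
  unfold didx
  rw [← Nat.floor_div_ofNat]
  congr 1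
  rw [pow_succ]
  simp only [OfNat.ofNat]
  field_simp

lemma cell_diff {d j : ℕ} {k : Fin d → ℕ} {x y : Eu d} (hx : x ∈ cell d j k)
    (hy : y ∈ cell d j k) (i : Fin d) : |x i - y i| ≤ (1 / 2) ^ j := by
  have h1 := hx i
  have h2 := hy i
  have h3 : (2:ℝ) ^ j * |x i - y i| ≤ 1 := by
    rw [← abs_of_pos (by positivity : (0:ℝ) < 2 ^ j), ← abs_mul, abs_le]
    constructor <;> rw [mul_sub] <;> linarith
  rw [one_div, inv_pow, ← one_div, le_div_iff₀ (by positivity)]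
  linarith

lemma cell_norm {d j : ℕ} {k : Fin d → ℕ} {x y : Eu d} (hx : x ∈ cell d j k)
    (hy : y ∈ cell d j k) : ‖x - y‖ ≤ d * (1 / 2) ^ j := by
  calc ‖x - y‖ ≤ ∑ i, |(x - y) i| := norm_le_sum_abs _
    _ ≤ ∑ _i : Fin d, ((1:ℝ) / 2) ^ j := Finset.sum_le_sum fun i _ => by
        simpa using cell_diff hx hy i
    _ = _ := by simp

lemma volume_cell (d j : ℕ) (k : Fin d → ℕ) :
    volume (cell d j k) = ENNReal.ofReal (((1 / 2) ^ j) ^ d) := by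
  have h1 : cell d j k = (WithLp.ofLp) ⁻¹' (Set.univ.pi fun i : Fin d =>
      Set.Ico ((k i : ℝ) / 2 ^ j) ((k i + 1) / 2 ^ j)) := by
    ext x
    simp only [cell, mem_ofPred_eq, mem_preimage, mem_univ_pi, mem_Ico]
    refine forall_congr' fun i => ?_
    rw [div_le_iff₀ (by positivity), lt_div_iff₀ (by positivity), mul_comm]
  rw [h1, (PiLp.volume_preserving_ofLp (Fin d)).measure_preimage
    (MeasurableSet.univ_pi fun i => measurableSet_Ico).nullMeasurableSet, volume_pi_pi]
  have : ∀ i, volume (Set.Ico ((k i : ℝ) / 2 ^ j) ((k i + 1) / 2 ^ j)) =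
      ENNReal.ofReal ((1/2) ^ j) := by
    intro i
    rw [Real.volume_Ico]
    congr 1
    rw [← sub_div]; simp
  simp only [this, Finset.prod_const, Finset.card_univ, Fintype.card_fin]
  rw [← ENNReal.ofReal_pow (by positivity)]

lemma isCompact_unitCube (d : ℕ) : IsCompact (unitCube d) := by
  have h1 : unitCube d = (PiLp.continuousLinearEquiv 2 ℝ (fun _ : Fin d => ℝ)).symm ''
      (Set.univ.pi fun _ => Icc 0 1) := by
    ext x
    constructor
    · intro hx
      exact ⟨WithLp.ofLp x, fun i _ => hx i, by ext i; simp⟩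
    · rintro ⟨y, hy, rfl⟩ i
      simpa using hy i (mem_univ i)
  rw [h1]
  exact (isCompact_univ_pi fun _ => isCompact_Icc).image (ContinuousLinearEquiv.continuous _)

lemma measurableSet_unitCube (d : ℕ) : MeasurableSet (unitCube d) :=
  (isCompact_unitCube d).isClosed.measurableSet

lemma measurableSet_box1 (d : ℕ) : MeasurableSet (box1 d) := by
  have : box1 d = ⋂ i, ({x : Eu d | 0 ≤ x i} ∩ {x | x i < 1}) := by
    ext x; simp [box1]
  rw [this]
  refine MeasurableSet.iInter fun i => ?_
  exact (measurableSet_le measurable_const (by fun_prop)).inter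
    (measurableSet_lt (by fun_prop) measurable_const)

lemma volume_unitCube (d : ℕ) : volume (unitCube d) = 1 := by
  have h1 : unitCube d = (WithLp.ofLp) ⁻¹' (Set.univ.pi fun _ : Fin d => Set.Icc (0:ℝ) 1) := by
    ext x
    simp only [unitCube, mem_ofPred_eq, mem_preimage, mem_univ_pi]
  rw [h1, (PiLp.volume_preserving_ofLp (Fin d)).measure_preimage
    (MeasurableSet.univ_pi fun i => measurableSet_Icc).nullMeasurableSet, volume_pi_pi]
  simp

lemma volume_box1 (d : ℕ) : volume (box1 d) = 1 := by
  have h1 : box1 d = (WithLp.ofLp) ⁻¹' (Set.univ.pi fun _ : Fin d => Set.Ico (0:ℝ) 1) := by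
    ext x
    simp [box1]
  rw [h1, (PiLp.volume_preserving_ofLp (Fin d)).measure_preimage
    (MeasurableSet.univ_pi fun i => measurableSet_Ico).nullMeasurableSet, volume_pi_pi]
  simp

lemma restrict_box1 (d : ℕ) : volume.restrict (unitCube d) = volume.restrict (box1 d) := by
  apply Measure.restrict_congr_set
  have h : volume (unitCube d \ box1 d) = 0 := by
    rw [measure_sdiff (box1_subset d) (measurableSet_box1 d).nullMeasurableSet (by simp [volume_box1]),
      volume_box1, volume_unitCube]; simp
  exact Filter.EventuallyLE.antisymm (ae_le_set.2 h) (LE.le.eventuallyLE (box1_subset d))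

lemma iUnion_cell (d j : ℕ) : ⋃ k : Fin d → Fin (2 ^ j), cell d j (kc k) = box1 d := by
  apply Subset.antisymm
  · exact iUnion_subset fun k => cell_subset_box1 fun i => (k i).2
  · intro x hx
    exact mem_iUnion.2 ⟨fidx j x hx, (mem_cell_fin hx).2 rfl⟩

lemma disjoint_cell (d j : ℕ) :
    Pairwise (Function.onFun Disjoint fun k : Fin d → Fin (2 ^ j) => cell d j (kc k)) := by
  intro k l hkl
  rw [Function.onFun, Set.disjoint_left]
  intro x hx hy
  have hb := cell_subset_box1 (fun i => (k i).2) hx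
  exact hkl (((mem_cell_fin hb).1 hx).trans ((mem_cell_fin hb).1 hy).symm)

lemma sum_cell_integral {d : ℕ} (j : ℕ) {F : Eu d → ℝ} (hF : IntegrableOn F (unitCube d)) :
    ∑ k : Fin d → Fin (2 ^ j), ∫ x in cell d j (kc k), F x = ∫ x in unitCube d, F x := by
  rw [restrict_box1, ← iUnion_cell d j, integral_iUnion_fintype]
  · exact fun k => measurableSet_cell _ _ _
  · exact disjoint_cell d j
  · intro k
    exact hF.mono_set ((cell_subset_box1 fun i => (k i).2).trans (box1_subset d))

/-! ### Averages over cells -/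

/-- The average of `u` over the dyadic cell. -/
def avg {d : ℕ} (u : Eu d → ℝ) (j : ℕ) (k : Fin d → ℕ) : ℝ :=
  ((2 : ℝ) ^ j) ^ d * ∫ x in cell d j k, u x

lemma qinv (d j : ℕ) : ((2 : ℝ) ^ j) ^ d * (((1 / 2) ^ j) ^ d) = 1 := by
  rw [← mul_pow, ← mul_pow]; norm_num

lemma vreal_cell (d j : ℕ) (k : Fin d → ℕ) :
    (volume.restrict (cell d j k)).real univ = ((1 / 2) ^ j) ^ d := by
  rw [measureReal_restrict_apply_univ, Measure.real, volume_cell, ENNReal.toReal_ofReal (by positivity)]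

instance finite_cell (d j : ℕ) (k : Fin d → ℕ) : IsFiniteMeasure (volume.restrict (cell d j k)) := by
  constructor
  rw [Measure.restrict_apply_univ, volume_cell]
  exact ENNReal.ofReal_lt_top

lemma integrableOn_cube {d : ℕ} {u : Eu d → ℝ} (hu : Continuous u) :
    IntegrableOn u (unitCube d) := hu.continuousOn.integrableOn_compact (isCompact_unitCube d)

lemma cell_subset_cube {d j : ℕ} {k : Fin d → ℕ} (hk : ∀ i, k i < 2 ^ j) :
    cell d j k ⊆ unitCube d := (cell_subset_box1 hk).trans (box1_subset d)

lemma integrableOn_cell {d : ℕ} {u : Eu d → ℝ} (hu : Continuous u) {j : ℕ} {k : Fin d → ℕ}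
    (hk : ∀ i, k i < 2 ^ j) : Integrable u (volume.restrict (cell d j k)) :=
  (integrableOn_cube hu).mono_set (cell_subset_cube hk)

lemma avg_const {d : ℕ} (c : ℝ) (j : ℕ) (k : Fin d → ℕ) : avg (fun _ => c) j k = c := by
  unfold avg
  rw [integral_const, vreal_cell, smul_eq_mul, ← mul_assoc, qinv, one_mul]

lemma avg_sub {d : ℕ} {u v : Eu d → ℝ} (hu : Continuous u) (hv : Continuous v) {j : ℕ}
    {k : Fin d → ℕ} (hk : ∀ i, k i < 2 ^ j) :
    avg (fun x => u x - v x) j k = avg u j k - avg v j k := by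
  unfold avg
  rw [integral_sub (integrableOn_cell hu hk) (integrableOn_cell hv hk), mul_sub]

lemma avg_const_mul {d : ℕ} (c : ℝ) (u : Eu d → ℝ) (j : ℕ) (k : Fin d → ℕ) :
    avg (fun x => c * u x) j k = c * avg u j k := by
  unfold avg
  rw [integral_const_mul]; ring

lemma avg_sum {d : ℕ} {ι : Type*} (s : Finset ι) {u : ι → Eu d → ℝ} (hu : ∀ i, Continuous (u i))
    {j : ℕ} {k : Fin d → ℕ} (hk : ∀ i, k i < 2 ^ j) :
    avg (fun x => ∑ i ∈ s, u i x) j k = ∑ i ∈ s, avg (u i) j k := by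
  unfold avg
  rw [integral_finsetSum _ (fun i _ => integrableOn_cell (hu i) hk), Finset.mul_sum]

lemma abs_avg_le {d : ℕ} {u : Eu d → ℝ} {j : ℕ} {k : Fin d → ℕ} {B : ℝ}
    (hB : ∀ x ∈ cell d j k, |u x| ≤ B) : |avg u j k| ≤ B := by
  unfold avg
  have h := norm_setIntegral_le_of_norm_le_const (μ := volume) (f := u) (s := cell d j k) (C := B)
    (by rw [volume_cell]; exact ENNReal.ofReal_lt_top) hB
  rw [Measure.real, volume_cell, ENNReal.toReal_ofReal (by positivity), Real.norm_eq_abs] at h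
  rw [abs_mul, abs_of_pos (by positivity)]
  calc ((2 : ℝ) ^ j) ^ d * |∫ x in cell d j k, u x| ≤ (2 ^ j) ^ d * (B * ((1 / 2) ^ j) ^ d) := by
        gcongr
    _ = B * ((2 ^ j) ^ d * ((1 / 2) ^ j) ^ d) := by ring
    _ = B := by rw [qinv, mul_one]

lemma avg_sq_le {d : ℕ} {u : Eu d → ℝ} (hu : Continuous u) {j : ℕ}
    {k : Fin d → ℕ} (hk : ∀ i, k i < 2 ^ j) :
    avg u j k ^ 2 ≤ ((2 : ℝ) ^ j) ^ d * ∫ x in cell d j k, u x ^ 2 := by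
  unfold avg
  have h := sq_integral_le (volume.restrict (cell d j k)) u (integrableOn_cell hu hk)
    (integrableOn_cell (hu.pow 2) hk)
  rw [vreal_cell] at h
  rw [mul_pow]
  calc (((2 : ℝ) ^ j) ^ d) ^ 2 * (∫ x in cell d j k, u x) ^ 2
      ≤ (((2 : ℝ) ^ j) ^ d) ^ 2 * (((1 / 2) ^ j) ^ d * ∫ x in cell d j k, u x ^ 2) := by gcongr
    _ = ((2 : ℝ) ^ j) ^ d * (((2 : ℝ) ^ j) ^ d * ((1 / 2) ^ j) ^ d) * ∫ x in cell d j k, u x ^ 2 := by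
        ring
    _ = _ := by rw [qinv, mul_one]

lemma integrable_prod_cell {d : ℕ} {F : Eu d × Eu d → ℝ} (hF : Continuous F) {j j' : ℕ}
    {k k' : Fin d → ℕ} (hk : ∀ i, k i < 2 ^ j) (hk' : ∀ i, k' i < 2 ^ j') :
    Integrable F ((volume.restrict (cell d j k)).prod (volume.restrict (cell d j' k'))) := by
  rw [Measure.prod_restrict]
  have h := hF.continuousOn.integrableOn_compact (μ := (volume : Measure (Eu d)).prod volume)
    ((isCompact_unitCube d).prod (isCompact_unitCube d))
  exact h.mono_set (prod_mono (cell_subset_cube hk) (cell_subset_cube hk'))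

lemma poincare_real {d : ℕ} {K : ℝ} {g : Eu d → ℝ} {G : Eu d → Eu d} (h : C11 d K g G)
    (hg : Continuous g) (hG : Continuous G) {j : ℕ}
    {k : Fin d → ℕ} (hk : ∀ i, k i < 2 ^ j) :
    ∫ z, (g z.1 - g z.2) ^ 2 ∂((volume.restrict (cell d j k)).prod (volume.restrict (cell d j k))) ≤
      (d * (1 / 2) ^ j) ^ 2 * (2 ^ d * ((1 / 2) ^ j) ^ d * ∫ x in cell d j k, ‖G x‖ ^ 2) := by
  have hp := poincare h hg hG (cell_subset_cube hk) (convex_cell d j k) (measurableSet_cell d j k)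
    (D := (d * (1 / 2) ^ j) ^ 2) (fun x hx y hy => by
      have := cell_norm hx hy
      gcongr)
  have hv : 0 ≤ ∫ x in cell d j k, ‖G x‖ ^ 2 := integral_nonneg fun x => by positivity
  rw [integral_eq_lintegral_of_nonneg_ae (Filter.Eventually.of_forall fun z => sq_nonneg _)
    (by fun_prop)]
  apply ENNReal.toReal_le_of_le_ofReal (by positivity)
  rw [lintegral_prod _ (by
    have : Continuous fun z : Eu d × Eu d => ENNReal.ofReal ((g z.1 - g z.2) ^ 2) :=
      ENNReal.continuous_ofReal.comp (by fun_prop)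
    exact this.measurable.aemeasurable)]
  refine hp.trans (le_of_eq ?_)
  rw [volume_cell, ← ofReal_integral_eq_lintegral_ofReal
    (integrableOn_cell (u := fun x => ‖G x‖ ^ 2) (by fun_prop) hk)
    (Filter.Eventually.of_forall fun z => sq_nonneg _),
    ENNReal.ofReal_mul (by positivity), ENNReal.ofReal_mul (by positivity),
    ENNReal.ofReal_mul (p := 2 ^ d) (by positivity), ENNReal.ofReal_pow (p := 2) (by positivity)]
  simp

lemma avg_diff_sq {d : ℕ} {K : ℝ} {g : Eu d → ℝ} {G : Eu d → Eu d} (h : C11 d K g G)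
    (hg : Continuous g) (hG : Continuous G) {j j' : ℕ}
    {k k' : Fin d → ℕ} (hk : ∀ i, k i < 2 ^ j) (hk' : ∀ i, k' i < 2 ^ j')
    (hsub : cell d j' k' ⊆ cell d j k) :
    (avg g j' k' - avg g j k) ^ 2 ≤
      ((2:ℝ) ^ j') ^ d * ((d * (1 / 2) ^ j) ^ 2 * 2 ^ d * ∫ x in cell d j k, ‖G x‖ ^ 2) := by
  set μ' := volume.restrict (cell d j' k')
  set μ := volume.restrict (cell d j k)
  set A := ((2:ℝ) ^ j) ^ d with hA
  set A' := ((2:ℝ) ^ j') ^ d with hA'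
  have hA0 : 0 < A := by positivity
  have hA0' : 0 < A' := by positivity
  have e1 : ∫ z, (g z.1 - g z.2) ∂(μ'.prod μ) = A⁻¹ * A'⁻¹ * (avg g j' k' - avg g j k) := by
    rw [integral_sub (integrable_prod_cell (by fun_prop) hk' hk)
      (integrable_prod_cell (by fun_prop) hk' hk), integral_fun_fst, integral_fun_snd,
      vreal_cell, vreal_cell]
    have q1 : (((1:ℝ) / 2) ^ j) ^ d = A⁻¹ := eq_inv_of_mul_eq_one_right (qinv d j)
    have q2 : (((1:ℝ) / 2) ^ j') ^ d = A'⁻¹ := eq_inv_of_mul_eq_one_right (qinv d j')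
    rw [q1, q2]
    unfold avg
    rw [← hA, ← hA', smul_eq_mul, smul_eq_mul]
    field_simp
  have h1 := sq_integral_le (μ'.prod μ) (fun z => g z.1 - g z.2)
    (integrable_prod_cell (by fun_prop) hk' hk) (integrable_prod_cell (by fun_prop) hk' hk)
  have e2 : (μ'.prod μ).real univ = A⁻¹ * A'⁻¹ := by
    rw [← univ_prod_univ, measureReal_prod_prod, vreal_cell, vreal_cell]
    have q1 : (((1:ℝ) / 2) ^ j) ^ d = A⁻¹ := eq_inv_of_mul_eq_one_right (qinv d j)
    have q2 : (((1:ℝ) / 2) ^ j') ^ d = A'⁻¹ := eq_inv_of_mul_eq_one_right (qinv d j')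
    rw [q1, q2, mul_comm]
  have h2 : ∫ z, (g z.1 - g z.2) ^ 2 ∂(μ'.prod μ) ≤ ∫ z, (g z.1 - g z.2) ^ 2 ∂(μ.prod μ) := by
    apply integral_mono_measure
    · exact Measure.prod_mono (Measure.restrict_mono hsub le_rfl) le_rfl
    · exact Filter.Eventually.of_forall fun z => sq_nonneg _
    · exact integrable_prod_cell (by fun_prop) hk hk
  have h3 := poincare_real h hg hG hk
  have q1 : (((1:ℝ) / 2) ^ j) ^ d = A⁻¹ := eq_inv_of_mul_eq_one_right (qinv d j)
  rw [q1] at h3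
  rw [e1, e2] at h1
  have h4 := h1.trans (mul_le_mul_of_nonneg_left (h2.trans h3) (by positivity))
  set V := ∫ x in cell d j k, ‖G x‖ ^ 2
  have h5 := mul_le_mul_of_nonneg_left h4 (by positivity : 0 ≤ (A * A') ^ 2)
  have l1 : (A * A') ^ 2 * (A⁻¹ * A'⁻¹ * (avg g j' k' - avg g j k)) ^ 2 =
      (avg g j' k' - avg g j k) ^ 2 := by field_simp
  have l2 : (A * A') ^ 2 * (A⁻¹ * A'⁻¹ * ((d * (1 / 2) ^ j) ^ 2 * (2 ^ d * A⁻¹ * V))) =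
      A' * ((d * (1 / 2) ^ j) ^ 2 * 2 ^ d * V) := by field_simp
  rw [l1, l2] at h5
  exact h5

lemma sum_half_le {d j : ℕ} (F : (Fin d → ℕ) → ℝ) (hF : ∀ k, 0 ≤ F k) :
    ∑ k : Fin d → Fin (2 ^ (j + 1)), F (fun i => kc k i / 2) ≤
      2 ^ d * ∑ p : Fin d → Fin (2 ^ j), F (kc p) := by
  let e : (Fin d → Fin (2 ^ (j + 1))) → (Fin d → Fin (2 ^ j)) × (Fin d → Fin 2) := fun k =>
    (fun i => ⟨(k i : ℕ) / 2, by
      have := lt_of_lt_of_eq (k i).2 (pow_succ 2 j)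
      omega⟩, fun i => ⟨(k i : ℕ) % 2, by omega⟩)
  have he : Function.Injective e := by
    intro k l hkl
    have h1 := congrArg Prod.fst hkl
    have h2 := congrArg Prod.snd hkl
    funext i
    have h3 := congrFun h1 i
    have h4 := congrFun h2 i
    simp only [e, Fin.mk.injEq] at h3 h4
    apply Fin.ext
    omega
  calc ∑ k : Fin d → Fin (2 ^ (j + 1)), F (fun i => kc k i / 2)
      = ∑ k : Fin d → Fin (2 ^ (j + 1)), (fun z : (Fin d → Fin (2 ^ j)) × (Fin d → Fin 2) => F (kc z.1)) (e k) := rfl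
    _ = ∑ z ∈ Finset.univ.map ⟨e, he⟩, F (kc z.1) := by rw [Finset.sum_map]; rfl
    _ ≤ ∑ z : (Fin d → Fin (2 ^ j)) × (Fin d → Fin 2), F (kc z.1) :=
        Finset.sum_le_univ_sum_of_nonneg fun z => hF _
    _ = _ := by
        rw [Fintype.sum_prod_type]
        simp [Finset.mul_sum]

lemma half_lt {d j : ℕ} (k : Fin d → Fin (2 ^ (j + 1))) (i : Fin d) : kc k i / 2 < 2 ^ j := by
  have := lt_of_lt_of_eq (k i).2 (pow_succ 2 j)
  unfold kc; omega

lemma cell_half_sub {d j : ℕ} (k : Fin d → ℕ) :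
    cell d (j + 1) k ⊆ cell d j (fun i => k i / 2) := by
  intro x hx
  have h0 := cell_nonneg hx
  rw [mem_cell_iff h0] at hx ⊢
  rw [← didx_succ, hx]

lemma incr_bound {d : ℕ} {K : ℝ} {g : Eu d → ℝ} {G : Eu d → Eu d} (h : C11 d K g G)
    (hg : Continuous g) (hG : Continuous G) (j : ℕ) :
    ∑ k : Fin d → Fin (2 ^ (j + 1)), (avg g (j + 1) (kc k) - avg g j (fun i => kc k i / 2)) ^ 2 ≤
      (8 ^ d * d ^ 2) * (((2:ℝ) ^ j) ^ d * (1 / 4) ^ j * ∫ x in unitCube d, ‖G x‖ ^ 2) := by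
  calc ∑ k : Fin d → Fin (2 ^ (j + 1)), (avg g (j + 1) (kc k) - avg g j (fun i => kc k i / 2)) ^ 2
      ≤ ∑ k : Fin d → Fin (2 ^ (j + 1)), (fun p => ((2:ℝ) ^ (j + 1)) ^ d *
        ((d * (1 / 2) ^ j) ^ 2 * 2 ^ d * ∫ x in cell d j p, ‖G x‖ ^ 2)) (fun i => kc k i / 2) := by
        apply Finset.sum_le_sum
        intro k _
        exact avg_diff_sq h hg hG (half_lt k) (fun i => (k i).2) (cell_half_sub _)
    _ ≤ 2 ^ d * ∑ p : Fin d → Fin (2 ^ j), (fun p => ((2:ℝ) ^ (j + 1)) ^ d *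
        ((d * (1 / 2) ^ j) ^ 2 * 2 ^ d * ∫ x in cell d j p, ‖G x‖ ^ 2)) (kc p) := by
        refine sum_half_le (fun p => ((2:ℝ) ^ (j + 1)) ^ d *
          ((d * (1 / 2) ^ j) ^ 2 * 2 ^ d * ∫ x in cell d j p, ‖G x‖ ^ 2)) ?_
        intro k
        have : 0 ≤ ∫ x in cell d j k, ‖G x‖ ^ 2 := integral_nonneg fun x => sq_nonneg _
        positivity
    _ = 2 ^ d * (((2:ℝ) ^ (j + 1)) ^ d * ((d * (1 / 2) ^ j) ^ 2 * 2 ^ d * ∫ x in unitCube d, ‖G x‖ ^ 2)) := by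
        simp only [← Finset.mul_sum]
        rw [sum_cell_integral j (integrableOn_cube (by fun_prop))]
    _ = _ := by
        have e1 : ((2:ℝ) ^ (j + 1)) ^ d = (2 ^ j) ^ d * 2 ^ d := by rw [pow_succ, mul_pow]
        have e2 : (((1:ℝ) / 2) ^ j) ^ 2 = (1 / 4) ^ j := by rw [← pow_mul, mul_comm, pow_mul]; norm_num
        have e3 : (8:ℝ) ^ d = 2 ^ d * 2 ^ d * 2 ^ d := by rw [← mul_pow, ← mul_pow]; norm_num
        rw [e1, mul_pow, e2, e3]
        ring

/-! ### Multiscale decomposition -/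

/-- Indicator of a dyadic cell of level `j+1`. -/
def psi (d j : ℕ) (k : Fin d → Fin (2 ^ (j + 1))) : Eu d → ℝ :=
  (cell d (j + 1) (kc k)).indicator fun _ => 1

/-- Localised linear functions. -/
def eta (d J : ℕ) (p : Fin d × (Fin d → Fin (2 ^ J))) : Eu d → ℝ :=
  (cell d J (kc p.2)).indicator fun x => x p.1 - avg (fun y : Eu d => y p.1) J (kc p.2)

/-- Increment coefficient. -/
def inc {d : ℕ} (g : Eu d → ℝ) (j : ℕ) (k : Fin d → Fin (2 ^ (j + 1))) : ℝ :=
  avg g (j + 1) (kc k) - avg g j (fun i => kc k i / 2)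

/-- Residual of the multiscale decomposition. -/
def resid {d : ℕ} (g : Eu d → ℝ) (G : Eu d → Eu d) (J : ℕ) (x : Eu d) : ℝ :=
  g x - avg g 0 (fun _ => 0) - (∑ j ∈ Finset.range J, ∑ k, inc g j k * psi d j k x)
    - ∑ p : Fin d × (Fin d → Fin (2 ^ J)), avg (fun y => G y p.1) J (kc p.2) * eta d J p x

lemma kc_fidx {d j : ℕ} {x : Eu d} (hx : x ∈ box1 d) : kc (fidx j x hx) = didx j x := rfl

lemma sum_psi {d j : ℕ} (a : (Fin d → Fin (2 ^ (j + 1))) → ℝ) {x : Eu d} (hx : x ∈ box1 d) :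
    ∑ k, a k * psi d j k x = a (fidx (j + 1) x hx) := by
  rw [Finset.sum_eq_single (fidx (j + 1) x hx)]
  · unfold psi
    rw [indicator_of_mem ((mem_cell_fin hx).2 rfl), mul_one]
  · intro k _ hk
    unfold psi
    rw [indicator_of_notMem (fun h => hk ((mem_cell_fin hx).1 h)), mul_zero]
  · simp

lemma sum_eta {d J : ℕ} (b : Fin d × (Fin d → Fin (2 ^ J)) → ℝ) {x : Eu d} (hx : x ∈ box1 d) :
    ∑ p, b p * eta d J p x =
      ∑ i, b (i, fidx J x hx) * (x i - avg (fun y : Eu d => y i) J (didx J x)) := by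
  rw [Fintype.sum_prod_type]
  refine Finset.sum_congr rfl fun i _ => ?_
  rw [Finset.sum_eq_single (fidx J x hx)]
  · unfold eta
    rw [indicator_of_mem ((mem_cell_fin hx).2 rfl)]
    rfl
  · intro k _ hk
    unfold eta
    rw [indicator_of_notMem (fun h => hk ((mem_cell_fin hx).1 h)), mul_zero]
  · simp

lemma resid_eq {d : ℕ} (g : Eu d → ℝ) (G : Eu d → Eu d) (J : ℕ) {x : Eu d} (hx : x ∈ box1 d) :
    resid g G J x = g x - avg g J (didx J x) -
      ∑ i, avg (fun y => G y i) J (didx J x) * (x i - avg (fun y : Eu d => y i) J (didx J x)) := by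
  unfold resid
  rw [sum_eta _ hx]
  have h1 : ∑ j ∈ Finset.range J, ∑ k, inc g j k * psi d j k x =
      avg g J (didx J x) - avg g 0 (didx 0 x) := by
    rw [← Finset.sum_range_sub (fun j => avg g j (didx j x))]
    refine Finset.sum_congr rfl fun j _ => ?_
    rw [sum_psi _ hx]
    unfold inc
    rw [kc_fidx]
    congr 2
    exact didx_succ x
  have h0 : didx 0 x = fun _ => 0 := by
    funext i
    have := didx_lt (j := 0) hx i
    simpa using this
  rw [h1, h0]
  simp only [kc_fidx]
  ring

lemma resid_meas {d : ℕ} {g : Eu d → ℝ} (hg : Continuous g) (G : Eu d → Eu d) (J : ℕ) :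
    Measurable (resid g G J) := by
  unfold resid
  have h1 : ∀ j k, Measurable (psi d j k) := fun j k =>
    measurable_const.indicator (measurableSet_cell _ _ _)
  have h2 : ∀ p, Measurable (eta d J p) := fun p =>
    ((measurable_coord p.1).sub_const _).indicator (measurableSet_cell _ _ _)
  have h3 := hg.measurable
  refine ((h3.sub_const _).sub ?_).sub ?_
  · exact Finset.measurable_fun_sum _ fun j _ => Finset.measurable_fun_sum _ fun k _ =>
      (h1 j k).const_mul _
  · exact Finset.measurable_fun_sum _ fun p _ => (h2 p).const_mul _

lemma mem_cell_didx {d j : ℕ} {x : Eu d} (hx : x ∈ box1 d) : x ∈ cell d j (didx j x) :=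
  (mem_cell_iff fun i => (hx i).1).2 rfl

lemma coord_avg {d j : ℕ} {k : Fin d → ℕ} (hk : ∀ i, k i < 2 ^ j) {x : Eu d}
    (hx : x ∈ cell d j k) (i : Fin d) : |x i - avg (fun y : Eu d => y i) j k| ≤ (1 / 2) ^ j := by
  have : x i - avg (fun y : Eu d => y i) j k = avg (fun y : Eu d => x i - y i) j k := by
    rw [avg_sub continuous_const (by fun_prop) hk, avg_const]
  rw [this]
  exact abs_avg_le fun y hy => cell_diff hx hy i

lemma resid_bound {d : ℕ} {K : ℝ} (hK : 0 ≤ K) {g : Eu d → ℝ} {G : Eu d → Eu d} (h : C11 d K g G)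
    (hg : Continuous g) (hG : Continuous G) (J : ℕ) {x : Eu d} (hx : x ∈ box1 d) :
    |resid g G J x| ≤ 2 * K * d ^ 2 * (1 / 4) ^ J := by
  rw [resid_eq g G J hx]
  set k := didx J x with hkdef
  have hk : ∀ i, k i < 2 ^ J := fun i => didx_lt hx i
  have hxc : x ∈ cell d J k := mem_cell_didx hx
  have hGi : ∀ i, Continuous fun y => G y i := fun i => by fun_prop
  have e : g x - avg g J k - ∑ i, avg (fun y => G y i) J k * (x i - avg (fun y : Eu d => y i) J k) =
      avg (fun y => (g x - g y) - ∑ i, avg (fun y => G y i) J k * (x i - y i)) J k := by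
    rw [avg_sub (by fun_prop) (by fun_prop) hk, avg_sub continuous_const hg hk, avg_const,
      avg_sum _ (fun i => by fun_prop) hk]
    congr 1
    refine Finset.sum_congr rfl fun i _ => ?_
    rw [avg_const_mul, avg_sub continuous_const (by fun_prop) hk, avg_const]
  rw [e]
  apply abs_avg_le
  intro y hy
  have hxu := cell_subset_cube hk hxc
  have hyu := cell_subset_cube hk hy
  have h1 := h.rem x hxu y hyu
  have hn := cell_norm hxc hy
  have e2 : g x - g y - ∑ i, avg (fun y => G y i) J k * (x i - y i) =
      (g x - g y - ⟪G y, x - y⟫) - ∑ i, (avg (fun y => G y i) J k - G y i) * (x i - y i) := by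
    have : ⟪G y, x - y⟫ = ∑ i, G y i * (x i - y i) := by
      rw [PiLp.inner_apply]
      refine Finset.sum_congr rfl fun i _ => ?_
      simp [mul_comm]
    rw [this, sub_sub (g x - g y), ← Finset.sum_add_distrib]
    congr 1
    refine Finset.sum_congr rfl fun i _ => ?_
    ring
  have h2 : ∀ i, |avg (fun y => G y i) J k - G y i| ≤ K * (d * (1 / 2) ^ J) := by
    intro i
    have : avg (fun z => G z i) J k - G y i = avg (fun z => G z i - G y i) J k := by
      rw [avg_sub (hGi i) continuous_const hk, avg_const]
    rw [this]
    refine abs_avg_le fun z hz => ?_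
    have h3 := h.lip z (cell_subset_cube hk hz) y hyu
    have h4 := PiLp.norm_apply_le (G z - G y) i
    simp only [PiLp.sub_apply, Real.norm_eq_abs] at h4
    exact h4.trans (h3.trans (mul_le_mul_of_nonneg_left (cell_norm hz hy) hK))
  have h3 : |∑ i, (avg (fun y => G y i) J k - G y i) * (x i - y i)| ≤
      ∑ _i : Fin d, K * (d * (1 / 2) ^ J) * (1 / 2) ^ J := by
    refine (Finset.abs_sum_le_sum_abs _ _).trans (Finset.sum_le_sum fun i _ => ?_)
    rw [abs_mul]
    exact mul_le_mul (h2 i) (cell_diff hxc hy i) (abs_nonneg _) (by positivity)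
  have h4 : K * ‖x - y‖ ^ 2 ≤ K * (d * (1 / 2) ^ J) ^ 2 := by gcongr
  have e4 : ((1:ℝ) / 4) ^ J = (1 / 2) ^ J * (1 / 2) ^ J := by rw [← mul_pow]; norm_num
  rw [e2, e4]
  refine (abs_sub _ _).trans ?_
  rw [Finset.sum_const, Finset.card_univ, Fintype.card_fin, nsmul_eq_mul] at h3
  nlinarith

lemma var_cell {d : ℕ} {K : ℝ} {g : Eu d → ℝ} {G : Eu d → Eu d} (h : C11 d K g G)
    (hg : Continuous g) (hG : Continuous G) {J : ℕ} {k : Fin d → ℕ} (hk : ∀ i, k i < 2 ^ J) :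
    ∫ x in cell d J k, (g x - avg g J k) ^ 2 ≤
      d ^ 2 * 2 ^ d * ((1 / 4) ^ J * ∫ x in cell d J k, ‖G x‖ ^ 2) := by
  have hpr := integrable_prod_cell (F := fun z : Eu d × Eu d => (g z.1 - g z.2) ^ 2)
    (by fun_prop) hk hk
  have h1 : ∀ x, (g x - avg g J k) ^ 2 ≤
      ((2 : ℝ) ^ J) ^ d * ∫ y in cell d J k, (g x - g y) ^ 2 := by
    intro x
    have : g x - avg g J k = avg (fun y => g x - g y) J k := by
      rw [avg_sub continuous_const hg hk, avg_const]
    rw [this]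
    exact avg_sq_le (by fun_prop) hk
  calc ∫ x in cell d J k, (g x - avg g J k) ^ 2
      ≤ ∫ x in cell d J k, ((2 : ℝ) ^ J) ^ d * ∫ y in cell d J k, (g x - g y) ^ 2 := by
        apply integral_mono
        · exact integrableOn_cell (u := fun x => (g x - avg g J k) ^ 2) (by fun_prop) hk
        · exact hpr.integral_prod_left.const_mul _
        · exact h1
    _ = ((2 : ℝ) ^ J) ^ d * ∫ z, (g z.1 - g z.2) ^ 2
          ∂((volume.restrict (cell d J k)).prod (volume.restrict (cell d J k))) := by
        rw [integral_const_mul, integral_prod _ hpr]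
    _ ≤ ((2 : ℝ) ^ J) ^ d * ((d * (1 / 2) ^ J) ^ 2 * (2 ^ d * ((1 / 2) ^ J) ^ d *
          ∫ x in cell d J k, ‖G x‖ ^ 2)) := by
        gcongr
        exact poincare_real h hg hG hk
    _ = (((2 : ℝ) ^ J) ^ d * ((1 / 2) ^ J) ^ d) * (d ^ 2 * 2 ^ d * (((1 / 2) ^ J) ^ 2 *
          ∫ x in cell d J k, ‖G x‖ ^ 2)) := by ring
    _ = _ := by
        rw [qinv, one_mul, ← pow_mul, mul_comm J 2, pow_mul]
        norm_num

lemma norm_sq_sum {d : ℕ} (v : Eu d) : ‖v‖ ^ 2 = ∑ i, v i ^ 2 := by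
  rw [EuclideanSpace.norm_sq_eq]
  simp

lemma resid_cell {d : ℕ} {K : ℝ} (hK : 0 ≤ K) {g : Eu d → ℝ} {G : Eu d → Eu d} (h : C11 d K g G)
    (hg : Continuous g) (hG : Continuous G) {J : ℕ} (k : Fin d → Fin (2 ^ J))
    (hInt0 : IntegrableOn (fun x => resid g G J x ^ 2) (unitCube d)) :
    ∫ x in cell d J (kc k), resid g G J x ^ 2 ≤
      (2 * d ^ 2 * 2 ^ d + 2 * d) * ((1 / 4) ^ J * ∫ x in cell d J (kc k), ‖G x‖ ^ 2) := by
  have hk : ∀ i, kc k i < 2 ^ J := fun i => (k i).2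
  have hGi : ∀ i, Continuous fun y => G y i := fun i => by fun_prop
  have hGi2 : ∀ i, Continuous fun y => G y i ^ 2 := fun i => by fun_prop
  set b : Fin d → ℝ := fun i => avg (fun y => G y i) J (kc k) with hb
  set B := ∑ i, b i ^ 2 with hB
  have hBle : ((1 / 2) ^ J) ^ d * B ≤ ∫ x in cell d J (kc k), ‖G x‖ ^ 2 := by
    have : B ≤ ((2:ℝ) ^ J) ^ d * ∫ x in cell d J (kc k), ‖G x‖ ^ 2 := by
      calc B ≤ ∑ i, ((2:ℝ) ^ J) ^ d * ∫ x in cell d J (kc k), G x i ^ 2 :=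
            Finset.sum_le_sum fun i _ => avg_sq_le (hGi i) hk
        _ = _ := by
            rw [← Finset.mul_sum, ← integral_finsetSum _ (fun i _ => integrableOn_cell (hGi2 i) hk)]
            congr 2; ext x; rw [norm_sq_sum]
    calc ((1 / 2) ^ J) ^ d * B ≤ ((1 / 2) ^ J) ^ d * (((2:ℝ) ^ J) ^ d * ∫ x in cell d J (kc k), ‖G x‖ ^ 2) := by
          gcongr
      _ = (((2:ℝ) ^ J) ^ d * ((1 / 2) ^ J) ^ d) * ∫ x in cell d J (kc k), ‖G x‖ ^ 2 := by ring
      _ = _ := by rw [qinv, one_mul]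
  have e4 : (((1:ℝ) / 2) ^ J) ^ 2 = (1 / 4) ^ J := by rw [← pow_mul, mul_comm, pow_mul]; norm_num
  have hpt : ∀ x ∈ cell d J (kc k), resid g G J x ^ 2 ≤
      2 * (g x - avg g J (kc k)) ^ 2 + 2 * (d * (B * (1 / 4) ^ J)) := by
    intro x hx
    have hxb := cell_subset_box1 hk hx
    have hd : didx J x = kc k := (mem_cell_iff fun i => (hxb i).1).1 hx
    rw [resid_eq g G J hxb, hd]
    have hL : (∑ i, b i * (x i - avg (fun y : Eu d => y i) J (kc k))) ^ 2 ≤ d * (B * (1 / 4) ^ J) := by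
      refine (sq_sum_le_card_mul_sum_sq (s := Finset.univ)).trans ?_
      rw [Finset.card_univ, Fintype.card_fin, hB, Finset.sum_mul]
      gcongr with i _
      rw [mul_pow, ← e4, ← sq_abs (x i - _)]
      gcongr
      exact coord_avg hk hx i
    nlinarith [sq_nonneg ((g x - avg g J (kc k)) +
      ∑ i, b i * (x i - avg (fun y : Eu d => y i) J (kc k)))]
  have hi1 : Integrable (fun x => (g x - avg g J (kc k)) ^ 2) (volume.restrict (cell d J (kc k))) :=
    integrableOn_cell (by fun_prop) hk
  calc ∫ x in cell d J (kc k), resid g G J x ^ 2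
      ≤ ∫ x in cell d J (kc k), (2 * (g x - avg g J (kc k)) ^ 2 + 2 * (d * (B * (1 / 4) ^ J))) := by
        apply setIntegral_mono_on
        · exact hInt0.mono_set (cell_subset_cube hk)
        · exact (hi1.const_mul 2).add (integrable_const _)
        · exact measurableSet_cell _ _ _
        · exact hpt
    _ = 2 * (∫ x in cell d J (kc k), (g x - avg g J (kc k)) ^ 2) +
          2 * d * (1 / 4) ^ J * (((1 / 2) ^ J) ^ d * B) := by
        rw [integral_add (hi1.const_mul 2) (integrable_const _), integral_const_mul,
          integral_const, vreal_cell, smul_eq_mul]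
        ring
    _ ≤ 2 * (d ^ 2 * 2 ^ d * ((1 / 4) ^ J * ∫ x in cell d J (kc k), ‖G x‖ ^ 2)) +
          2 * d * (1 / 4) ^ J * ∫ x in cell d J (kc k), ‖G x‖ ^ 2 := by
        gcongr
        exact var_cell h hg hG hk
    _ = _ := by ring

lemma resid_sq_int {d : ℕ} {K : ℝ} (hK : 0 ≤ K) {g : Eu d → ℝ} {G : Eu d → Eu d} (h : C11 d K g G)
    (hg : Continuous g) (hG : Continuous G) (J : ℕ) :
    IntegrableOn (fun x => resid g G J x ^ 2) (unitCube d) := by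
  apply Measure.integrableOn_of_bounded (M := (2 * K * d ^ 2 * (1 / 4) ^ J) ^ 2)
  rotate_left
  · rw [volume_unitCube]; simp
  · exact ((resid_meas hg G J).pow_const 2).aestronglyMeasurable
  · rw [restrict_box1]
    filter_upwards [ae_restrict_mem (measurableSet_box1 d)] with x hx
    rw [norm_pow]
    exact pow_le_pow_left₀ (norm_nonneg _) (resid_bound hK h hg hG J hx) 2

lemma resid_l2 {d : ℕ} {K : ℝ} (hK : 0 ≤ K) {g : Eu d → ℝ} {G : Eu d → Eu d} (h : C11 d K g G)
    (hg : Continuous g) (hG : Continuous G) (J : ℕ) :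
    ∫ x in unitCube d, resid g G J x ^ 2 ≤
      (2 * d ^ 2 * 2 ^ d + 2 * d) * ((1 / 4) ^ J * ∫ x in unitCube d, ‖G x‖ ^ 2) := by
  have hInt0 := resid_sq_int hK h hg hG J
  rw [← sum_cell_integral J hInt0, ← sum_cell_integral J (integrableOn_cube (by fun_prop)),
    Finset.mul_sum, Finset.mul_sum]
  exact Finset.sum_le_sum fun k _ => resid_cell hK h hg hG k hInt0

lemma grad_bound {d : ℕ} {G : Eu d → Eu d} (hG : Continuous G) (J : ℕ) :
    ∑ p : Fin d × (Fin d → Fin (2 ^ J)), avg (fun y => G y p.1) J (kc p.2) ^ 2 ≤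
      ((2:ℝ) ^ J) ^ d * ∫ x in unitCube d, ‖G x‖ ^ 2 := by
  have hGi : ∀ i, Continuous fun y => G y i := fun i => by fun_prop
  have hGi2 : ∀ i, Continuous fun y => G y i ^ 2 := fun i => by fun_prop
  rw [Fintype.sum_prod_type]
  calc ∑ i, ∑ k : Fin d → Fin (2 ^ J), avg (fun y => G y i) J (kc k) ^ 2
      ≤ ∑ i, ∑ k : Fin d → Fin (2 ^ J), ((2:ℝ) ^ J) ^ d * ∫ x in cell d J (kc k), (G x i) ^ 2 :=
        Finset.sum_le_sum fun i _ => Finset.sum_le_sum fun k _ => avg_sq_le (hGi i) fun i => (k i).2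
    _ = ∑ i, ((2:ℝ) ^ J) ^ d * ∫ x in unitCube d, (G x i) ^ 2 := by
        refine Finset.sum_congr rfl fun i _ => ?_
        rw [← Finset.mul_sum, sum_cell_integral J (integrableOn_cube (hGi2 i))]
    _ = _ := by
        rw [← Finset.mul_sum, ← integral_finsetSum _ (fun i _ => integrableOn_cube (hGi2 i))]
        congr 2; ext x
        rw [EuclideanSpace.norm_sq_eq]
        simp

/-! ### Empirical process tools -/

/-- The centered empirical mean. -/
def nu {Ω : Type*} [MeasurableSpace Ω] (μ : Measure Ω) {n : ℕ} (h : Ω → ℝ) (xs : Fin n → Ω) : ℝ :=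
  (n : ℝ)⁻¹ * ∑ i, h (xs i) - ∫ x, h x ∂μ

section
set_option linter.unusedSectionVars false
variable {Ω : Type*} [MeasurableSpace Ω] (μ : Measure Ω) [IsProbabilityMeasure μ]

lemma nu_sum {ι : Type*} (s : Finset ι) {n : ℕ} {h : ι → Ω → ℝ} (a : ι → ℝ)
    (hi : ∀ k, Integrable (h k) μ) (xs : Fin n → Ω) :
    nu μ (fun x => ∑ k ∈ s, a k * h k x) xs = ∑ k ∈ s, a k * nu μ (h k) xs := by
  unfold nu
  rw [integral_finsetSum _ (fun k _ => (hi k).const_mul _)]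
  simp_rw [integral_const_mul, mul_sub, Finset.sum_sub_distrib]
  congr 1
  rw [Finset.sum_comm, Finset.mul_sum]
  refine Finset.sum_congr rfl fun k _ => ?_
  rw [Finset.mul_sum, Finset.mul_sum, Finset.mul_sum]
  refine Finset.sum_congr rfl fun i _ => ?_
  ring

lemma nu_add {n : ℕ} {h h' : Ω → ℝ} (hi : Integrable h μ) (hi' : Integrable h' μ) (xs : Fin n → Ω) :
    nu μ (fun x => h x + h' x) xs = nu μ h xs + nu μ h' xs := by
  unfold nu
  rw [integral_add hi hi', Finset.sum_add_distrib]; ring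

lemma nu_const {n : ℕ} (hn : 1 ≤ n) (c : ℝ) (xs : Fin n → Ω) : nu μ (fun _ => c) xs = 0 := by
  unfold nu
  have : (n : ℝ) ≠ 0 := by positivity
  simp [this]

lemma nu_sq {n : ℕ} (hn : 1 ≤ n) {h : Ω → ℝ} (hh : MemLp h 2 μ) :
    Integrable (fun xs : Fin n → Ω => nu μ h xs ^ 2) (Measure.pi fun _ => μ) ∧
    ∫ xs : Fin n → Ω, nu μ h xs ^ 2 ∂(Measure.pi fun _ => μ) ≤ (∫ x, h x ^ 2 ∂μ) / n := by
  have hn0 : (n : ℝ) ≠ 0 := by positivity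
  set PP : Measure (Fin n → Ω) := Measure.pi fun _ => μ with hPP
  set S : (Fin n → Ω) → ℝ := ∑ i : Fin n, fun ω : Fin n → Ω => h (ω i) with hS
  have hcomp : ∀ i : Fin n, MemLp (fun ω : Fin n → Ω => h (ω i)) 2 PP := fun i =>
    hh.comp_measurePreserving (measurePreserving_eval (fun _ : Fin n => μ) i)
  have hSL : MemLp S 2 PP := memLp_finsetSum' _ fun i _ => hcomp i
  have hES : ∫ ω, S ω ∂PP = n * ∫ x, h x ∂μ := by
    simp only [hS, Finset.sum_apply]
    rw [integral_finsetSum _ (fun i _ => (hcomp i).integrable (by norm_num))]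
    have : ∀ i : Fin n, ∫ ω : Fin n → Ω, h (ω i) ∂PP = ∫ x, h x ∂μ := by
      intro i
      have hm := (measurePreserving_eval (fun _ : Fin n => μ) i)
      have := integral_map (μ := PP) (φ := fun ω : Fin n → Ω => ω i) (f := h) hm.measurable.aemeasurable
        (by rw [hm.map_eq]; exact hh.aestronglyMeasurable)
      rw [← this, hm.map_eq]
    simp [this]
  have hnu : ∀ xs : Fin n → Ω, nu μ h xs ^ 2 = ((n:ℝ)⁻¹) ^ 2 * (S xs - ∫ ω, S ω ∂PP) ^ 2 := by
    intro xs
    rw [hES, ← mul_pow, mul_sub]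
    unfold nu
    simp only [hS, Finset.sum_apply]
    rw [inv_mul_cancel_left₀ hn0]
  have hvar := ProbabilityTheory.variance_sum_pi (μ := fun _ : Fin n => μ) (X := fun _ => h) (fun _ => hh)
  have hv2 := ProbabilityTheory.variance_eq_integral (μ := PP) hSL.aestronglyMeasurable.aemeasurable
  have hInt0 : Integrable (fun xs => (S xs - ∫ ω, S ω ∂PP) ^ 2) PP :=
    (hSL.sub (memLp_const _)).integrable_sq
  constructor
  · simp_rw [hnu]
    exact hInt0.const_mul _
  · simp_rw [hnu]
    rw [integral_const_mul, ← hv2, hvar]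
    have hle : ProbabilityTheory.variance h μ ≤ ∫ x, h x ^ 2 ∂μ :=
      ProbabilityTheory.variance_le_expectation_sq hh.aestronglyMeasurable
    rw [Finset.sum_const, Finset.card_univ, Fintype.card_fin, nsmul_eq_mul]
    calc ((n:ℝ)⁻¹) ^ 2 * (n * ProbabilityTheory.variance h μ)
        ≤ ((n:ℝ)⁻¹) ^ 2 * (n * ∫ x, h x ^ 2 ∂μ) := by gcongr
      _ = _ := by field_simp

lemma nu_mgf {n : ℕ} (hn : 1 ≤ n) {h : Ω → ℝ} (hm : Measurable h) {b V s : ℝ}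
    (hb : ∀ᵐ x ∂μ, |h x| ≤ b) (hV : ∫ x, h x ^ 2 ∂μ ≤ V) (hs : 0 ≤ s) (hsb : 2 * s * b ≤ n) :
    Integrable (fun xs : Fin n → Ω => Real.exp (s * (- nu μ h xs))) (Measure.pi fun _ => μ) ∧
    ∫ xs : Fin n → Ω, Real.exp (s * (- nu μ h xs)) ∂(Measure.pi fun _ => μ) ≤
      Real.exp (s ^ 2 * V / n) := by
  have hn0 : (0:ℝ) < n := by positivity
  set m := ∫ x, h x ∂μ with hmdef
  have hL : MemLp h 2 μ := by
    refine MemLp.of_bound hm.aestronglyMeasurable b ?_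
    simpa using hb
  have hmb : |m| ≤ b := by
    have := norm_integral_le_of_norm_le_const (μ := μ) (f := h) (C := b) (by simpa using hb)
    simpa using this
  have hi := hL.integrable (by norm_num)
  set y : Ω → ℝ := fun x => -(s / n) * (h x - m) with hy
  have hym : Measurable y := by fun_prop
  have hyb : ∀ᵐ x ∂μ, |y x| ≤ 1 := by
    filter_upwards [hb] with x hx
    rw [hy]; simp only
    rw [abs_mul, abs_neg, abs_of_nonneg (by positivity)]
    have : |h x - m| ≤ 2 * b := (abs_sub _ _).trans (by linarith)
    calc s / n * |h x - m| ≤ s / n * (2 * b) := by gcongr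
      _ = 2 * s * b / n := by ring
      _ ≤ 1 := by rw [div_le_one hn0]; exact hsb
  have hprod : ∀ xs : Fin n → Ω, Real.exp (s * (- nu μ h xs)) = ∏ i, Real.exp (y (xs i)) := by
    intro xs
    rw [← Real.exp_sum]
    congr 1
    simp only [hy, ← Finset.mul_sum, Finset.sum_sub_distrib]
    unfold nu
    simp only [Finset.sum_const, Finset.card_univ, Fintype.card_fin, nsmul_eq_mul]
    rw [← hmdef]
    field_simp
  have hexpi : Integrable (fun x => Real.exp (y x)) μ := by
    refine Integrable.of_bound (by fun_prop) (Real.exp 1) ?_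
    filter_upwards [hyb] with x hx
    rw [Real.norm_of_nonneg (Real.exp_nonneg _)]
    exact Real.exp_le_exp.2 ((le_abs_self _).trans hx)
  simp_rw [hprod]
  refine ⟨Integrable.fintype_prod fun _ => hexpi, ?_⟩
  rw [integral_fintype_prod_eq_pow (fun x => Real.exp (y x)), Fintype.card_fin]
  have hyi : Integrable y μ := (hi.sub (integrable_const m)).const_mul _
  have hy2i : Integrable (fun x => y x ^ 2) μ :=
    ((hL.sub (memLp_const m)).const_mul (-(s / n))).integrable_sq
  have h1yi : Integrable (fun x => 1 + y x) μ := (integrable_const _).add hyi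
  have hy0 : ∫ x, y x ∂μ = 0 := by
    simp only [hy]
    rw [integral_const_mul, integral_sub hi (integrable_const _)]
    simp [hmdef]
  have hy2 : ∫ x, y x ^ 2 ∂μ ≤ (s / n) ^ 2 * V := by
    have e : ∀ x, y x ^ 2 = (s / n) ^ 2 * (h x - m) ^ 2 := fun x => by simp only [hy]; ring
    simp_rw [e]
    rw [integral_const_mul]
    gcongr
    rw [← ProbabilityTheory.variance_eq_integral hm.aemeasurable]
    exact (ProbabilityTheory.variance_le_expectation_sq hm.aestronglyMeasurable).trans hV
  have h1 : ∫ x, Real.exp (y x) ∂μ ≤ Real.exp ((s / n) ^ 2 * V) := by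
    calc ∫ x, Real.exp (y x) ∂μ ≤ ∫ x, (1 + y x + y x ^ 2) ∂μ := by
          apply integral_mono_ae hexpi (h1yi.add hy2i)
          filter_upwards [hyb] with x hx
          have := (abs_le.1 (Real.abs_exp_sub_one_sub_id_le hx)).2
          simp only [Pi.add_apply]
          linarith
      _ = 1 + ∫ x, y x ^ 2 ∂μ := by
          rw [integral_add h1yi hy2i, integral_add (integrable_const _) hyi,
            hy0]
          simp
      _ ≤ 1 + (s / n) ^ 2 * V := by gcongr
      _ ≤ _ := by rw [add_comm]; exact Real.add_one_le_exp _
  calc (∫ x, Real.exp (y x) ∂μ) ^ n ≤ (Real.exp ((s / n) ^ 2 * V)) ^ n := by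
        gcongr
    _ = _ := by
        rw [← Real.exp_nat_mul]
        congr 1
        field_simp

lemma resid_ep {n : ℕ} (hn : 1 ≤ n) {I : Type*} [Fintype I] [Nonempty I] {h : I → Ω → ℝ}
    (hm : ∀ f, Measurable (h f)) {b lam κ s : ℝ} (v : I → ℝ) (hv : ∀ f, 0 ≤ v f)
    (hb : ∀ f, ∀ᵐ x ∂μ, |h f x| ≤ b) (hV : ∀ f, ∫ x, h f x ^ 2 ∂μ ≤ lam * v f) (hs : 0 < s)
    (hsb : 2 * s * b ≤ n) (hsl : s * lam ≤ κ * n) :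
    ∃ a : (Fin n → Ω) → ℝ, Integrable a (Measure.pi fun _ => μ) ∧
      (∀ xs f, - nu μ (h f) xs ≤ κ * v f + a xs) ∧
      ∫ xs, a xs ∂(Measure.pi fun _ => μ) ≤ Real.log (Fintype.card I) / s := by
  have hn0 : (0:ℝ) < n := by positivity
  set N : ℝ := (Fintype.card I : ℝ) with hN
  have hN0 : 0 < N := by rw [hN]; exact_mod_cast Fintype.card_pos
  set E : I → (Fin n → Ω) → ℝ := fun f xs =>
    Real.exp (s * (- nu μ (h f) xs)) * Real.exp (-(s * κ * v f)) with hE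
  have hEi : ∀ f, Integrable (E f) (Measure.pi fun _ => μ) := fun f =>
    (nu_mgf μ hn (hm f) (hb f) (hV f) hs.le hsb).1.mul_const _
  have hEle : ∀ f, ∫ xs, E f xs ∂(Measure.pi fun _ => μ) ≤ 1 := by
    intro f
    have h1 := (nu_mgf μ hn (hm f) (hb f) (hV f) hs.le hsb).2
    simp only [hE]
    rw [integral_mul_const]
    calc (∫ xs : Fin n → Ω, Real.exp (s * (- nu μ (h f) xs)) ∂(Measure.pi fun _ => μ)) *
          Real.exp (-(s * κ * v f)) ≤ Real.exp (s ^ 2 * (lam * v f) / n) * Real.exp (-(s * κ * v f)) := by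
          gcongr
      _ = Real.exp (s ^ 2 * (lam * v f) / n - s * κ * v f) := by rw [← Real.exp_add]; rfl
      _ ≤ 1 := by
          rw [Real.exp_le_one_iff, sub_nonpos, div_le_iff₀ hn0]
          have := mul_le_mul_of_nonneg_left hsl (mul_nonneg hs.le (hv f))
          nlinarith
  refine ⟨fun xs => s⁻¹ * ((∑ f, E f xs) / N + (Real.log N - 1)), ?_, ?_, ?_⟩
  · exact ((((integrable_finsetSum _ fun f _ => hEi f).div_const N)).add (integrable_const _)).const_mul _
  · intro xs f
    have h1 : E f xs ≤ ∑ f, E f xs :=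
      Finset.single_le_sum (f := fun f => E f xs) (fun f _ => by simp only [hE]; positivity) (Finset.mem_univ f)
    have h2 : E f xs = Real.exp (s * (- nu μ (h f) xs - κ * v f)) := by
      simp only [hE]; rw [← Real.exp_add]; congr 1; ring
    have hEp : 0 < E f xs := by rw [h2]; exact Real.exp_pos _
    have h3 : s * (- nu μ (h f) xs - κ * v f) - Real.log N ≤ E f xs / N - 1 := by
      have := Real.log_le_sub_one_of_pos (div_pos hEp hN0)
      rw [Real.log_div hEp.ne' hN0.ne'] at this
      nth_rewrite 1 [h2] at this
      rwa [Real.log_exp] at this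
    have h4 : E f xs / N ≤ (∑ f, E f xs) / N := by gcongr
    have h5 : s * (- nu μ (h f) xs - κ * v f) ≤ (∑ f, E f xs) / N + (Real.log N - 1) := by linarith
    have h6 := mul_le_mul_of_nonneg_left h5 (inv_nonneg.2 hs.le)
    rw [inv_mul_cancel_left₀ hs.ne'] at h6
    linarith
  · rw [integral_const_mul, integral_add ((integrable_finsetSum _ fun f _ => hEi f).div_const N)
      (integrable_const _), integral_div, integral_finsetSum _ fun f _ => hEi f]
    have h1 : (∑ f, ∫ xs, E f xs ∂(Measure.pi fun _ => μ)) / N ≤ 1 := by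
      rw [div_le_one hN0]
      calc _ ≤ ∑ _f : I, (1:ℝ) := Finset.sum_le_sum fun f _ => hEle f
        _ = N := by simp [hN]
    rw [integral_const, probReal_univ, one_smul, div_eq_inv_mul (Real.log _) s]
    apply mul_le_mul_of_nonneg_left _ (by positivity)
    linarith

end

/-! ### The localized empirical process bound -/

/-- Scale weights. -/
def wt (d j : ℕ) : ℝ := Real.sqrt (((2:ℝ) ^ j) ^ d * (1 / 4) ^ j)

lemma wt_pos (d j : ℕ) : 0 < wt d j := Real.sqrt_pos.2 (by positivity)

lemma wt_sq (d j : ℕ) : wt d j ^ 2 = ((2:ℝ) ^ j) ^ d * (1 / 4) ^ j := Real.sq_sqrt (by positivity)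

section
variable {d : ℕ} {μ : Measure (Eu d)} [IsProbabilityMeasure μ] {C₀ : ℝ}

lemma ae_box1 (hμ : μ ≤ ENNReal.ofReal C₀ • volume.restrict (unitCube d)) :
    ∀ᵐ x ∂μ, x ∈ box1 d := by
  have h1 : ∀ᵐ x ∂(volume.restrict (unitCube d)), x ∈ box1 d := by
    rw [restrict_box1]
    exact ae_restrict_mem (measurableSet_box1 d)
  have h2 : μ ≪ volume.restrict (unitCube d) :=
    (Measure.absolutelyContinuous_of_le hμ).trans (Measure.smul_absolutelyContinuous)
  exact h2.ae_le h1

lemma integral_le_cube (hC : 0 ≤ C₀) (hμ : μ ≤ ENNReal.ofReal C₀ • volume.restrict (unitCube d)) {F : Eu d → ℝ}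
    (hF : ∀ x, 0 ≤ F x) (hi : IntegrableOn F (unitCube d)) :
    ∫ x, F x ∂μ ≤ C₀ * ∫ x in unitCube d, F x := by
  have h1 : ∫ x, F x ∂μ ≤ ∫ x, F x ∂(ENNReal.ofReal C₀ • volume.restrict (unitCube d)) := by
    apply integral_mono_measure hμ (Filter.Eventually.of_forall hF)
    exact hi.smul_measure ENNReal.ofReal_ne_top
  rw [integral_smul_measure, ENNReal.toReal_ofReal hC] at h1
  exact h1

lemma memLp_cont (hμ : μ ≤ ENNReal.ofReal C₀ • volume.restrict (unitCube d)) {u : Eu d → ℝ}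
    (hu : Continuous u) : MemLp u 2 μ := by
  obtain ⟨B, hB⟩ := (isCompact_unitCube d).exists_bound_of_continuousOn hu.continuousOn
  refine MemLp.of_bound hu.measurable.aestronglyMeasurable B ?_
  filter_upwards [ae_box1 hμ] with x hx
  exact hB x (box1_subset d hx)

lemma psi_memLp (j : ℕ) (k : Fin d → Fin (2 ^ (j + 1))) : MemLp (psi d j k) 2 μ := by
  refine MemLp.of_bound (measurable_const.indicator (measurableSet_cell _ _ _)).aestronglyMeasurable 1 ?_
  refine Filter.Eventually.of_forall fun x => ?_
  unfold psi
  by_cases h : x ∈ cell d (j + 1) (kc k) <;> simp [h]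

lemma eta_sq_le (J : ℕ) (p : Fin d × (Fin d → Fin (2 ^ J))) (x : Eu d) :
    eta d J p x ^ 2 ≤ (1 / 4) ^ J * (cell d J (kc p.2)).indicator (fun _ => (1:ℝ)) x := by
  unfold eta
  by_cases h : x ∈ cell d J (kc p.2)
  · rw [indicator_of_mem h, indicator_of_mem h, mul_one]
    have := coord_avg (fun i => (p.2 i).2) h p.1
    have e4 : (((1:ℝ) / 2) ^ J) ^ 2 = (1 / 4) ^ J := by rw [← pow_mul, mul_comm, pow_mul]; norm_num
    rw [← e4, ← sq_abs]
    exact pow_le_pow_left₀ (abs_nonneg _) this 2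
  · rw [indicator_of_notMem h, indicator_of_notMem h]; simp

lemma eta_meas (J : ℕ) (p : Fin d × (Fin d → Fin (2 ^ J))) : Measurable (eta d J p) :=
  ((measurable_coord p.1).sub_const _).indicator (measurableSet_cell _ _ _)

lemma eta_memLp (J : ℕ) (p : Fin d × (Fin d → Fin (2 ^ J))) : MemLp (eta d J p) 2 μ := by
  refine MemLp.of_bound (eta_meas J p).aestronglyMeasurable 1 ?_
  refine Filter.Eventually.of_forall fun x => ?_
  have h1 := eta_sq_le J p x
  have h2 : (cell d J (kc p.2)).indicator (fun _ => (1:ℝ)) x ≤ 1 := by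
    by_cases h : x ∈ cell d J (kc p.2) <;> simp [h]
  have h3 : ((1:ℝ) / 4) ^ J ≤ 1 := pow_le_one₀ (by norm_num) (by norm_num)
  have h4 : eta d J p x ^ 2 ≤ 1 := by
    have : 0 ≤ (cell d J (kc p.2)).indicator (fun _ => (1:ℝ)) x :=
      indicator_nonneg (fun _ _ => zero_le_one) _
    nlinarith
  rw [Real.norm_eq_abs]
  exact (sq_le_one_iff_abs_le_one _).1 h4

lemma sum_measure_cell_le (j : ℕ) :
    ∑ k : Fin d → Fin (2 ^ j), ∫ x, (cell d j (kc k)).indicator (fun _ => (1:ℝ)) x ∂μ ≤ 1 := by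
  have : ∀ k : Fin d → Fin (2 ^ j), ∫ x, (cell d j (kc k)).indicator (fun _ => (1:ℝ)) x ∂μ =
      μ.real (cell d j (kc k)) := by
    intro k
    rw [integral_indicator (measurableSet_cell _ _ _)]
    simp
  simp_rw [this]
  have h := measureReal_biUnion_finset (μ := μ) (s := Finset.univ)
    (f := fun k : Fin d → Fin (2 ^ j) => cell d j (kc k))
    (fun a _ b _ hab => disjoint_cell d j hab) (fun k _ => measurableSet_cell _ _ _)
  rw [← h]
  exact measureReal_le_one

lemma psi_sum (j : ℕ) : ∑ k, ∫ x, psi d j k x ^ 2 ∂μ ≤ 1 := by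
  have : ∀ k x, psi d j k x ^ 2 = (cell d (j + 1) (kc k)).indicator (fun _ => (1:ℝ)) x := by
    intro k x
    unfold psi
    by_cases h : x ∈ cell d (j + 1) (kc k) <;> simp [h]
  simp_rw [this]
  exact sum_measure_cell_le (j + 1)

lemma eta_sum (J : ℕ) : ∑ p, ∫ x, eta d J p x ^ 2 ∂μ ≤ d * (1 / 4) ^ J := by
  calc ∑ p, ∫ x, eta d J p x ^ 2 ∂μ
      ≤ ∑ p : Fin d × (Fin d → Fin (2 ^ J)), (1 / 4) ^ J * ∫ x, (cell d J (kc p.2)).indicator (fun _ => (1:ℝ)) x ∂μ := by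
        apply Finset.sum_le_sum
        intro p _
        rw [← integral_const_mul]
        apply integral_mono (eta_memLp J p).integrable_sq
        · exact ((integrable_const _).indicator (measurableSet_cell _ _ _)).const_mul _
        · exact eta_sq_le J p
    _ = d * ((1 / 4) ^ J * ∑ k : Fin d → Fin (2 ^ J), ∫ x, (cell d J (kc k)).indicator (fun _ => (1:ℝ)) x ∂μ) := by
        rw [Fintype.sum_prod_type]
        simp only [← Finset.mul_sum, Finset.sum_const, Finset.card_univ, Fintype.card_fin, nsmul_eq_mul]
        ring
    _ ≤ d * ((1 / 4) ^ J * 1) := by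
        gcongr
        exact sum_measure_cell_le J
    _ = _ := by ring

lemma amgm_sum {ι : Type*} (s : Finset ι) (a u : ι → ℝ) {θ : ℝ} (hθ : 0 < θ) :
    - ∑ k ∈ s, a k * u k ≤ θ * ∑ k ∈ s, a k ^ 2 + (4 * θ)⁻¹ * ∑ k ∈ s, u k ^ 2 := by
  rw [Finset.mul_sum, Finset.mul_sum, ← Finset.sum_neg_distrib, ← Finset.sum_add_distrib]
  apply Finset.sum_le_sum
  intro k _
  have h : 0 ≤ (4 * θ)⁻¹ * (2 * θ * a k + u k) ^ 2 := by positivity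
  have e : (4 * θ)⁻¹ * (2 * θ * a k + u k) ^ 2 = θ * a k ^ 2 + a k * u k + (4 * θ)⁻¹ * u k ^ 2 := by
    field_simp; ring
  linarith

end

theorem ep_lemma (d : ℕ) {K C₀ κ : ℝ} (hK : 0 < K) (hC₀ : 0 < C₀) (hκ : 0 < κ) :
    ∃ C : ℝ, 0 < C ∧ ∀ (μ : Measure (Eu d)) [IsProbabilityMeasure μ],
      μ ≤ ENNReal.ofReal C₀ • volume.restrict (unitCube d) →
      ∀ (I : Type) [Fintype I] [Nonempty I] (g : I → Eu d → ℝ) (G : I → Eu d → Eu d),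
      (∀ f, C11 d K (g f) (G f)) → (∀ f, Continuous (g f)) → (∀ f, Continuous (G f)) →
      ∀ n : ℕ, 1 ≤ n → ∀ J : ℕ, ∃ a : (Fin n → Eu d) → ℝ,
        Integrable a (Measure.pi fun _ => μ) ∧
        (∀ xs f, - nu μ (g f) xs ≤ κ * (∫ x in unitCube d, ‖G f x‖ ^ 2) + a xs) ∧
        ∫ xs, a xs ∂(Measure.pi fun _ => μ) ≤
          C * ((∑ j ∈ Finset.range (J + 1), wt d j) ^ 2 / n +
            (1 / 4) ^ J * Real.log (Fintype.card I) / n) := by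
  -- constants
  set c1 : ℝ := 8 ^ d * d ^ 2 + 1 with hc1
  set c2 : ℝ := 2 * d ^ 2 * 2 ^ d + 2 * d + 1 with hc2
  have hc1p : 0 < c1 := by positivity
  have hc2p : 0 < c2 := by positivity
  set b0 : ℝ := 2 * K * d ^ 2 with hb0
  have hb0p : 0 ≤ b0 := by positivity
  set s0 : ℝ := min (κ / 2 / (C₀ * c2)) (1 / (2 * (b0 + 1))) with hs0
  have hs0p : 0 < s0 := by rw [hs0]; positivity
  refine ⟨max ((c1 + d) / (2 * κ)) (1 / s0), lt_max_of_lt_right (by positivity), ?_⟩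
  intro μ _ hμ I _ _ g G hC hg hG n hn J
  have hn0 : (0:ℝ) < n := by positivity
  set v : I → ℝ := fun f => ∫ x in unitCube d, ‖G f x‖ ^ 2 with hv
  have hv0 : ∀ f, 0 ≤ v f := fun f => integral_nonneg fun x => sq_nonneg _
  set W := ∑ j ∈ Finset.range (J + 1), wt d j with hW
  have hWp : 0 < W := Finset.sum_pos (fun j _ => wt_pos d j) ⟨0, by simp⟩
  -- residual part
  obtain ⟨a0, ha0i, ha0, ha0le⟩ := resid_ep μ hn (h := fun f => resid (g f) (G f) J)
    (fun f => resid_meas (hg f) _ J) (b := b0 * (1 / 4) ^ J) (lam := C₀ * c2 * (1 / 4) ^ J)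
    (κ := κ / 2) (s := s0 * n * 4 ^ J) v hv0
    (fun f => by
      filter_upwards [ae_box1 hμ] with x hx
      exact resid_bound hK.le (hC f) (hg f) (hG f) J hx)
    (fun f => by
      refine (integral_le_cube hC₀.le hμ (fun x => sq_nonneg _)
        (resid_sq_int hK.le (hC f) (hg f) (hG f) J)).trans ?_
      rw [mul_assoc, mul_assoc]
      refine mul_le_mul_of_nonneg_left ?_ hC₀.le
      refine (resid_l2 hK.le (hC f) (hg f) (hG f) J).trans ?_
      refine mul_le_mul_of_nonneg_right (by rw [hc2]; linarith) ?_
      have := hv0 f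
      positivity)
    (by positivity)
    (by
      have h1 : s0 * (2 * (b0 + 1)) ≤ 1 := by
        rw [← le_div_iff₀ (by positivity)]; exact min_le_right _ _
      have h4 : (4:ℝ) ^ J * (1 / 4) ^ J = 1 := by rw [← mul_pow]; norm_num
      have h2 : s0 * (2 * b0) ≤ 1 := by nlinarith
      calc 2 * (s0 * n * 4 ^ J) * (b0 * (1 / 4) ^ J) = (s0 * (2 * b0)) * n * (4 ^ J * (1 / 4) ^ J) := by ring
        _ ≤ n := by rw [h4]; nlinarith)
    (by
      have h1 : s0 * (C₀ * c2) ≤ κ / 2 := by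
        rw [← le_div_iff₀ (by positivity)]; exact min_le_left _ _
      have h4 : (4:ℝ) ^ J * (1 / 4) ^ J = 1 := by rw [← mul_pow]; norm_num
      calc s0 * n * 4 ^ J * (C₀ * c2 * (1 / 4) ^ J) = (s0 * (C₀ * c2)) * n * (4 ^ J * (1 / 4) ^ J) := by ring
        _ ≤ κ / 2 * n := by rw [h4]; nlinarith)
  -- scale parts
  set θ : ℕ → ℝ := fun j => κ / 2 / (c1 * W * wt d j) with hθ
  have hθp : ∀ j, 0 < θ j := fun j => by
    have := wt_pos d j
    simp only [hθ]; positivity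
  set τ : ℝ := κ / 2 / (W * wt d J * 4 ^ J) with hτ
  have hτp : 0 < τ := by
    have := wt_pos d J
    rw [hτ]; positivity
  set U : ℕ → (Fin n → Eu d) → ℝ := fun j xs => ∑ k, nu μ (psi d j k) xs ^ 2 with hU
  set UL : (Fin n → Eu d) → ℝ := fun xs => ∑ p, nu μ (eta d J p) xs ^ 2 with hUL
  have hUi : ∀ j, Integrable (U j) (Measure.pi fun _ => μ) := fun j =>
    integrable_finsetSum _ fun k _ => (nu_sq μ hn (psi_memLp j k)).1
  have hULi : Integrable UL (Measure.pi fun _ => μ) :=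
    integrable_finsetSum _ fun k _ => (nu_sq μ hn (eta_memLp J k)).1
  have hUle : ∀ j, ∫ xs, U j xs ∂(Measure.pi fun _ => μ) ≤ 1 / n := by
    intro j
    simp only [hU]
    rw [integral_finsetSum _ fun k _ => (nu_sq μ hn (psi_memLp j k)).1]
    calc _ ≤ ∑ k, (∫ x, psi d j k x ^ 2 ∂μ) / n :=
          Finset.sum_le_sum fun k _ => (nu_sq μ hn (psi_memLp j k)).2
      _ = (∑ k, ∫ x, psi d j k x ^ 2 ∂μ) / n := by rw [Finset.sum_div]
      _ ≤ 1 / n := by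
          gcongr
          exact psi_sum j
  have hULle : ∫ xs, UL xs ∂(Measure.pi fun _ => μ) ≤ d * (1 / 4) ^ J / n := by
    simp only [hUL]
    rw [integral_finsetSum _ fun k _ => (nu_sq μ hn (eta_memLp J k)).1]
    calc _ ≤ ∑ k, (∫ x, eta d J k x ^ 2 ∂μ) / n :=
          Finset.sum_le_sum fun k _ => (nu_sq μ hn (eta_memLp J k)).2
      _ = (∑ k, ∫ x, eta d J k x ^ 2 ∂μ) / n := by rw [Finset.sum_div]
      _ ≤ _ := by
          gcongr
          exact eta_sum J
  refine ⟨fun xs => (∑ j ∈ Finset.range J, (4 * θ j)⁻¹ * U j xs) + (4 * τ)⁻¹ * UL xs + a0 xs, ?_, ?_, ?_⟩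
  · exact ((integrable_finsetSum _ fun j _ => (hUi j).const_mul _).add (hULi.const_mul _)).add ha0i
  · intro xs f
    have hpsii : ∀ j k, Integrable (psi d j k) μ := fun j k => (psi_memLp j k).integrable (by norm_num)
    have hetai : ∀ p, Integrable (eta d J p) μ := fun p => (eta_memLp J p).integrable (by norm_num)
    have hgi : Integrable (g f) μ := (memLp_cont hμ (hg f)).integrable (by norm_num)
    have hHi : ∀ j, Integrable (fun x => ∑ k, inc (g f) j k * psi d j k x) μ := fun j =>
      integrable_finsetSum _ fun k _ => (hpsii j k).const_mul _
    have hHsi : Integrable (fun x => ∑ j ∈ Finset.range J, ∑ k, inc (g f) j k * psi d j k x) μ :=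
      integrable_finsetSum _ fun j _ => hHi j
    have hLi : Integrable (fun x => ∑ p : Fin d × (Fin d → Fin (2 ^ J)),
        avg (fun y => G f y p.1) J (kc p.2) * eta d J p x) μ :=
      integrable_finsetSum _ fun p _ => (hetai p).const_mul _
    have hri : Integrable (resid (g f) (G f) J) μ :=
      ((hgi.sub (integrable_const _)).sub hHsi).sub hLi
    have e1 : g f = fun x => ((avg (g f) 0 (fun _ => 0) +
        ∑ j ∈ Finset.range J, ∑ k, inc (g f) j k * psi d j k x) +
        ∑ p : Fin d × (Fin d → Fin (2 ^ J)), avg (fun y => G f y p.1) J (kc p.2) * eta d J p x) +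
        resid (g f) (G f) J x := by
      funext x
      unfold resid
      ring
    have e2 : nu μ (g f) xs = (∑ j ∈ Finset.range J, ∑ k, inc (g f) j k * nu μ (psi d j k) xs) +
        (∑ p : Fin d × (Fin d → Fin (2 ^ J)), avg (fun y => G f y p.1) J (kc p.2) * nu μ (eta d J p) xs) +
        nu μ (resid (g f) (G f) J) xs := by
      conv_lhs => rw [e1]
      have k1 : Integrable (fun x => avg (g f) 0 (fun _ => 0) +
          ∑ j ∈ Finset.range J, ∑ k, inc (g f) j k * psi d j k x) μ := (integrable_const _).add hHsi
      have k2 : Integrable (fun x => (avg (g f) 0 (fun _ => 0) +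
          ∑ j ∈ Finset.range J, ∑ k, inc (g f) j k * psi d j k x) +
          ∑ p : Fin d × (Fin d → Fin (2 ^ J)), avg (fun y => G f y p.1) J (kc p.2) * eta d J p x) μ :=
        k1.add hLi
      rw [nu_add μ k2 hri, nu_add μ k1 hLi,
        nu_add μ (integrable_const _) hHsi, nu_const μ hn, nu_sum μ _ _ hetai, zero_add]
      congr 2
      have := nu_sum μ (Finset.range J) (fun _ => (1:ℝ)) hHi xs
      simp only [one_mul] at this
      rw [this]
      refine Finset.sum_congr rfl fun j _ => ?_
      rw [nu_sum μ _ _ (hpsii j)]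
    have t1 : ∀ j ∈ Finset.range J, - ∑ k, inc (g f) j k * nu μ (psi d j k) xs ≤
        κ / 2 * v f * (wt d j / W) + (4 * θ j)⁻¹ * U j xs := by
      intro j _
      refine (amgm_sum Finset.univ (inc (g f) j) (fun k => nu μ (psi d j k) xs) (hθp j)).trans ?_
      refine add_le_add ?_ le_rfl
      have hw := wt_pos d j
      have hb : ∑ k, inc (g f) j k ^ 2 ≤ c1 * (wt d j ^ 2 * v f) := by
        refine (incr_bound (hC f) (hg f) (hG f) j).trans ?_
        rw [wt_sq]
        refine mul_le_mul_of_nonneg_right (by rw [hc1]; linarith) ?_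
        have := hv0 f
        positivity
      calc θ j * ∑ k, inc (g f) j k ^ 2 ≤ θ j * (c1 * (wt d j ^ 2 * v f)) :=
            mul_le_mul_of_nonneg_left hb (hθp j).le
        _ = _ := by
            simp only [hθ]
            field_simp
    have t2 : - ∑ p : Fin d × (Fin d → Fin (2 ^ J)), avg (fun y => G f y p.1) J (kc p.2) * nu μ (eta d J p) xs ≤
        κ / 2 * v f * (wt d J / W) + (4 * τ)⁻¹ * UL xs := by
      refine (amgm_sum Finset.univ _ (fun p => nu μ (eta d J p) xs) hτp).trans ?_
      refine add_le_add ?_ le_rfl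
      have hw := wt_pos d J
      have hb := grad_bound (hG f) J
      have e5 : ((2:ℝ) ^ J) ^ d = wt d J ^ 2 * 4 ^ J := by
        rw [wt_sq, mul_assoc, ← mul_pow]; norm_num
      rw [e5] at hb
      refine (mul_le_mul_of_nonneg_left hb hτp.le).trans (le_of_eq ?_)
      rw [hτ]
      simp only [hv]
      field_simp
    have t3 := ha0 xs f
    have t4 := Finset.sum_le_sum t1
    rw [Finset.sum_neg_distrib, Finset.sum_add_distrib, ← Finset.mul_sum, ← Finset.sum_div] at t4
    have t5 : (∑ j ∈ Finset.range J, wt d j) / W + wt d J / W = 1 := by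
      rw [← add_div, ← Finset.sum_range_succ, div_self hWp.ne']
    have t6 : κ / 2 * v f * ((∑ j ∈ Finset.range J, wt d j) / W) + κ / 2 * v f * (wt d J / W) = κ / 2 * v f := by
      rw [← mul_add, t5, mul_one]
    rw [e2]
    change _ ≤ κ * v f + _
    linarith
  · have k1 : Integrable (fun xs => ∑ j ∈ Finset.range J, (4 * θ j)⁻¹ * U j xs) (Measure.pi fun _ => μ) :=
      integrable_finsetSum _ fun j _ => (hUi j).const_mul _
    have k2 : Integrable (fun xs => ∑ j ∈ Finset.range J, (4 * θ j)⁻¹ * U j xs + (4 * τ)⁻¹ * UL xs)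
      (Measure.pi fun _ => μ) := k1.add (hULi.const_mul _)
    simp only
    rw [integral_add k2 ha0i,
      integral_add k1 (hULi.const_mul _),
      integral_finsetSum _ fun j _ => (hUi j).const_mul _, integral_const_mul]
    simp_rw [integral_const_mul]
    have p1 : ∑ j ∈ Finset.range J, (4 * θ j)⁻¹ * ∫ xs, U j xs ∂(Measure.pi fun _ => μ) ≤
        c1 / (2 * κ) * (W ^ 2 / n) := by
      calc _ ≤ ∑ j ∈ Finset.range J, (4 * θ j)⁻¹ * (1 / n) := by
            apply Finset.sum_le_sum
            intro j _
            exact mul_le_mul_of_nonneg_left (hUle j) (by have := hθp j; positivity)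
        _ = ∑ j ∈ Finset.range J, c1 / (2 * κ) * W / n * wt d j := by
            refine Finset.sum_congr rfl fun j _ => ?_
            have hw := wt_pos d j
            simp only [hθ]
            field_simp; norm_num
        _ = c1 / (2 * κ) * W / n * ∑ j ∈ Finset.range J, wt d j := by rw [← Finset.mul_sum]
        _ ≤ c1 / (2 * κ) * W / n * W := by
            gcongr
            rw [hW, Finset.sum_range_succ]
            linarith [wt_pos d J]
        _ = _ := by ring
    have p2 : (4 * τ)⁻¹ * ∫ xs, UL xs ∂(Measure.pi fun _ => μ) ≤ d / (2 * κ) * (W ^ 2 / n) := by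
      have hw := wt_pos d J
      calc _ ≤ (4 * τ)⁻¹ * (d * (1 / 4) ^ J / n) := mul_le_mul_of_nonneg_left hULle (by positivity)
        _ = d / (2 * κ) * W / n * wt d J * (4 ^ J * (1 / 4) ^ J) := by
            rw [hτ]
            field_simp; norm_num
        _ = d / (2 * κ) * W / n * wt d J := by rw [← mul_pow]; norm_num
        _ ≤ d / (2 * κ) * W / n * W := by
            gcongr
            rw [hW]
            exact Finset.single_le_sum (f := fun j => wt d j) (fun j _ => (wt_pos d j).le) (by simp)
        _ = _ := by ring
    have p3 : Real.log (Fintype.card I) / (s0 * n * 4 ^ J) = 1 / s0 * ((1 / 4) ^ J * Real.log (Fintype.card I) / n) := by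
      rw [one_div_pow]
      field_simp
    rw [p3] at ha0le
    have hlog : 0 ≤ Real.log (Fintype.card I) := Real.log_natCast_nonneg _
    rw [mul_add]
    refine add_le_add ?_ (ha0le.trans ?_)
    · calc _ ≤ c1 / (2 * κ) * (W ^ 2 / n) + d / (2 * κ) * (W ^ 2 / n) := add_le_add p1 p2
        _ = (c1 + d) / (2 * κ) * (W ^ 2 / n) := by ring
        _ ≤ _ := by
          gcongr
          exact le_max_left _ _
    · gcongr
      exact le_max_right _ _

lemma vol_image_le {d : ℕ} {K : NNReal} {f : Eu d → Eu d} {s : Set (Eu d)}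
    (h : LipschitzOnWith K f s) : volume (f '' s) ≤ (K : ℝ≥0∞) ^ d * volume s := by
  have h1 := h.hausdorffMeasure_image_le (d := (d : ℝ)) (by positivity)
  rw [ENNReal.rpow_natCast] at h1
  rw [← EuclideanSpace.euclideanHausdorffMeasure_eq_volume d,
    MeasureTheory.Measure.euclideanHausdorffMeasure_def]
  rw [Measure.smul_apply, Measure.smul_apply, ENNReal.smul_def, ENNReal.smul_def, smul_eq_mul, smul_eq_mul,
    mul_left_comm]
  exact mul_le_mul_right h1 _

lemma P_le {d : ℕ} {M : ℝ} {P : Measure (Eu d)} (h : MemM d M P) :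
    P ≤ ENNReal.ofReal M • volume.restrict (unitCube d) := by
  obtain ⟨ρ, hρ, hP, hb⟩ := h.density
  refine Measure.le_iff.2 fun s hs => ?_
  rw [hP, withDensity_apply _ hs, Measure.smul_apply, smul_eq_mul,
    Measure.restrict_apply hs, inter_comm, ← Measure.restrict_apply (measurableSet_unitCube d),
    ← lintegral_indicator_const (measurableSet_unitCube d)]
  refine lintegral_mono_ae ?_
  filter_upwards [ae_restrict_of_ae hb] with x hx
  by_cases hc : x ∈ unitCube d
  · rw [indicator_of_mem hc]; exact ENNReal.ofReal_le_ofReal (hx.1 hc).2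
  · rw [indicator_of_notMem hc, hx.2 hc]; simp

lemma le_P {d : ℕ} {M : ℝ} (hM : 0 < M) {P : Measure (Eu d)} (h : MemM d M P) :
    volume.restrict (unitCube d) ≤ ENNReal.ofReal M • P := by
  obtain ⟨ρ, hρ, hP, hb⟩ := h.density
  refine Measure.le_iff.2 fun s hs => ?_
  rw [hP, Measure.smul_apply, smul_eq_mul, withDensity_apply _ hs, 
    Measure.restrict_apply hs, inter_comm, ← Measure.restrict_apply (measurableSet_unitCube d),
    ← one_mul ((volume.restrict s) (unitCube d)),
    ← lintegral_indicator_const (measurableSet_unitCube d),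
    ← lintegral_const_mul _ hρ.ennreal_ofReal]
  refine lintegral_mono_ae ?_
  filter_upwards [ae_restrict_of_ae hb] with x hx
  by_cases hc : x ∈ unitCube d
  · rw [indicator_of_mem hc, ← ENNReal.ofReal_mul hM.le, ENNReal.one_le_ofReal]
    calc (1:ℝ) = M * M⁻¹ := by field_simp
      _ ≤ _ := by gcongr; exact (hx.1 hc).1
  · rw [indicator_of_notMem hc]; simp

lemma P_compl {d : ℕ} {M : ℝ} {P : Measure (Eu d)} (h : MemM d M P) :
    P (unitCube d)ᶜ = 0 := by
  have := P_le h (unitCube d)ᶜ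
  rw [Measure.smul_apply, Measure.restrict_apply (measurableSet_unitCube d).compl] at this
  simpa using this

lemma P_ae {d : ℕ} {M : ℝ} {P : Measure (Eu d)} (h : MemM d M P) :
    ∀ᵐ x ∂P, x ∈ unitCube d := P_compl h

lemma adm_cls {d : ℕ} {α M R : ℝ} (hα : 1 < α) (hR : 0 ≤ R) {P : Measure (Eu d)} {T₀ : Eu d → Eu d}
    (h : Admissible d α M R P T₀) : T₀ ∈ Cls d α M R := by
  refine ⟨h.memT, ?_⟩
  have hcont : ContinuousOn T₀ (unitCube d) := by
    intro x hx
    obtain ⟨A, hA, -⟩ := h.memT.derivBounds x (unitCube_sub_bigBox hx)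
    exact hA.continuousAt.continuousWithinAt
  apply Subset.antisymm
  · rintro _ ⟨x, hx, rfl⟩
    rw [← h.pushSupp]
    intro U hU hxU
    rw [Measure.map_apply h.meas hU.measurableSet]
    obtain ⟨A, hA, -⟩ := h.memT.derivBounds x (unitCube_sub_bigBox hx)
    obtain ⟨V, hV, hVo, hxV⟩ := mem_nhds_iff.1 (hA.continuousAt.preimage_mem_nhds (hU.mem_nhds hxU))
    have hxs : x ∈ mSupport P := by rw [h.memM.supp]; exact hx
    exact (hxs V hVo hxV).trans_le (measure_mono hV)
  · intro y hy
    by_contra hn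
    rw [← h.pushSupp] at hy
    have hK : IsClosed (T₀ '' unitCube d) := ((isCompact_unitCube d).image_of_continuousOn hcont).isClosed
    have := hy _ hK.isOpen_compl hn
    rw [Measure.map_apply h.meas hK.isOpen_compl.measurableSet] at this
    refine this.ne' (measure_mono_null ?_ (P_compl h.memM))
    intro x hx hxc
    exact hx ⟨x, hxc, rfl⟩

lemma C11.lipOn {d : ℕ} {K : ℝ} (hK : 0 ≤ K) {g : Eu d → ℝ} {G : Eu d → Eu d} (h : C11 d K g G) :
    LipschitzOnWith ⟨K, hK⟩ G (unitCube d) :=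
  LipschitzOnWith.of_dist_le_mul fun x hx y hy => by
    rw [dist_eq_norm, dist_eq_norm]; exact h.lip x hx y hy

lemma C11.cont {d : ℕ} {K : ℝ} {g : Eu d → ℝ} {G : Eu d → Eu d} (h : C11 d K g G) :
    ContinuousOn g (unitCube d) := by
  intro y hy
  have h1 : Filter.Tendsto (fun x => K * ‖x - y‖ ^ 2 + ‖G y‖ * ‖x - y‖) (nhdsWithin y (unitCube d)) (nhds 0) := by
    have : ContinuousAt (fun x => K * ‖x - y‖ ^ 2 + ‖G y‖ * ‖x - y‖) y := by fun_prop
    have h2 := this.tendsto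
    simp only [sub_self, norm_zero] at h2
    norm_num at h2
    exact h2.mono_left nhdsWithin_le_nhds
  rw [ContinuousWithinAt, tendsto_iff_norm_sub_tendsto_zero]
  refine squeeze_zero' (Filter.Eventually.of_forall fun x => norm_nonneg _) ?_ h1
  filter_upwards [self_mem_nhdsWithin] with x hx
  have h3 := h.rem x hx y hy
  have h4 := abs_real_inner_le_norm (G y) (x - y)
  rw [Real.norm_eq_abs]
  have h5 : g x - g y = (g x - g y - ⟪G y, x - y⟫) + ⟪G y, x - y⟫ := by ring
  rw [h5]
  exact (abs_add_le _ _).trans (add_le_add h3 h4)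

section
variable {d : ℕ} {K c M : ℝ} {P : Measure (Eu d)} {T S : Eu d → Eu d} {f fs : Eu d → ℝ}

lemma Q_le (hK : 0 ≤ K) (hM : 0 ≤ M) (hP : MemM d M P) (hT : Measurable T) (hp : Pot d K c T S f fs) :
    P.map T ≤ ENNReal.ofReal (M * K ^ d) • volume.restrict (unitCube d) := by
  refine Measure.le_iff.2 fun s hs => ?_
  rw [Measure.map_apply hT hs, Measure.smul_apply, smul_eq_mul, Measure.restrict_apply hs]
  have h1 := P_le hP (T ⁻¹' s)
  rw [Measure.smul_apply, smul_eq_mul, Measure.restrict_apply (hT hs)] at h1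
  have h2 : T ⁻¹' s ∩ unitCube d ⊆ S '' (s ∩ unitCube d) := by
    rintro x ⟨hx, hxc⟩
    exact ⟨T x, ⟨hx, hp.mapT x hxc⟩, hp.ST x hxc⟩
  have h3 := (measure_mono h2).trans (vol_image_le ((hp.c2.lipOn hK).mono inter_subset_right))
  refine h1.trans ((mul_le_mul_right h3 _).trans (le_of_eq ?_))
  rw [ENNReal.ofReal_mul hM, ENNReal.ofReal_pow hK, mul_assoc]
  congr 3
  exact (ENNReal.ofReal_eq_coe_nnreal hK).symm

lemma le_Q (hK : 0 ≤ K) (hM : 0 < M) (hP : MemM d M P) (hT : Measurable T) (hp : Pot d K c T S f fs) :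
    volume.restrict (unitCube d) ≤ ENNReal.ofReal (M * K ^ d) • P.map T := by
  refine Measure.le_iff.2 fun s hs => ?_
  rw [Measure.smul_apply, Measure.map_apply hT hs, smul_eq_mul, Measure.restrict_apply hs]
  have h1 := le_P hM hP (T ⁻¹' s)
  rw [Measure.smul_apply, smul_eq_mul, Measure.restrict_apply (hT hs)] at h1
  have h2 : s ∩ unitCube d ⊆ T '' (T ⁻¹' s ∩ unitCube d) := by
    rintro x ⟨hx, hxc⟩
    exact ⟨S x, ⟨by rw [mem_preimage, hp.TS x hxc]; exact hx, hp.mapS x hxc⟩, hp.TS x hxc⟩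
  have h3 := (measure_mono h2).trans (vol_image_le ((hp.c1.lipOn hK).mono inter_subset_right))
  refine h3.trans ((mul_le_mul_right h1 _).trans (le_of_eq ?_))
  rw [ENNReal.ofReal_mul hM.le, ENNReal.ofReal_pow hK, ← mul_assoc, mul_comm (ENNReal.ofReal M)]
  congr 3
  exact (ENNReal.ofReal_eq_coe_nnreal hK).symm

end

/-- Coordinatewise projection on the unit cube. -/
def clampC (d : ℕ) (x : Eu d) : Eu d := WithLp.toLp 2 fun i => max 0 (min (x i) 1)

lemma clampC_cont (d : ℕ) : Continuous (clampC d) := by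
  unfold clampC
  fun_prop

lemma clampC_mem {d : ℕ} (x : Eu d) : clampC d x ∈ unitCube d := by
  intro i
  exact ⟨le_max_left _ _, max_le zero_le_one (min_le_right _ _)⟩

lemma clampC_id {d : ℕ} {x : Eu d} (hx : x ∈ unitCube d) : clampC d x = x := by
  ext i
  change max 0 (min (x i) 1) = x i
  rw [min_eq_left (hx i).2, max_eq_right (hx i).1]

lemma comp_clampC_cont {d : ℕ} {β : Type*} [TopologicalSpace β] {g : Eu d → β}
    (hg : ContinuousOn g (unitCube d)) : Continuous (fun x => g (clampC d x)) :=
  hg.comp_continuous (clampC_cont d) clampC_mem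

lemma C11.comp_clamp {d : ℕ} {K : ℝ} {g : Eu d → ℝ} {G : Eu d → Eu d} (h : C11 d K g G) :
    C11 d K (fun x => g (clampC d x)) (fun x => G (clampC d x)) := by
  refine ⟨fun x hx y hy => ?_, fun x hx y hy => ?_⟩
  · rw [clampC_id hx, clampC_id hy]; exact h.rem x hx y hy
  · rw [clampC_id hx, clampC_id hy]; exact h.lip x hx y hy

lemma C11.sub {d : ℕ} {K : ℝ} {g g' : Eu d → ℝ} {G G' : Eu d → Eu d} (h : C11 d K g G)
    (h' : C11 d K g' G') : C11 d (2 * K) (fun x => g x - g' x) (fun x => G x - G' x) := by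
  refine ⟨fun x hx y hy => ?_, fun x hx y hy => ?_⟩
  · have e : g x - g' x - (g y - g' y) - ⟪G y - G' y, x - y⟫ =
      (g x - g y - ⟪G y, x - y⟫) - (g' x - g' y - ⟪G' y, x - y⟫) := by
      rw [inner_sub_left]; ring
    rw [e]
    refine (abs_sub _ _).trans ?_
    have := h.rem x hx y hy
    have := h'.rem x hx y hy
    linarith
  · have e : G x - G' x - (G y - G' y) = (G x - G y) - (G' x - G' y) := by abel
    rw [e]
    refine (norm_sub_le _ _).trans ?_
    have := h.lip x hx y hy
    have := h'.lip x hx y hy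
    linarith

lemma cont_integrable {d : ℕ} {μ : Measure (Eu d)} [IsProbabilityMeasure μ] {C₀ : ℝ}
    (hμ : μ ≤ ENNReal.ofReal C₀ • volume.restrict (unitCube d)) {u : Eu d → ℝ}
    (hu : Continuous u) : Integrable u μ := (memLp_cont hμ hu).integrable (by norm_num)

lemma cube_le_integral {d : ℕ} {μ : Measure (Eu d)} {C₀ : ℝ} (hC : 0 ≤ C₀)
    (hμ : volume.restrict (unitCube d) ≤ ENNReal.ofReal C₀ • μ) {F : Eu d → ℝ}
    (hF : ∀ x, 0 ≤ F x) (hi : Integrable F μ) :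
    ∫ x in unitCube d, F x ≤ C₀ * ∫ x, F x ∂μ := by
  have h1 : ∫ x in unitCube d, F x ≤ ∫ x, F x ∂(ENNReal.ofReal C₀ • μ) := by
    apply integral_mono_measure hμ (Filter.Eventually.of_forall hF)
    exact hi.smul_measure ENNReal.ofReal_ne_top
  rw [integral_smul_measure, ENNReal.toReal_ofReal hC] at h1
  exact h1

/-- Discrepancy between `T₀` and the inverse of `S`. -/
def disc (d : ℕ) (P : Measure (Eu d)) (T₀ S : Eu d → Eu d) : ℝ :=
  ∫ x, ‖clampC d x - S (T₀ (clampC d x))‖ ^ 2 ∂P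

lemma disc_nonneg (d : ℕ) (P : Measure (Eu d)) (T₀ S : Eu d → Eu d) : 0 ≤ disc d P T₀ S :=
  integral_nonneg fun _ => by positivity

section
variable {d : ℕ} {K c M : ℝ} {P : Measure (Eu d)} {T₀ S₀ : Eu d → Eu d} {f₀ fs₀ : Eu d → ℝ}
  {T S : Eu d → Eu d} {f fs : Eu d → ℝ}

lemma contT (hK : 0 ≤ K) (hp : Pot d K c T S f fs) : Continuous fun x => T (clampC d x) :=
  comp_clampC_cont (hp.c1.lipOn hK).continuousOn

lemma contS (hK : 0 ≤ K) (hp : Pot d K c T S f fs) : Continuous fun x => S (clampC d x) :=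
  comp_clampC_cont (hp.c2.lipOn hK).continuousOn

lemma disc_cont (hK : 0 ≤ K) (hp0 : Pot d K c T₀ S₀ f₀ fs₀) (hp : Pot d K c T S f fs) :
    Continuous fun x => ‖clampC d x - S (T₀ (clampC d x))‖ ^ 2 := by
  have h1 : Continuous fun x => S (T₀ (clampC d x)) :=
    (hp.c2.lipOn hK).continuousOn.comp_continuous (contT hK hp0) fun x => hp0.mapT _ (clampC_mem x)
  exact ((clampC_cont d).sub h1).norm.pow 2

lemma T_le (hp0 : Pot d K c T₀ S₀ f₀ fs₀) (hp : Pot d K c T S f fs) {x : Eu d} (hx : x ∈ unitCube d) :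
    ‖T x - T₀ x‖ ≤ K * ‖x - S (T₀ x)‖ := by
  have h0 := hp0.mapT x hx
  have h1 := hp.c1.lip x hx _ (hp.mapS _ h0)
  rwa [hp.TS _ h0] at h1

lemma le_T (hp0 : Pot d K c T₀ S₀ f₀ fs₀) (hp : Pot d K c T S f fs) {x : Eu d} (hx : x ∈ unitCube d) :
    ‖x - S (T₀ x)‖ ≤ K * ‖T₀ x - T x‖ := by
  have h1 := hp.c2.lip _ (hp.mapT x hx) _ (hp0.mapT x hx)
  rwa [hp.ST _ hx, norm_sub_rev (T x)] at h1

lemma gap_bounds (hK : 0 ≤ K) (hM : 0 < M) (hP : MemM d M P) (hT : Measurable T₀)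
    (hp0 : Pot d K c T₀ S₀ f₀ fs₀) (hp : Pot d K c T S f fs) :
    c * disc d P T₀ S ≤ (∫ x, (f (clampC d x) - f₀ (clampC d x)) ∂P) +
      (∫ y, (fs (clampC d y) - fs₀ (clampC d y)) ∂(P.map T₀)) ∧
    (∫ x, (f (clampC d x) - f₀ (clampC d x)) ∂P) +
      (∫ y, (fs (clampC d y) - fs₀ (clampC d y)) ∂(P.map T₀)) ≤ K * disc d P T₀ S := by
  have := hP.prob
  have hQp : IsProbabilityMeasure (P.map T₀) := Measure.isProbabilityMeasure_map hT.aemeasurable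
  have hc1 : Continuous fun x => f (clampC d x) - f₀ (clampC d x) :=
    (comp_clampC_cont hp.c1.cont).sub (comp_clampC_cont hp0.c1.cont)
  have hc2 : Continuous fun x => fs (clampC d x) - fs₀ (clampC d x) :=
    (comp_clampC_cont hp.c2.cont).sub (comp_clampC_cont hp0.c2.cont)
  have hi1 := cont_integrable (P_le hP) hc1
  have hi2 := cont_integrable (Q_le hK hM.le hP hT hp0) hc2
  have hi3 := cont_integrable (P_le hP) (disc_cont hK hp0 hp)
  have hi2' : Integrable (fun x => fs (clampC d (T₀ x)) - fs₀ (clampC d (T₀ x))) P :=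
    hi2.comp_measurable hT
  rw [integral_map hT.aemeasurable hc2.aestronglyMeasurable, ← integral_add hi1 hi2']
  have key : ∀ x ∈ unitCube d, f (clampC d x) - f₀ (clampC d x) +
      (fs (clampC d (T₀ x)) - fs₀ (clampC d (T₀ x))) = f x + fs (T₀ x) - ⟪x, T₀ x⟫ := by
    intro x hx
    have h0 := hp0.mapT x hx
    rw [clampC_id hx, clampC_id h0]
    have h1 := hp0.lower x hx x hx
    have h2 := hp0.upper x hx x hx
    rw [sub_self, norm_zero] at h1 h2
    norm_num at h1 h2
    linarith
  unfold disc
  rw [← integral_const_mul, ← integral_const_mul]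
  constructor
  · refine integral_mono_ae (hi3.const_mul _) (hi1.add hi2') ?_
    filter_upwards [P_ae hP] with x hx
    rw [key x hx, clampC_id hx]
    have h0 := hp0.mapT x hx
    have h1 := hp.lower x hx _ (hp.mapS _ h0)
    rwa [hp.TS _ h0] at h1
  · refine integral_mono_ae (hi1.add hi2') (hi3.const_mul _) ?_
    filter_upwards [P_ae hP] with x hx
    rw [key x hx, clampC_id hx]
    have h0 := hp0.mapT x hx
    have h1 := hp.upper x hx _ (hp.mapS _ h0)
    rwa [hp.TS _ h0] at h1

lemma intT_le (hK : 0 ≤ K) (hM : 0 < M) (hP : MemM d M P)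
    (hp0 : Pot d K c T₀ S₀ f₀ fs₀) (hp : Pot d K c T S f fs) :
    ∫ x in unitCube d, ‖T (clampC d x) - T₀ (clampC d x)‖ ^ 2 ≤ M * K ^ 2 * disc d P T₀ S := by
  have := hP.prob
  have hc : Continuous fun x => ‖T (clampC d x) - T₀ (clampC d x)‖ ^ 2 :=
    ((contT hK hp).sub (contT hK hp0)).norm.pow 2
  refine (cube_le_integral hM.le (le_P hM hP) (fun x => by positivity) (cont_integrable (P_le hP) hc)).trans ?_
  rw [mul_assoc]
  refine mul_le_mul_of_nonneg_left ?_ hM.le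
  unfold disc
  rw [← integral_const_mul]
  refine integral_mono (cont_integrable (P_le hP) hc)
    ((cont_integrable (P_le hP) (disc_cont hK hp0 hp)).const_mul _) fun x => ?_
  simp only
  rw [← mul_pow]
  exact pow_le_pow_left₀ (norm_nonneg _) (T_le hp0 hp (clampC_mem x)) 2

lemma intS_le (hK : 0 ≤ K) (hM : 0 < M) (hP : MemM d M P) (hT : Measurable T₀)
    (hp0 : Pot d K c T₀ S₀ f₀ fs₀) (hp : Pot d K c T S f fs) :
    ∫ x in unitCube d, ‖S (clampC d x) - S₀ (clampC d x)‖ ^ 2 ≤ M * K ^ d * disc d P T₀ S := by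
  have := hP.prob
  have hQp : IsProbabilityMeasure (P.map T₀) := Measure.isProbabilityMeasure_map hT.aemeasurable
  have hc : Continuous fun x => ‖S (clampC d x) - S₀ (clampC d x)‖ ^ 2 :=
    ((contS hK hp).sub (contS hK hp0)).norm.pow 2
  refine (cube_le_integral (by positivity) (le_Q hK hM hP hT hp0) (fun x => by positivity)
    (cont_integrable (Q_le hK hM.le hP hT hp0) hc)).trans ?_
  refine mul_le_mul_of_nonneg_left ?_ (by positivity)
  rw [integral_map hT.aemeasurable hc.aestronglyMeasurable]
  unfold disc
  apply le_of_eq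
  refine integral_congr_ae ?_
  filter_upwards [P_ae hP] with x hx
  have h0 := hp0.mapT x hx
  rw [clampC_id hx, clampC_id h0, hp0.ST x hx, norm_sub_rev]

lemma lint_le (hK : 0 ≤ K) (hP : MemM d M P)
    (hp0 : Pot d K c T₀ S₀ f₀ fs₀) (hp : Pot d K c T S f fs) :
    ∫⁻ x, (‖T (clampC d x) - T₀ x‖₊ : ℝ≥0∞) ^ 2 ∂P ≤ ENNReal.ofReal (K ^ 2 * disc d P T₀ S) := by
  have := hP.prob
  unfold disc
  rw [← integral_const_mul, ofReal_integral_eq_lintegral_ofReal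
    ((cont_integrable (P_le hP) (disc_cont hK hp0 hp)).const_mul _)
    (Filter.Eventually.of_forall fun x => by positivity)]
  refine lintegral_mono_ae ?_
  filter_upwards [P_ae hP] with x hx
  rw [clampC_id hx, ← mul_pow]
  have := T_le hp0 hp hx
  rw [ENNReal.ofReal_pow (by positivity)]
  refine pow_le_pow_left' ?_ 2
  rw [← enorm_eq_nnnorm, ← ofReal_norm]
  exact ENNReal.ofReal_le_ofReal this

lemma disc_le (hK : 0 ≤ K) (hP : MemM d M P)
    (hp0 : Pot d K c T₀ S₀ f₀ fs₀) (hp : Pot d K c T S f fs) {ε : ℝ}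
    (hε : ∀ x ∈ unitCube d, ‖T₀ x - T x‖ ≤ ε) : disc d P T₀ S ≤ K ^ 2 * ε ^ 2 := by
  have := hP.prob
  unfold disc
  calc _ ≤ ∫ _, K ^ 2 * ε ^ 2 ∂P := by
        refine integral_mono (cont_integrable (P_le hP) (disc_cont hK hp0 hp)) (integrable_const _) fun x => ?_
        simp only
        rw [← mul_pow]
        refine pow_le_pow_left₀ (norm_nonneg _) ((le_T hp0 hp (clampC_mem x)).trans ?_) 2
        exact mul_le_mul_of_nonneg_left (hε _ (clampC_mem x)) hK
    _ = _ := by simp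

end

lemma nu_integral {Ω : Type*} [MeasurableSpace Ω] (μ : Measure Ω) [IsProbabilityMeasure μ] {n : ℕ} (hn : 1 ≤ n)
    {h : Ω → ℝ} (hh : Integrable h μ) :
    Integrable (fun xs : Fin n → Ω => (n:ℝ)⁻¹ * ∑ i, h (xs i)) (Measure.pi fun _ => μ) ∧
    ∫ xs : Fin n → Ω, (n:ℝ)⁻¹ * ∑ i, h (xs i) ∂(Measure.pi fun _ => μ) = ∫ x, h x ∂μ := by
  have hn0 : (n:ℝ) ≠ 0 := by positivity
  have hi : ∀ i : Fin n, Integrable (fun xs : Fin n → Ω => h (xs i)) (Measure.pi fun _ => μ) := fun i =>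
    (measurePreserving_eval (fun _ : Fin n => μ) i).integrable_comp_of_integrable hh
  refine ⟨(integrable_finsetSum _ fun i _ => hi i).const_mul _, ?_⟩
  rw [integral_const_mul, integral_finsetSum _ fun i _ => hi i]
  have : ∀ i : Fin n, ∫ xs : Fin n → Ω, h (xs i) ∂(Measure.pi fun _ => μ) = ∫ x, h x ∂μ := fun i =>
    integral_comp_eval (μ := fun _ : Fin n => μ) (i := i) (f := h) hh.aestronglyMeasurable
  simp [this, hn0]

lemma exists_argmin {Ω I : Type*} [MeasurableSpace Ω] [Fintype I] [Nonempty I] (u : I → Ω → ℝ)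
    (hu : ∀ i, Measurable (u i)) :
    ∃ j : Ω → I, (@Measurable _ _ _ ⊤ j) ∧ ∀ ω i, u (j ω) ω ≤ u i ω := by
  let _ : MeasurableSpace I := ⊤
  have : DiscreteMeasurableSpace I := ⟨fun _ => trivial⟩
  classical
  have H : ∀ s : Finset I, s.Nonempty → ∃ j : Ω → I, Measurable j ∧ ∀ ω, ∀ i ∈ s, u (j ω) ω ≤ u i ω := by
    intro s hs
    induction hs using Finset.Nonempty.cons_induction with
    | singleton a => exact ⟨fun _ => a, measurable_const, by simp⟩
    | cons a s ha hs ih =>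
      obtain ⟨j, hj, hmin⟩ := ih
      have hm : Measurable fun ω => u (j ω) ω := by
        have h2 : Measurable (fun p : I × Ω => u p.1 p.2) := measurable_from_prod_countable_right hu
        exact h2.comp (hj.prodMk measurable_id)
      refine ⟨fun ω => if u a ω ≤ u (j ω) ω then a else j ω,
        Measurable.ite (measurableSet_le (hu a) hm) measurable_const hj, ?_⟩
      intro ω i hi
      rw [Finset.mem_cons] at hi
      by_cases h : u a ω ≤ u (j ω) ω
      · simp only [h, if_true]
        rcases hi with rfl | hi
        · exact le_rfl
        · exact h.trans (hmin ω i hi)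
      · simp only [h, if_false]
        rcases hi with rfl | hi
        · exact (not_le.1 h).le
        · exact hmin ω i hi
  obtain ⟨j, hj, hmin⟩ := H Finset.univ Finset.univ_nonempty
  exact ⟨j, hj, fun ω i => hmin ω i (Finset.mem_univ i)⟩

lemma risk_lemma (d : ℕ) {α M R : ℝ} (hα : 1 < α) (hR : 1 < R) (hM : 0 < M)
    (hne : (Cls d α M R).Nonempty) :
    ∃ C : ℝ, 0 < C ∧ ∀ J n : ℕ, 1 ≤ n →
      ∃ Th : (Fin n → Eu d) → (Fin n → Eu d) → Eu d → Eu d,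
        Measurable (fun p : (Fin n → Eu d) × (Fin n → Eu d) × Eu d => Th p.1 p.2.1 p.2.2) ∧
        ∀ (P : Measure (Eu d)) (T₀ : Eu d → Eu d), Admissible d α M R P T₀ →
          transportRisk d n P T₀ Th ≤ ENNReal.ofReal
            (C * (((((1:ℝ) / 2) ^ J) ^ α) ^ 2 + (∑ j ∈ Finset.range (J + 1), wt d j) ^ 2 / n +
              (1 / 4) ^ J * (2 ^ (J * d) * (J + 1)) / n)) := by
  obtain ⟨K, c, hK, hc, hpot⟩ := exists_pot d hα (by linarith : (0:ℝ) ≤ R) hM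
  obtain ⟨Cn, hCn, hnet⟩ := exists_net d hα hR hne
  set κ : ℝ := c / (2 * (M * K ^ 2 + M * K ^ d)) with hκ
  have hκp : 0 < κ := by positivity
  have hκe : κ * (M * K ^ 2 + M * K ^ d) = c / 2 := by rw [hκ]; field_simp
  obtain ⟨C1, hC1, hep1⟩ := ep_lemma d (K := 2 * K) (C₀ := M) (κ := κ) (by positivity) hM hκp
  obtain ⟨C2, hC2, hep2⟩ := ep_lemma d (K := 2 * K) (C₀ := M * K ^ d) (κ := κ) (by positivity) (by positivity) hκp
  set k : ℝ := K ^ 2 * (2 / c) with hk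
  have hkp : 0 < k := by positivity
  refine ⟨k * (C1 + C2 + (C1 + C2) * Cn + K * (K ^ 2 * Cn ^ 2)), by positivity, fun J n hn => ?_⟩
  have hn0 : (0:ℝ) < n := by exact_mod_cast hn
  obtain ⟨I, hI1, hI2, net, hnetC, hcov, hcard⟩ := hnet J
  choose S f fs hp using fun j => hpot (net j) (hnetC j)
  -- the criterion
  have hfc : ∀ j, Continuous fun x => f j (clampC d x) := fun j => comp_clampC_cont (hp j).c1.cont
  have hfsc : ∀ j, Continuous fun x => fs j (clampC d x) := fun j => comp_clampC_cont (hp j).c2.cont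
  obtain ⟨jh, hjm, hjmin⟩ := exists_argmin (Ω := (Fin n → Eu d) × (Fin n → Eu d)) (I := I)
    (fun j ω => (n:ℝ)⁻¹ * ∑ i, f j (clampC d (ω.1 i)) + (n:ℝ)⁻¹ * ∑ i, fs j (clampC d (ω.2 i)))
    (fun j => by
      have h1 := (hfc j).measurable
      have h2 := (hfsc j).measurable
      refine Measurable.add (Measurable.const_mul (Finset.measurable_sum _ fun i _ => ?_) _)
        (Measurable.const_mul (Finset.measurable_sum _ fun i _ => ?_) _)
      · exact h1.comp ((measurable_pi_apply i).comp measurable_fst)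
      · exact h2.comp ((measurable_pi_apply i).comp measurable_snd))
  refine ⟨fun xs ys x => net (jh (xs, ys)) (clampC d x), ?_, ?_⟩
  · let _ : MeasurableSpace I := ⊤
    have : DiscreteMeasurableSpace I := ⟨fun _ => trivial⟩
    have h2 : Measurable (fun p : I × Eu d => net p.1 (clampC d p.2)) :=
      measurable_from_prod_countable_right fun j => (contT hK.le (hp j)).measurable
    exact h2.comp (((hjm.comp (measurable_fst.prodMk (measurable_fst.comp measurable_snd)))).prodMk
      (measurable_snd.comp measurable_snd))
  intro P T₀ hadm
  have hT0 := adm_cls hα (by linarith) hadm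
  obtain ⟨S₀, f₀, fs₀, hp0⟩ := hpot T₀ hT0
  have hPprob := hadm.memM.prob
  have hT := hadm.meas
  have hP := hadm.memM
  set Q : Measure (Eu d) := P.map T₀ with hQ
  have hQprob : IsProbabilityMeasure Q := Measure.isProbabilityMeasure_map hT.aemeasurable
  have hf0c : Continuous fun x => f₀ (clampC d x) := comp_clampC_cont hp0.c1.cont
  have hfs0c : Continuous fun x => fs₀ (clampC d x) := comp_clampC_cont hp0.c2.cont
  obtain ⟨a, hai, ha, hale⟩ := hep1 P (P_le hP) I (fun j x => f j (clampC d x) - f₀ (clampC d x))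
    (fun j x => net j (clampC d x) - T₀ (clampC d x))
    (fun j => (hp j).c1.comp_clamp.sub hp0.c1.comp_clamp)
    (fun j => (hfc j).sub hf0c) (fun j => (contT hK.le (hp j)).sub (contT hK.le hp0)) n hn J
  obtain ⟨b, hbi, hb, hble⟩ := hep2 Q (Q_le hK.le hM.le hP hT hp0) I
    (fun j x => fs j (clampC d x) - fs₀ (clampC d x))
    (fun j x => S j (clampC d x) - S₀ (clampC d x))
    (fun j => (hp j).c2.comp_clamp.sub hp0.c2.comp_clamp)
    (fun j => (hfsc j).sub hfs0c) (fun j => (contS hK.le (hp j)).sub (contS hK.le hp0)) n hn J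
  obtain ⟨e, he⟩ := hcov T₀ hT0
  obtain ⟨i1, v1⟩ := nu_integral P hn (cont_integrable (P_le hP) ((hfc e).sub hf0c))
  obtain ⟨i2, v2⟩ := nu_integral Q hn (cont_integrable (Q_le hK.le hM.le hP hT hp0) ((hfsc e).sub hfs0c))
  set A : (Fin n → Eu d) → ℝ := fun xs => a xs + (n:ℝ)⁻¹ * ∑ i, (f e (clampC d (xs i)) - f₀ (clampC d (xs i))) with hA
  set B : (Fin n → Eu d) → ℝ := fun ys => b ys + (n:ℝ)⁻¹ * ∑ i, (fs e (clampC d (ys i)) - fs₀ (clampC d (ys i))) with hB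
  have hAi : Integrable A (Measure.pi fun _ => P) := hai.add i1
  have hBi : Integrable B (Measure.pi fun _ => Q) := hbi.add i2
  have hAv : ∫ xs, A xs ∂(Measure.pi fun _ => P) = ∫ xs, a xs ∂(Measure.pi fun _ => P) +
      ∫ x, (f e (clampC d x) - f₀ (clampC d x)) ∂P := by
    refine (integral_add hai i1).trans ?_
    rw [v1]; rfl
  have hBv : ∫ xs, B xs ∂(Measure.pi fun _ => Q) = ∫ xs, b xs ∂(Measure.pi fun _ => Q) +
      ∫ x, (fs e (clampC d x) - fs₀ (clampC d x)) ∂Q := by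
    refine (integral_add hbi i2).trans ?_
    rw [v2]; rfl
  -- basic inequality
  have hbasic : ∀ xs ys, disc d P T₀ (S (jh (xs, ys))) ≤ 2 / c * (A xs + B ys) := by
    intro xs ys
    set j := jh (xs, ys) with hj
    have h1 := (gap_bounds hK.le hM hP hT hp0 (hp j)).1
    have h2 := ha xs j
    have h3 := hb ys j
    have h4 := hjmin (xs, ys) e
    have h5 := mul_le_mul_of_nonneg_left (intT_le hK.le hM hP hp0 (hp j)) hκp.le
    have h6 := mul_le_mul_of_nonneg_left (intS_le hK.le hM hP hT hp0 (hp j)) hκp.le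
    simp only [nu] at h2 h3
    simp only at h4
    rw [← hj] at h4
    have h7 : κ * (M * K ^ 2 * disc d P T₀ (S j)) + κ * (M * K ^ d * disc d P T₀ (S j)) =
        c / 2 * disc d P T₀ (S j) := by rw [← hκe]; ring
    have h8 : c / 2 * disc d P T₀ (S j) ≤ A xs + B ys := by
      simp only [hA, hB]
      simp only [Finset.sum_sub_distrib, mul_sub] at h2 h3 ⊢
      linarith
    calc disc d P T₀ (S j) = 2 / c * (c / 2 * disc d P T₀ (S j)) := by field_simp
      _ ≤ _ := by gcongr
  have hAB : ∀ xs ys, 0 ≤ A xs + B ys := by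
    intro xs ys
    have h1 := hbasic xs ys
    have h2 := disc_nonneg d P T₀ (S (jh (xs, ys)))
    have h3 : 0 ≤ 2 / c * (A xs + B ys) := h2.trans h1
    exact (mul_nonneg_iff_of_pos_left (by positivity)).1 h3
  have hr : transportRisk d n P T₀ (fun xs ys x => net (jh (xs, ys)) (clampC d x)) ≤
      ENNReal.ofReal (k * (∫ xs, A xs ∂(Measure.pi fun _ => P) + ∫ ys, B ys ∂(Measure.pi fun _ => Q))) := by
    unfold transportRisk
    calc _ ≤ ∫⁻ xs, (∫⁻ ys, ENNReal.ofReal (k * (A xs + B ys)) ∂(Measure.pi fun _ : Fin n => Q))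
            ∂(Measure.pi fun _ : Fin n => P) := by
          refine lintegral_mono fun xs => lintegral_mono fun ys => ?_
          refine (lint_le hK.le hP hp0 (hp (jh (xs, ys)))).trans (ENNReal.ofReal_le_ofReal ?_)
          rw [hk, mul_assoc]
          exact mul_le_mul_of_nonneg_left (hbasic xs ys) (by positivity)
      _ = ∫⁻ xs, ENNReal.ofReal (k * (A xs + ∫ ys, B ys ∂(Measure.pi fun _ : Fin n => Q)))
            ∂(Measure.pi fun _ : Fin n => P) := by
          refine lintegral_congr fun xs => ?_
          have z1 : Integrable (fun ys => k * (A xs + B ys)) (Measure.pi fun _ : Fin n => Q) :=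
            ((integrable_const _).add hBi).const_mul _
          rw [← ofReal_integral_eq_lintegral_ofReal z1
            (Filter.Eventually.of_forall fun ys => mul_nonneg hkp.le (hAB xs ys)),
            integral_const_mul, integral_add (integrable_const _) hBi]
          simp
      _ = _ := by
          have h0 : ∀ xs, 0 ≤ A xs + ∫ ys, B ys ∂(Measure.pi fun _ : Fin n => Q) := by
            intro xs
            have h1 : 0 ≤ ∫ ys, (A xs + B ys) ∂(Measure.pi fun _ : Fin n => Q) :=
              integral_nonneg fun ys => hAB xs ys
            rw [integral_add (integrable_const _) hBi] at h1
            simpa using h1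
          have z1 : Integrable (fun xs => k * (A xs + ∫ ys, B ys ∂(Measure.pi fun _ : Fin n => Q)))
            (Measure.pi fun _ : Fin n => P) := (hAi.add (integrable_const _)).const_mul _
          rw [← ofReal_integral_eq_lintegral_ofReal z1
            (Filter.Eventually.of_forall fun xs => mul_nonneg hkp.le (h0 xs)),
            integral_const_mul, integral_add hAi (integrable_const _)]
          simp
  refine hr.trans (ENNReal.ofReal_le_ofReal ?_)
  rw [mul_assoc k]
  refine mul_le_mul_of_nonneg_left ?_ hkp.le
  have g1 := (gap_bounds hK.le hM hP hT hp0 (hp e)).2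
  have g2 := mul_le_mul_of_nonneg_left (disc_le hK.le hP hp0 (hp e) he) hK.le
  rw [hAv, hBv]
  set W : ℝ := (∑ j ∈ Finset.range (J + 1), wt d j) ^ 2 / n with hW
  set V : ℝ := (1 / 4) ^ J * (2 ^ (J * d) * (J + 1)) / n with hV
  set E : ℝ := (((1:ℝ) / 2) ^ J) ^ α with hE
  have hW0 : 0 ≤ W := by positivity
  have hV0 : 0 ≤ V := by positivity
  have hL : (1 / 4) ^ J * Real.log (Fintype.card I) / n ≤ Cn * V := by
    rw [hV]
    calc (1 / 4 : ℝ) ^ J * Real.log (Fintype.card I) / n ≤ (1 / 4) ^ J * (Cn * 2 ^ (J * d) * (J + 1)) / n := by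
          gcongr
      _ = _ := by ring
  have l1 := hale.trans (mul_le_mul_of_nonneg_left (add_le_add_right hL _) hC1.le)
  have l2 := hble.trans (mul_le_mul_of_nonneg_left (add_le_add_right hL _) hC2.le)
  rw [← hQ] at g1
  have hfin : C1 * (W + Cn * V) + C2 * (W + Cn * V) + K * (K ^ 2 * (Cn * E) ^ 2) ≤
      (C1 + C2 + (C1 + C2) * Cn + K * (K ^ 2 * Cn ^ 2)) * (E ^ 2 + W + V) := by
    have q1 : 0 ≤ (C1 + C2) * (E ^ 2 + V) := by positivity
    have q2 : 0 ≤ (C1 + C2) * Cn * (E ^ 2 + W) := by positivity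
    have q3 : 0 ≤ K * (K ^ 2 * Cn ^ 2) * (W + V) := by positivity
    nlinarith
  linarith

/-! ### Choice of the resolution level -/

lemma wt_base (d j : ℕ) : ((2:ℝ) ^ j) ^ d * (1 / 4) ^ j = ((2:ℝ) ^ d / 4) ^ j := by
  rw [← pow_mul, mul_comm j d, pow_mul, ← mul_pow]; congr 1; ring

lemma wt_one_sum (J : ℕ) : ∑ j ∈ Finset.range (J + 1), wt 1 j ≤ 4 := by
  have hq : Real.sqrt (1 / 2) ≤ 3 / 4 := by
    rw [Real.sqrt_le_left (by norm_num)]; norm_num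
  have h1 : ∀ j, wt 1 j ≤ (3 / 4) ^ j := by
    intro j
    unfold wt
    rw [wt_base]
    rw [Real.sqrt_le_left (by positivity), ← pow_mul, mul_comm, pow_mul]
    gcongr
    norm_num
  calc _ ≤ ∑ j ∈ Finset.range (J + 1), (3 / 4 : ℝ) ^ j := Finset.sum_le_sum fun j _ => h1 j
    _ ≤ 4 := by
      rw [geom_sum_eq (by norm_num)]
      have : (0:ℝ) ≤ (3 / 4) ^ (J + 1) := by positivity
      rw [div_le_iff_of_neg (by norm_num)]
      linarith

lemma wt_sum_le {d : ℕ} (hd : 2 ≤ d) (J : ℕ) :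
    (∑ j ∈ Finset.range (J + 1), wt d j) ^ 2 ≤ (J + 1) ^ 2 * ((2:ℝ) ^ d / 4) ^ J := by
  have hb : (1:ℝ) ≤ (2:ℝ) ^ d / 4 := by
    have : (2:ℝ) ^ 2 ≤ 2 ^ d := pow_le_pow_right₀ (by norm_num) hd
    linarith
  have h1 : ∀ j ∈ Finset.range (J + 1), wt d j ≤ wt d J := by
    intro j hj
    unfold wt
    rw [wt_base, wt_base]
    exact Real.sqrt_le_sqrt (pow_le_pow_right₀ hb (by rw [Finset.mem_range] at hj; omega))
  have h2 := Finset.sum_le_sum h1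
  rw [Finset.sum_const, Finset.card_range, nsmul_eq_mul] at h2
  have h3 : (0:ℝ) ≤ ∑ j ∈ Finset.range (J + 1), wt d j := Finset.sum_nonneg fun j _ => (wt_pos d j).le
  calc _ ≤ (((J + 1 : ℕ) : ℝ) * wt d J) ^ 2 := pow_le_pow_left₀ h3 h2 2
    _ = _ := by rw [mul_pow, wt_sq, wt_base]; push_cast; ring

lemma numerics {d : ℕ} (hd : 1 ≤ d) {α : ℝ} (hα : 1 < α) :
    ∃ C : ℝ, 0 < C ∧ ∀ n : ℕ, 3 ≤ n → ∃ J : ℕ,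
      (((((1:ℝ) / 2) ^ J) ^ α) ^ 2 + (∑ j ∈ Finset.range (J + 1), wt d j) ^ 2 / n +
        (1 / 4) ^ J * (2 ^ (J * d) * (J + 1)) / n) ≤
      C * max ((n : ℝ) ^ (-(2 * α) / (2 * α - 2 + d)) * Real.log n ^ 2) ((n : ℝ)⁻¹) := by
  have hd1 : (1:ℝ) ≤ d := by exact_mod_cast hd
  set β : ℝ := 2 * α - 2 + d with hβ
  have hβ1 : 1 ≤ β := by rw [hβ]; linarith
  have hβ0 : 0 < β := by linarith
  set c0 : ℝ := 1 / (β * Real.log 2) + 1 with hc0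
  have hl2 : 0 < Real.log 2 := Real.log_pos (by norm_num)
  have hc0p : 0 < c0 := by positivity
  refine ⟨(2:ℝ) ^ (2 * α) + 2 * c0 ^ 2 + 17, by positivity, fun n hn => ?_⟩
  have hn3 : (3:ℝ) ≤ n := by exact_mod_cast hn
  have hn0 : (0:ℝ) < n := by linarith
  have hlog : 1 ≤ Real.log n := by
    rw [Real.le_log_iff_exp_le hn0]
    exact (Real.exp_one_lt_d9.le.trans (by norm_num)).trans hn3
  set L : ℝ := Real.log n / (β * Real.log 2) with hL
  have hL0 : 0 ≤ L := by positivity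
  have h2L : ∀ s : ℝ, (2:ℝ) ^ (L * s) = (n:ℝ) ^ (s / β) := by
    intro s
    rw [Real.rpow_def_of_pos (by norm_num), Real.rpow_def_of_pos hn0, hL]
    congr 1
    field_simp
  set J : ℕ := ⌊L⌋₊ with hJ
  have hJL : (J:ℝ) ≤ L := Nat.floor_le hL0
  have hLJ : L < J + 1 := Nat.lt_floor_add_one L
  have hJ1 : (J:ℝ) + 1 ≤ c0 * Real.log n := by
    calc (J:ℝ) + 1 ≤ L + 1 * Real.log n := by linarith
      _ = c0 * Real.log n := by rw [hL, hc0]; ring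
  set r : ℝ := (n:ℝ) ^ (-(2 * α) / β) with hr
  have hr0 : 0 < r := by positivity
  set m := max (r * Real.log n ^ 2) ((n:ℝ)⁻¹) with hm
  have hm1 : r * Real.log n ^ 2 ≤ m := le_max_left _ _
  have hm2 : (n:ℝ)⁻¹ ≤ m := le_max_right _ _
  have hm0 : 0 < m := lt_of_lt_of_le (by positivity) hm2
  have hrm : r ≤ m := by
    refine le_trans ?_ hm1
    have : 1 ≤ Real.log n ^ 2 := one_le_pow₀ hlog
    nlinarith
  refine ⟨J, ?_⟩
  -- bias
  have e1 : ((((1:ℝ) / 2) ^ J) ^ α) ^ 2 ≤ (2:ℝ) ^ (2 * α) * m := by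
    have : ((((1:ℝ) / 2) ^ J) ^ α) ^ 2 = (2:ℝ) ^ (-(2 * α) * J) := by
      have hh : ((1:ℝ) / 2) ^ J = (2:ℝ) ^ (-(J:ℝ)) := by
        rw [Real.rpow_neg (by norm_num), Real.rpow_natCast, one_div, inv_pow]
      rw [hh, ← Real.rpow_mul (by norm_num), ← Real.rpow_natCast, ← Real.rpow_mul (by norm_num)]
      congr 1
      push_cast; ring
    rw [this]
    calc (2:ℝ) ^ (-(2 * α) * J) ≤ (2:ℝ) ^ (2 * α + L * (-(2 * α))) := by
          apply Real.rpow_le_rpow_of_exponent_le (by norm_num)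
          nlinarith
      _ = (2:ℝ) ^ (2 * α) * r := by rw [Real.rpow_add (by norm_num), h2L]
      _ ≤ _ := by gcongr
  have e3' : (1 / 4 : ℝ) ^ J * (2 ^ (J * d) * (J + 1)) = (J + 1) * ((2:ℝ) ^ d / 4) ^ J := by
    rw [← wt_base, pow_mul]; ring
  rcases Nat.lt_or_ge d 2 with hlt | hge
  · have hd' : d = 1 := by omega
    have e2 : (∑ j ∈ Finset.range (J + 1), wt d j) ^ 2 / n ≤ 16 * m := by
      have h1 : ∑ j ∈ Finset.range (J + 1), wt d j ≤ 4 := by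
        rw [hd']; exact wt_one_sum J
      have h3 : (0:ℝ) ≤ ∑ j ∈ Finset.range (J + 1), wt d j := Finset.sum_nonneg fun j _ => (wt_pos d j).le
      calc _ ≤ (4:ℝ) ^ 2 / n := by gcongr
        _ = 16 * (n:ℝ)⁻¹ := by ring
        _ ≤ _ := by gcongr
    have e3 : (1 / 4 : ℝ) ^ J * (2 ^ (J * d) * (J + 1)) / n ≤ m := by
      rw [e3', hd']
      have h1 : (J:ℝ) + 1 ≤ 2 ^ J := by exact_mod_cast (Nat.lt_two_pow_self (n := J))
      have h2 : ((J:ℝ) + 1) * ((2:ℝ) ^ 1 / 4) ^ J ≤ 1 := by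
        calc _ ≤ (2:ℝ) ^ J * ((2:ℝ) ^ 1 / 4) ^ J := by gcongr
          _ = 1 := by rw [← mul_pow]; norm_num
      calc _ ≤ 1 / (n:ℝ) := by gcongr
        _ = (n:ℝ)⁻¹ := one_div _
        _ ≤ m := hm2
    have : 0 ≤ c0 ^ 2 * m := by positivity
    linarith
  · have hbase : ((2:ℝ) ^ d / 4) ^ J / n ≤ r := by
      have h2d : (2:ℝ) ≤ d := by exact_mod_cast hge
      have h1 : ((2:ℝ) ^ d / 4) ^ J = (2:ℝ) ^ (J * ((d:ℝ) - 2)) := by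
        rw [mul_comm, Real.rpow_mul (by norm_num), Real.rpow_natCast, Real.rpow_sub (by norm_num), Real.rpow_natCast]
        norm_num
      rw [h1]
      calc (2:ℝ) ^ (J * ((d:ℝ) - 2)) / n ≤ (2:ℝ) ^ (L * ((d:ℝ) - 2)) / n := by
            have h5 : (J:ℝ) * ((d:ℝ) - 2) ≤ L * ((d:ℝ) - 2) :=
              mul_le_mul_of_nonneg_right hJL (by linarith)
            exact div_le_div_of_nonneg_right
              (Real.rpow_le_rpow_of_exponent_le (by norm_num) h5) hn0.le
        _ = r := by
            have hexp : ((d:ℝ) - 2) / β - 1 = -(2 * α) / β := by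
              rw [div_sub_one hβ0.ne', hβ]; congr 1; ring
            rw [h2L, hr, ← hexp, Real.rpow_sub hn0, Real.rpow_one]
    have hsq : ((J:ℝ) + 1) ^ 2 * (((2:ℝ) ^ d / 4) ^ J / n) ≤ c0 ^ 2 * m := by
      calc _ ≤ (c0 * Real.log n) ^ 2 * r := by gcongr
        _ = c0 ^ 2 * (r * Real.log n ^ 2) := by ring
        _ ≤ _ := by gcongr
    have e2 : (∑ j ∈ Finset.range (J + 1), wt d j) ^ 2 / n ≤ c0 ^ 2 * m := by
      refine le_trans ?_ hsq
      rw [← mul_div_assoc]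
      gcongr
      exact wt_sum_le hge J
    have e3 : (1 / 4 : ℝ) ^ J * (2 ^ (J * d) * (J + 1)) / n ≤ c0 ^ 2 * m := by
      refine le_trans ?_ hsq
      rw [e3', mul_div_assoc]
      have : (J:ℝ) + 1 ≤ ((J:ℝ) + 1) ^ 2 := by
        have : (0:ℝ) ≤ J := by positivity
        nlinarith
      gcongr
    linarith

/-- **Near-minimax upper bound for the estimation of smooth optimal transport maps**
(Theorem 3.2 / Theorem 5.4 of Hütter–Rigollet, Minimax estimation of smooth optimal
transport maps). For every `d ≥ 1`, `α > 1`, `M ≥ 2` and `R > 1` there are `C > 0` and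
`n₀ ∈ ℕ` such that for every `n ≥ n₀` there is a measurable estimator `T̂`, based on `n`
i.i.d. samples from `P` and `n` i.i.d. samples from `(T₀)_# P`, whose risk over every
admissible pair `(P, T₀)` is at most `C·max(n^{−2α/(2α−2+d)}(log n)², n^{−1})`. -/
theorem transport_map_minimax_upper_bound
    (d : ℕ) (hd : 1 ≤ d) (α : ℝ) (hα : 1 < α) (M : ℝ) (hM : 2 ≤ M) (R : ℝ) (hR : 1 < R) :
    ∃ C : ℝ, 0 < C ∧ ∃ n₀ : ℕ, ∀ n : ℕ, n₀ ≤ n →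
      ∃ Th : (Fin n → EuclideanSpace ℝ (Fin d)) → (Fin n → EuclideanSpace ℝ (Fin d)) →
          EuclideanSpace ℝ (Fin d) → EuclideanSpace ℝ (Fin d),
        Measurable (fun p : (Fin n → EuclideanSpace ℝ (Fin d)) ×
            (Fin n → EuclideanSpace ℝ (Fin d)) × EuclideanSpace ℝ (Fin d) =>
            Th p.1 p.2.1 p.2.2) ∧
        ∀ (P : Measure (EuclideanSpace ℝ (Fin d)))
          (T₀ : EuclideanSpace ℝ (Fin d) → EuclideanSpace ℝ (Fin d)),
          Admissible d α M R P T₀ →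
          transportRisk d n P T₀ Th
            ≤ ENNReal.ofReal
                (C * max ((n : ℝ) ^ (-(2 * α) / (2 * α - 2 + d)) * Real.log n ^ 2)
                  ((n : ℝ)⁻¹)) := by
  by_cases hne : (Cls d α M R).Nonempty
  · obtain ⟨C, hC, h⟩ := risk_lemma d hα hR (by linarith : (0:ℝ) < M) hne
    obtain ⟨C', hC', h'⟩ := numerics hd hα
    refine ⟨C * C', by positivity, 3, fun n hn => ?_⟩
    obtain ⟨J, hJ⟩ := h' n hn
    obtain ⟨Th, hTm, hTr⟩ := h J n (by omega)
    refine ⟨Th, hTm, fun P T₀ hadm => (hTr P T₀ hadm).trans (ENNReal.ofReal_le_ofReal ?_)⟩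
    rw [mul_assoc]
    exact mul_le_mul_of_nonneg_left hJ hC.le
  · refine ⟨1, one_pos, 0, fun n _ => ⟨fun _ _ _ => 0, measurable_const, fun P T₀ hadm => ?_⟩⟩
    exact absurd ⟨T₀, adm_cls hα (by linarith) hadm⟩ hne

end
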